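/- Let C be a smooth projective plane quartic curve over a number field k with C(k) ≠ ∅. Then every quadratic (i.e. 2-level) arithmetic or geometric progression sequence on C is of finite length, yet for every n ≥ 3 the curve C admits an n-level progression sequence of infinite length (since C is trigonal: gon(C,k) = 3). -/

import Mathlib

open MvPolynomial

set_option synthInstance.maxHeartbeats 1000000
set_option maxHeartbeats 1000000

noncomputable section

/-- `F` defines a smooth projective plane curve of degree `d` over `k`: it is homogeneous of
degree `d` and, over the algebraic closure of `k`, `F` and its partial derivatives have no
common nontrivial zero (the Jacobian criterion for smoothness of the plane curve `F = 0`). -/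
def IsSmoothPlaneCurve {k : Type} [Field k] (d : ℕ) (F : MvPolynomial (Fin 3) k) : Prop :=
  F.IsHomogeneous d ∧
    ∀ P : Fin 3 → AlgebraicClosure k, P ≠ 0 →
      ∃ i : Fin 3, eval P (map (algebraMap k (AlgebraicClosure k)) (pderiv i F)) ≠ 0

/-- The affine coordinate ring of the plane curve `F = 0`, obtained by dehomogenizing at
`Z = 1`. Its fraction field is the function field of the curve. -/
abbrev PlaneCurveRing (k : Type) [Field k] (F : MvPolynomial (Fin 3) k) : Type :=
  MvPolynomial (Fin 2) k ⧸
    Ideal.span {(aeval ![X 0, X 1, 1] F : MvPolynomial (Fin 2) k)}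

/-- The arithmetic gonality `gon(C,k)` of the curve with function field `K` over `k`: the
least degree of a nonconstant `k`-morphism from the curve to the projective line `ℙ¹_k`,
i.e. the least index `[K : k(x)]` of a rational subfield `k(x)` with `x` nonconstant. -/
def gonality (k K : Type) [Field k] [Field K] [Algebra k K] : ℕ :=
  sInf {n : ℕ | ∃ x : K, Transcendental k x ∧
    Module.finrank (IntermediateField.adjoin k {x}) K = n}

/-- `F'` is obtained from `F` by a `k`-linear change of projective coordinates
(a `PGL₃(k)`-equivalence), so `F' = 0` is a plane model of the same curve. -/
def IsLinearChange {k : Type} [Field k] (F F' : MvPolynomial (Fin 3) k) : Prop :=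
  ∃ A : GL (Fin 3) k,
    F' = aeval (fun i => ∑ j, C ((A : Matrix (Fin 3) (Fin 3) k) i j) * X j) F

/-- `x` is an infinite geometric progression in `k`: `x i = t' * t ^ (i+1)` with `t, t' ∈ k*`. -/
def IsGeomProg {k : Type} [Field k] (x : ℕ → k) : Prop :=
  ∃ t t' : k, t ≠ 0 ∧ t' ≠ 0 ∧ ∀ i, x i = t' * t ^ (i + 1)

/-- `x` is an infinite arithmetic progression in `k`: `x i = t' + (i+1) * t` with `t, t' ∈ k*`. -/
def IsArithProg {k : Type} [Field k] (x : ℕ → k) : Prop :=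
  ∃ t t' : k, t ≠ 0 ∧ t' ≠ 0 ∧ ∀ i, x i = t' + (i + 1 : ℕ) * t

/-- The plane curve `F' = 0` carries an infinite `n`-level progression sequence with
`x`-coordinates `x i`: an infinite sequence of pairwise distinct points
`P i = (x i : 1 : z i)` on the curve, each lying in `Γ_n(C,k)`, i.e. with field of definition
of degree at most `n` over `k`. -/
def HasInfiniteLevelProg {k : Type} [Field k] (F' : MvPolynomial (Fin 3) k)
    (x : ℕ → k) (n : ℕ) : Prop :=
  ∃ P : ℕ → Fin 3 → AlgebraicClosure k, Function.Injective P ∧ ∀ i,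
    eval (P i) (map (algebraMap k (AlgebraicClosure k)) F') = 0 ∧
    P i 0 = algebraMap k (AlgebraicClosure k) (x i) ∧ P i 1 = 1 ∧
    Module.finrank k (IntermediateField.adjoin k (Set.range (P i))) ≤ n

open scoped IntermediateField.algebraAdjoinAdjoin in
/-- Differentiation with respect to a transcendental element extends to algebraic extensions. -/
lemma exists_derivation_eq_one {κ K : Type} [Field κ] [CharZero κ] [Field K] [Algebra κ K] {y : K}
    (hy : Transcendental κ y) (halg : ∀ x : K, IsAlgebraic (IntermediateField.adjoin κ {y}) x) :
    ∃ D : Derivation κ K K, D y = 1 := by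
  let := (Polynomial.aeval (R := κ) y).toAlgebra
  have : IsScalarTower κ (Polynomial κ) K := .of_algebraMap_eq fun r => by
    simp [RingHom.algebraMap_toAlgebra]
  have hinj : Function.Injective (algebraMap (Polynomial κ) K) :=
    transcendental_iff_injective.mp hy
  have : FaithfulSMul (Polynomial κ) K := (faithfulSMul_iff_algebraMap_injective _ _).mpr hinj
  let := FractionRing.liftAlgebra (Polynomial κ) K
  have hK : Algebra.IsAlgebraic (FractionRing (Polynomial κ)) K := by
    refine IsFractionRing.comap_isAlgebraic_iff (A := Polynomial κ).mp ⟨fun x => ?_⟩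
    have hx := (IsFractionRing.isAlgebraic_iff (Algebra.adjoin κ {y})
      (IntermediateField.adjoin κ {y}) K).mpr (halg x)
    refine IsAlgebraic.of_ringHom_of_comp_eq
      ((Polynomial.aeval (R := κ) y).codRestrict (Algebra.adjoin κ {y}) fun p => ?_)
      (RingHom.id K) hx ?_ (RingHom.id K).injective ?_
    · exact Polynomial.aeval_mem_adjoin_singleton κ y
    · rintro ⟨z, hz⟩
      rw [Algebra.adjoin_singleton_eq_range_aeval] at hz
      obtain ⟨p, rfl⟩ := hz
      exact ⟨p, rfl⟩
    · ext <;> rfl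
  have : CharZero (FractionRing (Polynomial κ)) :=
    charZero_of_injective_algebraMap (R := Polynomial κ)
      (FaithfulSMul.algebraMap_injective (Polynomial κ) (FractionRing (Polynomial κ)))
  have h1 : Algebra.FormallyEtale (Polynomial κ) (FractionRing (Polynomial κ)) :=
    .of_isLocalization (nonZeroDivisors (Polynomial κ))
  have h2 : Algebra.FormallyEtale (FractionRing (Polynomial κ)) K :=
    .of_isSeparable _ _ 
  have h3 : Algebra.FormallyEtale (Polynomial κ) K := .comp _ (FractionRing (Polynomial κ)) _
  let e := (KaehlerDifferential.tensorKaehlerEquivOfFormallyEtale κ (Polynomial κ) K).symm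
  let l : Ω[K⁄κ] →ₗ[K] K := (TensorProduct.AlgebraTensorModule.rid (Polynomial κ) K K).toLinearMap ∘ₗ
    (LinearMap.baseChange K (KaehlerDifferential.polynomialEquiv κ).toLinearMap) ∘ₗ e.toLinearMap
  refine ⟨l.compDer (KaehlerDifferential.D κ K), ?_⟩
  have : y = algebraMap (Polynomial κ) K Polynomial.X := by simp [RingHom.algebraMap_toAlgebra]
  change l (KaehlerDifferential.D κ K y) = 1
  conv_lhs => rw [this]
  simp [l, e, KaehlerDifferential.tensorKaehlerEquivOfFormallyEtale_symm_D_algebraMap]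

lemma derivation_eq_zero_of_isAlgebraic_adjoin {κ K : Type} [Field κ] [CharZero κ] [Field K]
    [Algebra κ K] (D : Derivation κ K K) {x y : K} (hx : D x = 0)
    (hy : IsAlgebraic (IntermediateField.adjoin κ {x}) y) : D y = 0 := by
  have hL : ∀ l ∈ IntermediateField.adjoin κ {x}, D l = 0 := fun l hl => by
    induction hl using IntermediateField.adjoin_induction with
    | mem z hz => rw [Set.mem_singleton_iff.mp hz, hx]
    | algebraMap z => exact D.map_algebraMap z
    | add a b _ _ ha hb => rw [map_add, ha, hb, add_zero]
    | inv a _ ha => rw [Derivation.leibniz_inv, ha, smul_zero]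
    | mul a b _ _ ha hb => rw [Derivation.leibniz, ha, hb, smul_zero, smul_zero, add_zero]
  let D' : Derivation (IntermediateField.adjoin κ {x}) K K :=
    Derivation.mk' { toFun := D
                     map_add' := map_add D
                     map_smul' := fun l z => by
                       have : l • z = (l : K) * z := rfl
                       rw [this, Derivation.leibniz, hL l l.2, smul_zero, add_zero]; rfl }
      fun a b => D.leibniz a b
  have h1 := D'.map_aeval (minpoly (IntermediateField.adjoin κ {x}) y) y
  rw [minpoly.aeval, map_zero, eq_comm, smul_eq_mul, mul_eq_zero] at h1
  exact h1.resolve_left ((minpoly.irreducible hy.isIntegral).separable.aeval_derivative_ne_zero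
    (minpoly.aeval _ _))

lemma isAlgebraic_adjoin_of_transcendental {κ K : Type} [Field κ] [Field K]
    [Algebra κ K] {y : K} (hy : Transcendental κ y)
    (halg : ∀ x : K, IsAlgebraic (IntermediateField.adjoin κ {y}) x) {x : K}
    (hx : Transcendental κ x) (z : K) : IsAlgebraic (IntermediateField.adjoin κ {x}) z := by
  have hy' : IsTranscendenceBasis κ (fun _ : Unit => y) := by
    rw [isTranscendenceBasis_iff_algebraicIndependent_isAlgebraic]
    refine ⟨algebraicIndependent_unique_type_iff.mpr hy, ⟨fun x => ?_⟩⟩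
    rw [Set.range_const]
    open scoped IntermediateField.algebraAdjoinAdjoin in
    exact (IsFractionRing.isAlgebraic_iff (Algebra.adjoin κ {y})
      (IntermediateField.adjoin κ {y}) K).mpr (halg x)
  have hx' : IsTranscendenceBasis κ (fun _ : Unit => x) := by
    refine AlgebraicIndependent.isTranscendenceBasis_of_trdeg_le_of_finite
      (algebraicIndependent_unique_type_iff.mpr hx) ?_
    rw [← hy'.cardinalMk_eq_trdeg]
  have := hx'.isAlgebraic_field
  rw [Set.range_const] at this
  exact this.isAlgebraic z

lemma isAlgebraic_of_derivation_eq_zero {κ K : Type} [Field κ] [CharZero κ] [Field K]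
    [Algebra κ K] (D : Derivation κ K K) {y : K} (hDy : D y ≠ 0) (hy : Transcendental κ y)
    (halg : ∀ x : K, IsAlgebraic (IntermediateField.adjoin κ {y}) x) {x : K} (hx : D x = 0) :
    IsAlgebraic κ x := by
  by_contra hcon
  exact hDy (derivation_eq_zero_of_isAlgebraic_adjoin D hx
    (isAlgebraic_adjoin_of_transcendental hy halg hcon y))

lemma derivation_aeval_eq_sum {κ K : Type} [Field κ] [CommRing K] [Algebra κ K]
    (D : Derivation κ K K) (P : Fin 3 → K) (F : MvPolynomial (Fin 3) κ) :
    D (aeval P F) = ∑ i, aeval P (pderiv i F) * D (P i) := by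
  induction F using MvPolynomial.induction_on with
  | C a => simp
  | add p q hp hq => simp only [map_add, hp, hq, add_mul, Finset.sum_add_distrib]
  | mul_X p j hp =>
    simp only [map_mul, aeval_X, Derivation.leibniz, hp, smul_eq_mul, pderiv_X, map_add,
      Fin.sum_univ_three]
    fin_cases j <;> simp <;> ring

/-- `v = g • P` where `P × DP = g • ∇F(P)`. -/
def IsCanonicalVector {κ K : Type} [Field κ] [Field K] [Algebra κ K]
    (F : MvPolynomial (Fin 3) κ) (D : Derivation κ K K) (P v : Fin 3 → K) : Prop :=
  ∃ g : K, (∀ i, v i = g * P i) ∧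
    P 1 * D (P 2) - P 2 * D (P 1) = g * aeval P (pderiv 0 F) ∧
    P 2 * D (P 0) - P 0 * D (P 2) = g * aeval P (pderiv 1 F) ∧
    P 0 * D (P 1) - P 1 * D (P 0) = g * aeval P (pderiv 2 F)

lemma aeval_mul_of_isHomogeneous {κ K : Type} [Field κ] [Field K] [Algebra κ K]
    {F : MvPolynomial (Fin 3) κ} {n : ℕ} (hF : F.IsHomogeneous n) (P : Fin 3 → K) (c : K) :
    aeval (fun i => c * P i) F = c ^ n * aeval P F := by
  rw [aeval_def, aeval_def, eval₂_eq', eval₂_eq', Finset.mul_sum]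
  refine Finset.sum_congr rfl fun m hm => ?_
  have : n = ∑ i, m i := by
    rw [← hF (mem_support_iff.mp hm), Finsupp.weight_apply, Finsupp.sum_fintype _ _ (by simp)]
    simp
  rw [this, Finset.prod_congr rfl fun i _ => mul_pow c (P i) (m i), Finset.prod_mul_distrib,
    Finset.prod_pow_eq_pow_sum]
  ring

lemma IsCanonicalVector.smul {κ K : Type} [Field κ] [Field K] [Algebra κ K]
    {F : MvPolynomial (Fin 3) κ} (hF : F.IsHomogeneous 4) {D : Derivation κ K K} {P v : Fin 3 → K}
    (h : IsCanonicalVector F D P v) {c : K} (hc : c ≠ 0) :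
    IsCanonicalVector F D (fun i => c * P i) v := by
  obtain ⟨g, h1, h2, h3, h4⟩ := h
  refine ⟨g / c, fun i => by rw [h1]; field_simp, ?_, ?_, ?_⟩ <;>
  rw [aeval_mul_of_isHomogeneous hF.pderiv] <;> simp only [Derivation.leibniz, smul_eq_mul] <;> field_simp
  · linear_combination c ^ 3 * h2
  · linear_combination c ^ 3 * h3
  · linear_combination c ^ 3 * h4

lemma exists_isCanonicalVector {κ K : Type} [Field κ] [Field K] [Algebra κ K]
    {F : MvPolynomial (Fin 3) κ} {d : ℕ} (hF : F.IsHomogeneous d) (D : Derivation κ K K)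
    {P : Fin 3 → K} (h0 : aeval P F = 0) (hs : ∃ i, aeval P (pderiv i F) ≠ 0) :
    ∃ v, IsCanonicalVector F D P v := by
  have h1 : ∑ i, P i * aeval P (pderiv i F) = 0 := by
    have := congrArg (aeval P) hF.sum_X_mul_pderiv
    simpa [h0] using this
  have h2 := derivation_aeval_eq_sum D P F
  rw [h0, map_zero] at h2
  rw [Fin.sum_univ_three] at h1 h2
  obtain ⟨i, hi⟩ := hs
  fin_cases i <;> simp only [Fin.zero_eta, Fin.mk_one, Fin.reduceFinMk] at hi
  · refine ⟨_, (P 1 * D (P 2) - P 2 * D (P 1)) / aeval P (pderiv 0 F), fun i => rfl, ?_, ?_, ?_⟩ <;>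
      rw [div_mul_eq_mul_div, eq_div_iff hi]
    · linear_combination -D (P 2) * h1 - P 2 * h2
    · linear_combination D (P 1) * h1 + P 1 * h2
  · refine ⟨_, (P 2 * D (P 0) - P 0 * D (P 2)) / aeval P (pderiv 1 F), fun i => rfl, ?_, ?_, ?_⟩ <;>
      rw [div_mul_eq_mul_div, eq_div_iff hi]
    · linear_combination D (P 2) * h1 + P 2 * h2
    · linear_combination -D (P 0) * h1 - P 0 * h2
  · refine ⟨_, (P 0 * D (P 1) - P 1 * D (P 0)) / aeval P (pderiv 2 F), fun i => rfl, ?_, ?_, ?_⟩ <;>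
      rw [div_mul_eq_mul_div, eq_div_iff hi]
    · linear_combination -D (P 1) * h1 - P 1 * h2
    · linear_combination D (P 0) * h1 + P 0 * h2

/-- The partial derivatives of `F` generate an ideal containing a power of each variable. -/
def HasPrimaryJacobian {κ : Type} [Field κ] (F : MvPolynomial (Fin 3) κ) : Prop :=
  ∀ j, ∃ N : ℕ, (X j : MvPolynomial (Fin 3) κ) ^ N ∈ Ideal.span (Set.range fun l => pderiv l F)

lemma HasPrimaryJacobian.exists_eq {κ K : Type} [Field κ] [CommRing K] [Algebra κ K]
    {F : MvPolynomial (Fin 3) κ} (hF : HasPrimaryJacobian F) (j : Fin 3) :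
    ∃ (N : ℕ) (A : Fin 3 → MvPolynomial (Fin 3) κ), ∀ P : Fin 3 → K,
      P j ^ N = ∑ l, aeval P (A l) * aeval P (pderiv l F) := by
  obtain ⟨N, hN⟩ := hF j
  obtain ⟨A, hA⟩ := Ideal.mem_span_range_iff_exists_fun.mp hN
  refine ⟨N, A, fun P => ?_⟩
  have := congrArg (aeval P) hA
  simpa using this.symm

lemma HasPrimaryJacobian.exists_ne_zero {κ K : Type} [Field κ] [Field K] [Algebra κ K]
    {F : MvPolynomial (Fin 3) κ} (hF : HasPrimaryJacobian F) {P : Fin 3 → K} (hP : P ≠ 0) :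
    ∃ l, aeval P (pderiv l F) ≠ 0 := by
  by_contra! h
  obtain ⟨j, hj⟩ := Function.ne_iff.mp hP
  obtain ⟨N, A, hA⟩ := hF.exists_eq (K := K) j
  have := hA P
  simp only [h, mul_zero, Finset.sum_const_zero] at this
  exact hj (eq_zero_of_pow_eq_zero this)

/-- The elements integral at a prime `v` of a Dedekind domain containing `κ`. -/
def localSubalgebra (κ : Type) {B : Type} (K : Type) [Field κ] [CommRing B] [IsDedekindDomain B]
    [Field K] [Algebra κ B] [Algebra B K] [IsFractionRing B K] [Algebra κ K] [IsScalarTower κ B K]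
    (v : IsDedekindDomain.HeightOneSpectrum B) : Subalgebra κ K where
  __ := (v.valuation K).integer
  algebraMap_mem' r := by
    change v.valuation K _ ≤ 1
    rw [IsScalarTower.algebraMap_apply κ B K]
    exact v.valuation_le_one _

lemma aeval_mem_subalgebra {κ K : Type} [Field κ] [Field K] [Algebra κ K] {ι : Type}
    (S : Subalgebra κ K) {P : ι → K} (hP : ∀ i, P i ∈ S) (G : MvPolynomial ι κ) : aeval P G ∈ S := by
  have := Subalgebra.mvPolynomial_aeval_coe S (fun i => (⟨P i, hP i⟩ : S)) G
  rw [show P = fun i => ((⟨P i, hP i⟩ : S) : K) from rfl, this]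
  exact Subtype.property _

/-- A canonical vector is regular wherever the derivation is. -/
lemma IsCanonicalVector.exists_algebraMap_eq {κ B K : Type} [Field κ] [CommRing B]
    [IsDedekindDomain B] [Field K] [Algebra κ B] [Algebra B K] [IsFractionRing B K] [Algebra κ K]
    [IsScalarTower κ B K] {F : MvPolynomial (Fin 3) κ} (hF : F.IsHomogeneous 4)
    (hJ : HasPrimaryJacobian F) {D : Derivation κ K K}
    (hD : ∀ b : B, ∃ b' : B, D (algebraMap B K b) = algebraMap B K b') {P u : Fin 3 → K}
    (hP : P ≠ 0) (hu : IsCanonicalVector F D P u) (i : Fin 3) : ∃ b : B, algebraMap B K b = u i := by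
  refine IsDedekindDomain.HeightOneSpectrum.mem_integers_of_valuation_le_one K _ fun v => ?_
  set O := localSubalgebra κ K v with hO
  have hmem : ∀ x, x ∈ O ↔ v.valuation K x ≤ 1 := fun x => Iff.rfl
  have hDO : ∀ x ∈ O, D x ∈ O := fun x hx => by
    obtain ⟨n, d, hnd⟩ := v.exists_primeCompl_mul_eq_of_integer x hx
    have hd : v.valuation K (algebraMap B K d) = 1 := by
      rw [v.valuation_of_algebraMap]
      exact (v.intValuation_eq_one_iff_mem_primeCompl d).mpr d.prop
    obtain ⟨n', hn'⟩ := hD n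
    obtain ⟨d', hd'⟩ := hD d
    have h := congrArg D hnd
    rw [Derivation.leibniz, hn', hd', smul_eq_mul, smul_eq_mul] at h
    have hB : ∀ b : B, algebraMap B K b ∈ O := fun b => v.valuation_le_one b
    have : algebraMap B K d * D x ∈ O := by
      rw [← add_sub_cancel_left (x * algebraMap B K d') (algebraMap B K d * D x), h]
      exact O.sub_mem (hB _) (O.mul_mem hx (hB _))
    rwa [hmem, map_mul, hd, one_mul] at this
  obtain ⟨j, -, hj⟩ := Finset.exists_max_image Finset.univ (fun i => v.valuation K (P i))
    Finset.univ_nonempty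
  have hPj : P j ≠ 0 := by
    intro h0
    refine hP (funext fun i => ?_)
    have := hj i (Finset.mem_univ _)
    simpa [h0] using this
  have hQ : ∀ i, (P j)⁻¹ * P i ∈ O := fun i => by
    rw [hmem, map_mul, map_inv₀, mul_comm, ← div_eq_mul_inv]
    exact div_le_one_of_le₀ (hj i (Finset.mem_univ _)) zero_le
  have hu' := hu.smul hF (inv_ne_zero hPj)
  set Q : Fin 3 → K := fun i => (P j)⁻¹ * P i with hQdef
  have hQj : Q j = 1 := inv_mul_cancel₀ hPj
  have hunit : ∃ l, v.valuation K (aeval Q (pderiv l F)) = 1 := by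
    by_contra! hcon
    have hlt : ∀ l, v.valuation K (aeval Q (pderiv l F)) < 1 := fun l =>
      lt_of_le_of_ne ((hmem _).mp (aeval_mem_subalgebra O hQ _)) (hcon l)
    obtain ⟨N, A, hA⟩ := hJ.exists_eq (K := K) j
    have h1 := hA Q
    rw [hQj, one_pow] at h1
    have : v.valuation K (1 : K) < 1 := by
      rw [h1]
      refine Valuation.map_sum_lt _ one_ne_zero fun l _ => ?_
      rw [map_mul]
      exact mul_lt_one_of_nonneg_of_lt_one_right ((hmem _).mp (aeval_mem_subalgebra O hQ _))
        zero_le (hlt l)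
    simp at this
  obtain ⟨g, h1, h2, h3, h4⟩ := hu'
  have hW : ∀ l, g * aeval Q (pderiv l F) ∈ O := by
    intro l
    have hDQ := fun i => hDO _ (hQ i)
    fin_cases l
    · exact h2 ▸ O.sub_mem (O.mul_mem (hQ _) (hDQ _)) (O.mul_mem (hQ _) (hDQ _))
    · exact h3 ▸ O.sub_mem (O.mul_mem (hQ _) (hDQ _)) (O.mul_mem (hQ _) (hDQ _))
    · exact h4 ▸ O.sub_mem (O.mul_mem (hQ _) (hDQ _)) (O.mul_mem (hQ _) (hDQ _))
  obtain ⟨l, hl⟩ := hunit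
  have hg : g ∈ O := by
    have := hW l
    rwa [hmem, map_mul, hl, mul_one] at this
  rw [h1]
  exact O.mul_mem hg (hQ i)

/-- `K = κ(y)(w)` with `y` transcendental over `κ`, `w ∉ κ(y)` and `w² = f(y)`, `f` squarefree. -/
structure IsHyperellipticPair {κ K : Type} [Field κ] [Field K] [Algebra κ K] (y w : K)
    (f : Polynomial κ) : Prop where
  transcendental : Transcendental κ y
  sq_eq : w ^ 2 = Polynomial.aeval y f
  squarefree : Squarefree f
  indep : ∀ a b : Polynomial κ, Polynomial.aeval y a + Polynomial.aeval y b * w = 0 →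
    a = 0 ∧ b = 0
  gen : ∀ x : K, ∃ a b c : Polynomial κ, c ≠ 0 ∧
    Polynomial.aeval y c * x = Polynomial.aeval y a + Polynomial.aeval y b * w

lemma Squarefree.dvd_of_sq_dvd_mul_sq {κ : Type} [Field κ] {f b c : Polynomial κ}
    (hf : Squarefree f) (h : c ^ 2 ∣ f * b ^ 2) : c ∣ b := by
  classical
  rcases eq_or_ne c 0 with rfl | hc
  · have : f * b ^ 2 = 0 := by simpa using h
    rcases mul_eq_zero.mp this with h0 | h0
    · exact absurd h0 hf.ne_zero
    · simp [eq_zero_of_pow_eq_zero h0]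
  · have hg : EuclideanDomain.gcd c b ≠ 0 := fun h0 => hc (EuclideanDomain.gcd_eq_zero_iff.mp h0).1
    obtain ⟨c', hc'⟩ := EuclideanDomain.gcd_dvd_left c b
    obtain ⟨b', hb'⟩ := EuclideanDomain.gcd_dvd_right c b
    set g := EuclideanDomain.gcd c b
    have hco : IsCoprime c' b' := by
      refine ⟨EuclideanDomain.gcdA c b, EuclideanDomain.gcdB c b, mul_left_cancel₀ hg ?_⟩
      have := EuclideanDomain.gcd_eq_gcd_ab c b
      linear_combination -this - EuclideanDomain.gcdA c b * hc' - EuclideanDomain.gcdB c b * hb'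
    have h2 : c' ^ 2 ∣ f * b' ^ 2 := by
      rw [hc', hb', mul_pow, mul_pow, mul_left_comm] at h
      exact (mul_dvd_mul_iff_left (pow_ne_zero 2 hg)).mp h
    have h3 : c' ^ 2 ∣ f := hco.pow.dvd_of_dvd_mul_right h2
    have h4 : IsUnit c' := hf c' (by rwa [← sq])
    rw [hc', h4.mul_right_dvd, hb']
    exact dvd_mul_right _ _

lemma IsHyperellipticPair.exists_eq_of_isCanonicalVector {κ K : Type} [Field κ] [CharZero κ]
    [Field K] [Algebra κ K] {y w : K} {f : Polynomial κ} (h : IsHyperellipticPair y w f)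
    {F : MvPolynomial (Fin 3) κ} (hF : F.IsHomogeneous 4)
    (hJ : HasPrimaryJacobian F) {D : Derivation κ K K} (hD : D y = w) {P u : Fin 3 → K}
    (hP : P ≠ 0) (hu : IsCanonicalVector F D P u) (i : Fin 3) :
    ∃ p q : Polynomial κ, u i = Polynomial.aeval y p + Polynomial.aeval y q * w := by
  classical
  have : CharZero K := charZero_of_injective_algebraMap (algebraMap κ K).injective
  let := (Polynomial.aeval (R := κ) y).toAlgebra
  have hmap : ∀ p, algebraMap (Polynomial κ) K p = Polynomial.aeval y p := fun p => rfl
  have : IsScalarTower κ (Polynomial κ) K := .of_algebraMap_eq fun r => by simp [hmap]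
  have hinj : Function.Injective (algebraMap (Polynomial κ) K) :=
    transcendental_iff_injective.mp h.transcendental
  have : FaithfulSMul (Polynomial κ) K := (faithfulSMul_iff_algebraMap_injective _ _).mpr hinj
  let := FractionRing.liftAlgebra (Polynomial κ) K
  set L := FractionRing (Polynomial κ) with hL
  have hspan : Submodule.span L ((insert 1 (singleton w) : Finset K) : Set K) = ⊤ := by
    rw [eq_top_iff]
    rintro x -
    obtain ⟨a, b, c, hc, hx⟩ := h.gen x
    have hc' : Polynomial.aeval y c ≠ 0 := fun h0 => hc (hinj (by rw [hmap, h0, map_zero]))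
    have : x = (algebraMap (Polynomial κ) L a / algebraMap (Polynomial κ) L c) • (1 : K) +
        (algebraMap (Polynomial κ) L b / algebraMap (Polynomial κ) L c) • w := by
      rw [Algebra.smul_def, Algebra.smul_def, map_div₀, map_div₀,
        ← IsScalarTower.algebraMap_apply, ← IsScalarTower.algebraMap_apply,
        ← IsScalarTower.algebraMap_apply, hmap, hmap, hmap]
      field_simp
      linear_combination hx
    rw [this]
    exact add_mem (Submodule.smul_mem _ _ (Submodule.subset_span (by simp)))
      (Submodule.smul_mem _ _ (Submodule.subset_span (by simp)))
  have hfd : FiniteDimensional L K := ⟨⟨_, hspan⟩⟩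
  have hrank : Module.finrank L K ≤ 2 := by
    have h1 := finrank_span_finset_le_card (R := L) (insert 1 (singleton w) : Finset K)
    rw [Set.finrank, hspan, finrank_top] at h1
    exact h1.trans Finset.card_le_two
  have hchar : CharZero L :=
    charZero_of_injective_algebraMap (R := Polynomial κ) (FaithfulSMul.algebraMap_injective _ _)
  have : IsDedekindDomain (integralClosure (Polynomial κ) K) :=
    integralClosure.isDedekindDomain (Polynomial κ) L K
  have : IsFractionRing (integralClosure (Polynomial κ) K) K :=
    integralClosure.isFractionRing_of_finite_extension L K
  have hwint : IsIntegral (Polynomial κ) w :=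
    IsIntegral.of_pow (n := 2) two_pos (by rw [h.sq_eq, ← hmap]; exact isIntegral_algebraMap)
  have hw0 : w ≠ 0 := by
    rintro rfl
    exact one_ne_zero (h.indep 0 1 (by simp)).2
  have hform : ∀ x : K, IsIntegral (Polynomial κ) x → ∃ p q : Polynomial κ,
      x = Polynomial.aeval y p + Polynomial.aeval y q * w := by
    intro x hx
    obtain ⟨a, b, c, hc, hxe⟩ := h.gen x
    have hc' : Polynomial.aeval y c ≠ 0 := fun h0 => hc (hinj (by rw [hmap, h0, map_zero]))
    rcases eq_or_ne b 0 with rfl | hb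
    · have : x = algebraMap L K (algebraMap (Polynomial κ) L a / algebraMap (Polynomial κ) L c) := by
        rw [map_div₀, ← IsScalarTower.algebraMap_apply, ← IsScalarTower.algebraMap_apply, hmap,
          hmap, eq_div_iff hc']
        rw [mul_comm, hxe, map_zero, zero_mul, add_zero]
      rw [this, isIntegral_algebraMap_iff (algebraMap L K).injective] at hx
      obtain ⟨p, hp⟩ := IsIntegrallyClosed.isIntegral_iff.mp hx
      refine ⟨p, 0, ?_⟩
      rw [this, ← hp, ← IsScalarTower.algebraMap_apply, hmap]
      simp
    · have hdeg : (minpoly (Polynomial κ) x).natDegree ≤ 2 := by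
        rw [← (minpoly.monic hx).natDegree_map (algebraMap (Polynomial κ) L),
          ← minpoly.isIntegrallyClosed_eq_field_fractions L K hx]
        exact (minpoly.natDegree_le x).trans hrank
      obtain ⟨s, n, hsn⟩ : ∃ s n : Polynomial κ,
          x ^ 2 = Polynomial.aeval y s * x - Polynomial.aeval y n := by
        obtain ⟨m, hm, hm0, hdeg⟩ : ∃ m : Polynomial (Polynomial κ), m.Monic ∧
          Polynomial.aeval x m = 0 ∧ m.natDegree ≤ 2 := ⟨_, minpoly.monic hx, minpoly.aeval _ _, hdeg⟩
        have hmm : (m * Polynomial.X ^ (2 - m.natDegree)).Monic :=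
          hm.mul (Polynomial.monic_X_pow _)
        have hmd : (m * Polynomial.X ^ (2 - m.natDegree)).natDegree = 2 := by
          rw [hm.natDegree_mul (Polynomial.monic_X_pow _),
            Polynomial.natDegree_X_pow]
          omega
        set m' := m * Polynomial.X ^ (2 - m.natDegree)
        have h0 : Polynomial.aeval x m' = 0 := by
          rw [map_mul, hm0, zero_mul]
        rw [Polynomial.aeval_eq_sum_range, hmd, Finset.sum_range_succ, Finset.sum_range_succ,
          Finset.sum_range_one] at h0
        have h2 : m'.coeff 2 = 1 := by rw [← hmd]; exact hmm
        refine ⟨-m'.coeff 1, m'.coeff 0, ?_⟩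
        simp only [Algebra.smul_def, hmap, h2, map_one, one_mul, pow_zero, mul_one, pow_one] at h0
        rw [map_neg]
        linear_combination h0
      have h1 := h.indep (a ^ 2 + b ^ 2 * f - s * c * a + n * c ^ 2) (2 * a * b - s * c * b) (by
        simp only [map_add, map_sub, map_mul, map_pow, ← h.sq_eq, map_ofNat]
        linear_combination (Polynomial.aeval y c) ^ 2 * hsn + 
          (- Polynomial.aeval y c * x - Polynomial.aeval y a - Polynomial.aeval y b * w +
            Polynomial.aeval y s * Polynomial.aeval y c) * hxe)
      obtain ⟨h2, h3⟩ := h1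
      have h4 : 2 * a = s * c := mul_right_cancel₀ hb (by linear_combination h3)
      have hC : Polynomial.C (2⁻¹ : κ) * 2 = 1 := by
        rw [← Polynomial.C_ofNat, ← Polynomial.C_mul, inv_mul_cancel₀ two_ne_zero, Polynomial.C_1]
      have h5 : a = c * (Polynomial.C 2⁻¹ * s) := by
        linear_combination Polynomial.C 2⁻¹ * h4 - a * hC
      obtain ⟨q, hq⟩ : c ∣ b := h.squarefree.dvd_of_sq_dvd_mul_sq
        ⟨(Polynomial.C 2⁻¹ * s) ^ 2 - n, by
          linear_combination h2 + (a + c * (Polynomial.C 2⁻¹ * s)) * h5 - a * h4⟩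
      refine ⟨Polynomial.C 2⁻¹ * s, q, mul_left_cancel₀ hc' ?_⟩
      rw [hxe, h5, hq]
      simp only [map_mul]
      ring
  have hDp : ∀ p : Polynomial κ, D (Polynomial.aeval y p) =
      Polynomial.aeval y (Polynomial.derivative p) * w := fun p => by
    rw [D.map_aeval, hD, smul_eq_mul]
  have hDw : D w = Polynomial.aeval y (Polynomial.derivative f) / 2 := by
    have h1 := congrArg D h.sq_eq
    rw [hDp, Derivation.leibniz_pow] at h1
    apply mul_right_cancel₀ hw0
    rw [div_mul_eq_mul_div, ← h1]
    simp
    ring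
  obtain ⟨b, hb⟩ := hu.exists_algebraMap_eq (B := integralClosure (Polynomial κ) K) hF hJ
    (fun b => by
      obtain ⟨p, q, hpq⟩ := hform _ b.2
      have hmem : D b ∈ integralClosure (Polynomial κ) K := by
        have h2 : D b = algebraMap (Polynomial κ) K (Polynomial.derivative p) * w +
            algebraMap (Polynomial κ) K (Polynomial.derivative q * f +
              q * (Polynomial.C 2⁻¹ * Polynomial.derivative f)) := by
          rw [hpq, map_add, hDp, Derivation.leibniz, hDp, hDw]
          simp only [hmap, map_add, map_mul, smul_eq_mul, Polynomial.aeval_C, map_inv₀, map_ofNat,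
            ← h.sq_eq]
          ring
        rw [h2]
        exact add_mem (mul_mem (algebraMap_mem _ _) hwint) (algebraMap_mem _ _)
      exact ⟨⟨_, hmem⟩, rfl⟩) hP i
  rw [← hb]
  exact hform _ b.2

lemma aeval_ne_zero_of_transcendental {κ K : Type} [Field κ] [Field K] [Algebra κ K] {y : K}
    (hy : Transcendental κ y) {c : Polynomial κ} (hc : c ≠ 0) : Polynomial.aeval y c ≠ 0 :=
  fun h => hc (transcendental_iff.mp hy c h)

lemma IsHyperellipticPair.isAlgebraic_adjoin {κ K : Type} [Field κ] [Field K] [Algebra κ K]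
    {y w : K} {f : Polynomial κ} (h : IsHyperellipticPair y w f) (x : K) :
    IsAlgebraic (IntermediateField.adjoin κ {y}) x := by
  have hp : ∀ p : Polynomial κ, IsAlgebraic (IntermediateField.adjoin κ {y})
      (Polynomial.aeval y p) := fun p => by
    have hm : Polynomial.aeval y p ∈ IntermediateField.adjoin κ {y} :=
      (IntermediateField.algebra_adjoin_le_adjoin κ _) (Polynomial.aeval_mem_adjoin_singleton _ _)
    exact isAlgebraic_algebraMap (⟨_, hm⟩ : IntermediateField.adjoin κ {y})
  have hw : IsAlgebraic (IntermediateField.adjoin κ {y}) w :=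
    IsAlgebraic.of_pow two_pos (h.sq_eq ▸ hp f)
  obtain ⟨a, b, c, hc, hx⟩ := h.gen x
  have hc' := aeval_ne_zero_of_transcendental h.transcendental hc
  rw [← mul_div_cancel_left₀ x hc', hx, div_eq_mul_inv]
  exact ((hp a).add ((hp b).mul hw)).mul (hp c).inv

lemma IsCanonicalVector.smul_derivation {κ K : Type} [Field κ] [Field K] [Algebra κ K]
    {F : MvPolynomial (Fin 3) κ} {D : Derivation κ K K} {P v : Fin 3 → K}
    (h : IsCanonicalVector F D P v) (c : K) :
    IsCanonicalVector F (c • D) P (fun i => c * v i) := by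
  obtain ⟨g, h1, h2, h3, h4⟩ := h
  refine ⟨c * g, fun i => by simp only [h1]; ring, ?_, ?_, ?_⟩ <;>
  simp only [Derivation.smul_apply, smul_eq_mul]
  · linear_combination c * h2
  · linear_combination c * h3
  · linear_combination c * h4

lemma Squarefree.reflect {κ : Type} [Field κ] {f : Polynomial κ} (hf : Squarefree f) {n : ℕ}
    (h1 : f.natDegree ≤ n) (h2 : n ≤ f.natDegree + 1) : Squarefree (f.reflect n) := by
  have hf0 := hf.ne_zero
  rintro x ⟨g, hg⟩
  have hr0 : f.reflect n ≠ 0 := by rwa [Ne, Polynomial.reflect_eq_zero_iff]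
  have hxx : x * x ≠ 0 := left_ne_zero_of_mul (hg ▸ hr0)
  have hx0 : x ≠ 0 := left_ne_zero_of_mul hxx
  have hg0 : g ≠ 0 := right_ne_zero_of_mul (hg ▸ hr0)
  have hdeg : (x * x * g).natDegree ≤ n := by
    rw [← hg]
    refine (Polynomial.natDegree_reflect_le).trans (by simp [h1])
  rw [Polynomial.natDegree_mul hxx hg0, Polynomial.natDegree_mul hx0 hx0] at hdeg
  obtain ⟨e, he⟩ : ∃ e, n = x.natDegree + x.natDegree + e := ⟨_, (Nat.add_sub_of_le (by omega)).symm⟩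
  have hfe : f = x.reverse * x.reverse * g.reflect e := by
    have hinv : f = (f.reflect n).reflect n := by
      ext i
      rw [Polynomial.coeff_reflect, Polynomial.coeff_reflect, Polynomial.revAt_invol]
    rw [hinv, hg, he,
      Polynomial.reflect_mul _ _ (Polynomial.natDegree_mul_le_of_le le_rfl le_rfl) (by omega),
      Polynomial.reflect_mul _ _ le_rfl le_rfl]
    rfl
  have hu : IsUnit x.reverse := hf _ ⟨_, hfe⟩
  have hdr := Polynomial.natDegree_eq_zero_of_isUnit hu
  by_cases hd : x.natDegree = 0
  · rw [Polynomial.isUnit_iff_degree_eq_zero, Polynomial.degree_eq_natDegree hx0, hd]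
    rfl
  exfalso
  have hX : (Polynomial.X : Polynomial κ) ∣ x := by
    rw [Polynomial.X_dvd_iff]
    by_contra h0
    rw [Polynomial.reverse_natDegree, Polynomial.natTrailingDegree_eq_zero.mpr (Or.inr h0)] at hdr
    exact hd hdr
  have hXX : (Polynomial.X : Polynomial κ) ^ 2 ∣ f.reflect n := by
    rw [hg, sq]
    exact (mul_dvd_mul hX hX).mul_right g
  rw [Polynomial.X_pow_dvd_iff] at hXX
  have hc0 := hXX 0 (by norm_num)
  have hc1 := hXX 1 (by norm_num)
  rw [Polynomial.coeff_reflect] at hc0 hc1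
  have hl : f.coeff f.natDegree ≠ 0 := by simpa using hf0
  rcases h1.eq_or_lt with h | h
  · rw [Polynomial.revAt_le (by omega), Nat.sub_zero, ← h] at hc0
    exact hl hc0
  · rw [Polynomial.revAt_le (by omega), show n - 1 = f.natDegree by omega] at hc1
    exact hl hc1

lemma aeval_inv_mul_pow {κ K : Type} [Field κ] [Field K] [Algebra κ K] {y : K} (hy : y ≠ 0)
    {p : Polynomial κ} {n : ℕ} (hn : p.natDegree ≤ n) :
    Polynomial.aeval y⁻¹ p * y ^ n = Polynomial.aeval y (p.reflect n) := by
  let : Invertible y⁻¹ := invertibleOfNonzero (inv_ne_zero hy)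
  have h := Polynomial.eval₂_reflect_mul_pow (algebraMap κ K) y⁻¹ n p hn
  rw [Polynomial.aeval_def, Polynomial.aeval_def, ← h, mul_assoc, ← mul_pow, inv_mul_cancel₀ hy,
    one_pow, mul_one]
  congr 1
  rw [invOf_eq_inv, inv_inv]

lemma IsHyperellipticPair.inv {κ K : Type} [Field κ] [Field K] [Algebra κ K]
    {y w : K} {f : Polynomial κ} (h : IsHyperellipticPair y w f) {m : ℕ}
    (h1 : f.natDegree ≤ 2 * m) (h2 : 2 * m ≤ f.natDegree + 1) :
    IsHyperellipticPair y⁻¹ (w / y ^ m) (f.reflect (2 * m)) := by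
  have hy : y ≠ 0 := fun h0 => h.transcendental (h0 ▸ isAlgebraic_zero)
  have hy' : y⁻¹ ≠ 0 := inv_ne_zero hy
  refine ⟨?_, ?_, h.squarefree.reflect h1 h2, ?_, ?_⟩
  · exact fun hc => h.transcendental (by simpa using hc.inv)
  · have := aeval_inv_mul_pow hy' h1
    rw [inv_inv] at this
    rw [← this, div_pow, h.sq_eq, ← pow_mul, mul_comm m 2, inv_pow, div_eq_mul_inv]
  · intro a b hab
    set N := a.natDegree + b.natDegree
    have h3 := h.indep (a.reflect N * Polynomial.X ^ m) (b.reflect N) (by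
      rw [map_mul, ← aeval_inv_mul_pow hy (show a.natDegree ≤ N by omega),
        ← aeval_inv_mul_pow hy (show b.natDegree ≤ N by omega), map_pow, Polynomial.aeval_X]
      generalize Polynomial.aeval y⁻¹ a = A at hab ⊢
      generalize Polynomial.aeval y⁻¹ b = B at hab ⊢
      field_simp at hab
      linear_combination y ^ N * hab)
    simpa using h3
  · intro x
    obtain ⟨a, b, c, hc, hx⟩ := h.gen x
    set N := a.natDegree + b.natDegree + c.natDegree
    refine ⟨a.reflect N * Polynomial.X ^ m, b.reflect N, c.reflect N * Polynomial.X ^ m, ?_, ?_⟩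
    · simp [hc]
    · simp only [map_mul, map_pow, Polynomial.aeval_X,
        ← aeval_inv_mul_pow hy' (show a.natDegree ≤ N by omega),
        ← aeval_inv_mul_pow hy' (show b.natDegree ≤ N by omega),
        ← aeval_inv_mul_pow hy' (show c.natDegree ≤ N by omega), inv_inv]
      have hm : y ^ m * y⁻¹ ^ m = 1 := by rw [← mul_pow, mul_inv_cancel₀ hy, one_pow]
      field_simp
      rw [one_div]
      linear_combination hx + (Polynomial.aeval y c * x - Polynomial.aeval y a) * hm

lemma IsHyperellipticPair.isAlgebraic_of_isCanonicalVector_of_eq {κ K : Type} [Field κ]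
    [CharZero κ] [Field K] [Algebra κ K]
    {y w : K} {f : Polynomial κ} (h : IsHyperellipticPair y w f)
    {F : MvPolynomial (Fin 3) κ} (hF : F.IsHomogeneous 4) (hJ : HasPrimaryJacobian F)
    {P : Fin 3 → K} {j : Fin 3} (hj : P j = 1) (h0 : aeval P F = 0) (i : Fin 3) :
    IsAlgebraic κ (P i) := by
  have hy : y ≠ 0 := fun h0 => h.transcendental (h0 ▸ isAlgebraic_zero)
  have hw : w ≠ 0 := by
    rintro rfl
    exact one_ne_zero (h.indep 0 1 (by simp)).2
  have hP : P ≠ 0 := fun h => by simp [h] at hj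
  obtain ⟨D₁, hD₁⟩ := exists_derivation_eq_one h.transcendental h.isAlgebraic_adjoin
  have hD : (w • D₁) y = w := by simp [hD₁]
  set D := w • D₁
  obtain ⟨v, hv⟩ := exists_isCanonicalVector hF D h0 (hJ.exists_ne_zero hP)
  choose p q hpq using h.exists_eq_of_isCanonicalVector hF hJ hD hP hv
  have hq : ∀ i, q i = 0 := fun i => by
    by_contra hqi
    obtain ⟨m, hm1, hm2⟩ : ∃ m, f.natDegree ≤ 2 * m ∧ 2 * m ≤ f.natDegree + 1 :=
      ⟨(f.natDegree + 1) / 2, by omega, by omega⟩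
    have hD' : ((-(y ^ 2 / y ^ m)) • D) y⁻¹ = w / y ^ m := by
      rw [Derivation.smul_apply, Derivation.leibniz_inv, hD, smul_eq_mul, smul_eq_mul]
      field_simp
    obtain ⟨r, s, hrs⟩ := (h.inv hm1 hm2).exists_eq_of_isCanonicalVector hF hJ hD' hP
      (hv.smul_derivation _) i
    rw [hpq] at hrs
    set N := r.natDegree + s.natDegree
    have h3 := (h.indep (Polynomial.X ^ (2 + N) * p i + r.reflect N * Polynomial.X ^ m)
      (Polynomial.X ^ (2 + N) * q i + s.reflect N) (by
        simp only [map_mul, map_pow, map_add, Polynomial.aeval_X,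
          ← aeval_inv_mul_pow hy (show r.natDegree ≤ N by omega),
          ← aeval_inv_mul_pow hy (show s.natDegree ≤ N by omega)]
        generalize Polynomial.aeval y⁻¹ r = A at hrs ⊢
        generalize Polynomial.aeval y⁻¹ s = B at hrs ⊢
        field_simp at hrs
        rw [pow_add]
        linear_combination -y ^ N * hrs)).2
    have h4 : (Polynomial.X ^ (2 + N) * q i).natDegree ≤ N := by
      rw [eq_neg_of_add_eq_zero_left h3, Polynomial.natDegree_neg]
      exact Polynomial.natDegree_reflect_le.trans (by simp; omega)
    rw [Polynomial.natDegree_X_pow_mul _ hqi] at h4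
    omega
  have hvp : ∀ i, v i = Polynomial.aeval y (p i) := fun i => by rw [hpq, hq]; simp
  have hDv : ∀ i, D (v i) = Polynomial.aeval y (Polynomial.derivative (p i)) * w := fun i => by
    rw [hvp, D.map_aeval, hD, smul_eq_mul]
  obtain ⟨g, hg⟩ := id hv
  have hg0 : g = 0 := by
    by_contra hg0
    have hgv : (fun i => g * P i) = v := funext fun i => (hg.1 i).symm
    have hv0 : v ≠ 0 := fun hv0 => by
      have := congrFun hv0 j
      rw [hg.1, hj] at this
      exact hg0 (by simpa using this)
    have hc := hv.smul hF hg0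
    rw [hgv] at hc
    obtain ⟨g', h1, h2⟩ := hc
    have hg' : g' = 1 := by
      have := h1 j
      have h3 : v j ≠ 0 := by rw [hg.1, hj]; simpa using hg0
      exact mul_right_cancel₀ h3 (by rw [← this, one_mul])
    obtain ⟨l, hl⟩ := hJ.exists_ne_zero hv0
    have hpl : aeval v (pderiv l F) = Polynomial.aeval y (aeval p (pderiv l F)) := by
      rw [comp_aeval_apply]
      exact congrArg (fun a => aeval a (pderiv l F)) (funext hvp)
    have key : ∀ a b, v a * D (v b) - v b * D (v a) = aeval v (pderiv l F) → False := by
      intro a b hab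
      have := (h.indep (-aeval p (pderiv l F))
        (p a * Polynomial.derivative (p b) - p b * Polynomial.derivative (p a)) (by
          rw [map_neg, ← hpl, ← hab, hDv, hDv, hvp, hvp]
          simp only [map_sub, map_mul]
          ring)).1
      rw [neg_eq_zero] at this
      rw [hpl, this, map_zero] at hl
      exact hl rfl
    rw [hg', one_mul, one_mul, one_mul] at h2
    fin_cases l
    · exact key _ _ h2.1
    · exact key _ _ h2.2.1
    · exact key _ _ h2.2.2
  have hDP : D (P i) = 0 := by
    obtain ⟨-, h1, h2, h3⟩ := hg
    have h4 : D (P j) = 0 := by rw [hj]; exact D.map_one_eq_zero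
    rw [hg0, zero_mul] at h1 h2 h3
    clear_value D
    clear hv hP hpq hq hvp hDv
    fin_cases j <;> simp only [Fin.zero_eta, Fin.mk_one, Fin.reduceFinMk] at hj h4 <;>
      fin_cases i <;> simp only [Fin.zero_eta, Fin.mk_one, Fin.reduceFinMk] <;>
      simp only [hj, D.map_one_eq_zero, one_mul, mul_zero, sub_zero, zero_sub, neg_eq_zero]
        at h1 h2 h3 ⊢ <;>
      assumption
  exact isAlgebraic_of_derivation_eq_zero D (hD ▸ hw) h.transcendental h.isAlgebraic_adjoin hDP

lemma Polynomial.exists_sq_mul_squarefree {κ : Type} [Field κ] (n : ℕ) :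
    ∀ g : Polynomial κ, g ≠ 0 → g.natDegree ≤ n → ∃ s f, s ≠ 0 ∧ Squarefree f ∧ g = s ^ 2 * f := by
  induction n with
  | zero =>
    intro g hg hn
    have hu : IsUnit g := by
      rw [Polynomial.isUnit_iff_degree_eq_zero, Polynomial.degree_eq_natDegree hg,
        Nat.le_zero.mp hn]
      rfl
    exact ⟨1, g, one_ne_zero, hu.squarefree, by simp⟩
  | succ n ih =>
    intro g hg hn
    by_cases hs : Squarefree g
    · exact ⟨1, g, one_ne_zero, hs, by simp⟩
    simp only [Squarefree, not_forall] at hs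
    obtain ⟨x, ⟨r, hr⟩, hx⟩ := hs
    have hr0 : r ≠ 0 := right_ne_zero_of_mul (hr ▸ hg)
    have hxx : x * x ≠ 0 := left_ne_zero_of_mul (hr ▸ hg)
    have hx0 : x ≠ 0 := left_ne_zero_of_mul hxx
    have hd : x.natDegree ≠ 0 := fun h => hx (by
      rw [Polynomial.isUnit_iff_degree_eq_zero, Polynomial.degree_eq_natDegree hx0, h]
      rfl)
    rw [hr, Polynomial.natDegree_mul hxx hr0, Polynomial.natDegree_mul hx0 hx0] at hn
    obtain ⟨s, f, hs, hf, h⟩ := ih r hr0 (by omega)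
    exact ⟨x * s, f, mul_ne_zero hx0 hs, hf, by rw [hr, h]; ring⟩

lemma Polynomial.exists_eq_expand_add_X_mul_expand {R : Type} [CommRing R] (p : Polynomial R) :
    ∃ A B : Polynomial R, p = Polynomial.expand R 2 A + Polynomial.X * Polynomial.expand R 2 B := by
  induction p using Polynomial.induction_on' with
  | add p q hp hq =>
    obtain ⟨A, B, h⟩ := hp
    obtain ⟨A', B', h'⟩ := hq
    exact ⟨A + A', B + B', by rw [map_add, map_add, h, h']; ring⟩
  | monomial n a =>
    rcases Nat.even_or_odd' n with ⟨m, rfl | rfl⟩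
    · exact ⟨Polynomial.monomial m a, 0, by simp [Polynomial.expand_monomial, mul_comm]⟩
    · exact ⟨0, Polynomial.monomial m a, by
        simp [Polynomial.expand_monomial, Polynomial.X_mul_monomial, mul_comm]⟩

/-- A smooth plane quartic has no nonconstant point over a field of degree at most two over a
purely transcendental extension `κ(y)`. -/
lemma isAlgebraic_of_quadratic {κ K : Type} [Field κ] [CharZero κ] [Field K] [Algebra κ K]
    {y w : K} (hy : Transcendental κ y)
    (hgen : ∀ x : K, ∃ a b c : Polynomial κ, c ≠ 0 ∧
      Polynomial.aeval y c * x = Polynomial.aeval y a + Polynomial.aeval y b * w)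
    {F : MvPolynomial (Fin 3) κ} (hF : F.IsHomogeneous 4) (hJ : HasPrimaryJacobian F)
    {P : Fin 3 → K} {j : Fin 3} (hj : P j = 1) (h0 : aeval P F = 0) (i : Fin 3) :
    IsAlgebraic κ (P i) := by
  have : CharZero K := charZero_of_injective_algebraMap (algebraMap κ K).injective
  have hy0 : y ≠ 0 := fun h0 => hy (h0 ▸ isAlgebraic_zero)
  have hne : ∀ {c : Polynomial κ}, c ≠ 0 → Polynomial.aeval y c ≠ 0 :=
    aeval_ne_zero_of_transcendental hy
  by_cases hind : ∀ a b : Polynomial κ, Polynomial.aeval y a + Polynomial.aeval y b * w = 0 →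
      a = 0 ∧ b = 0
  · obtain ⟨a, b, c, hc, hw⟩ := hgen (w ^ 2)
    have hsq : (2 * Polynomial.aeval y c * w - Polynomial.aeval y b) ^ 2 =
        Polynomial.aeval y (4 * a * c + b ^ 2) := by
      simp only [map_add, map_mul, map_pow, map_ofNat]
      linear_combination 4 * Polynomial.aeval y c * hw
    have h2 : (2 : Polynomial κ) ≠ 0 := two_ne_zero
    have hg : 4 * a * c + b ^ 2 ≠ 0 := fun hg => by
      rw [hg, map_zero] at hsq
      have := (hind (-b) (2 * c) (by
        rw [map_neg, map_mul, map_ofNat]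
        linear_combination pow_eq_zero_iff two_ne_zero |>.mp hsq)).2
      exact mul_ne_zero h2 hc this
    obtain ⟨s, f, hs, hf, hgs⟩ := Polynomial.exists_sq_mul_squarefree _ _ hg le_rfl
    have hs' := hne hs
    have hpair : IsHyperellipticPair y
        ((2 * Polynomial.aeval y c * w - Polynomial.aeval y b) / Polynomial.aeval y s) f := by
      refine ⟨hy, ?_, hf, fun p q hpq => ?_, fun x => ?_⟩
      · rw [div_pow, hsq, hgs, map_mul, map_pow]
        field_simp
      · field_simp at hpq
        obtain ⟨h3, h4⟩ := hind (p * s - q * b) (2 * q * c) (by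
          simp only [map_sub, map_mul, map_ofNat]
          linear_combination hpq)
        have hq : q = 0 := by
          rcases mul_eq_zero.mp h4 with h4 | h4
          · exact (mul_eq_zero.mp h4).resolve_left h2
          · exact absurd h4 hc
        rw [hq, zero_mul, sub_zero] at h3
        exact ⟨(mul_eq_zero.mp h3).resolve_right hs, hq⟩
      · obtain ⟨p, q, r, hr, hx⟩ := hgen x
        refine ⟨2 * c * p + q * b, q * s, 2 * c * r, mul_ne_zero (mul_ne_zero h2 hc) hr, ?_⟩
        simp only [map_add, map_mul, map_ofNat]
        field_simp
        linear_combination 2 * Polynomial.aeval y c * hx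
    exact hpair.isAlgebraic_of_isCanonicalVector_of_eq hF hJ hj h0 i
  · push Not at hind
    obtain ⟨a, b, hab, hne0⟩ := hind
    have hb : b ≠ 0 := fun hb => hne0 (by
      rw [hb, map_zero, zero_mul, add_zero] at hab
      by_contra ha
      exact hne ha hab) hb
    have hgen' : ∀ x : K, ∃ p q : Polynomial κ, q ≠ 0 ∧
        Polynomial.aeval y q * x = Polynomial.aeval y p := fun x => by
      obtain ⟨p, q, r, hr, hx⟩ := hgen x
      refine ⟨p * b - q * a, r * b, mul_ne_zero hr hb, ?_⟩
      simp only [map_sub, map_mul]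
      linear_combination Polynomial.aeval y b * hx + Polynomial.aeval y q * hab
    have hexp : ∀ p : Polynomial κ, Polynomial.aeval y (Polynomial.expand κ 2 p) =
        Polynomial.aeval (y ^ 2) p := fun p => Polynomial.expand_aeval 2 p y
    have hmul : ∀ A B : Polynomial κ, Polynomial.aeval (y ^ 2) A + Polynomial.aeval (y ^ 2) B * y
        = Polynomial.aeval y (Polynomial.expand κ 2 A + Polynomial.X * Polynomial.expand κ 2 B) :=
      fun A B => by rw [map_add, map_mul, hexp, hexp, Polynomial.aeval_X, mul_comm y]
    have hAB : ∀ A B : Polynomial κ,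
        Polynomial.expand κ 2 A + Polynomial.X * Polynomial.expand κ 2 B = 0 → A = 0 ∧ B = 0 := by
      intro A B h
      constructor
      · ext n
        have := congrArg (fun p => p.coeff (n * 2)) h
        simp only [Polynomial.coeff_add, Polynomial.coeff_zero] at this
        rw [Polynomial.coeff_expand_mul two_pos] at this
        rcases n with _ | n
        · simpa using this
        · rw [show (n + 1) * 2 = (n * 2 + 1) + 1 by ring, Polynomial.coeff_X_mul,
            Polynomial.coeff_expand two_pos, if_neg (by omega), add_zero] at this
          simpa using this
      · ext n
        have := congrArg (fun p => p.coeff (n * 2 + 1)) h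
        simp only [Polynomial.coeff_add, Polynomial.coeff_zero] at this
        rw [Polynomial.coeff_X_mul, Polynomial.coeff_expand_mul two_pos,
            Polynomial.coeff_expand two_pos, if_neg (by omega), zero_add] at this
        simpa using this
    have hy2 : Transcendental κ (y ^ 2) := fun h => hy (h.of_pow two_pos)
    have hpair : IsHyperellipticPair (y ^ 2) y (Polynomial.X : Polynomial κ) := by
      refine ⟨hy2, by simp, Polynomial.irreducible_X.squarefree, fun A B h => ?_, fun x => ?_⟩
      · rw [hmul] at h
        refine hAB A B ?_
        by_contra hcon
        exact hne hcon h
      · obtain ⟨p, q, hq, hx⟩ := hgen' x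
        obtain ⟨A, B, hp⟩ := Polynomial.exists_eq_expand_add_X_mul_expand p
        obtain ⟨A', B', hq'⟩ := Polynomial.exists_eq_expand_add_X_mul_expand q
        have hpy := hmul A B
        have hqy := hmul A' B'
        rw [← hp] at hpy
        rw [← hq'] at hqy
        have hqm := hmul A' (-B')
        refine ⟨A * A' - Polynomial.X * B * B', B * A' - A * B', A' ^ 2 - Polynomial.X * B' ^ 2,
          fun h0 => ?_, ?_⟩
        · have h3 : Polynomial.aeval y q * Polynomial.aeval y
              (Polynomial.expand κ 2 A' + Polynomial.X * Polynomial.expand κ 2 (-B')) = 0 := by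
            rw [← hqm, ← hqy]
            have := congrArg (Polynomial.aeval (y ^ 2)) h0
            simp only [map_sub, map_mul, map_pow, Polynomial.aeval_X, map_zero, map_neg] at this ⊢
            linear_combination this
          rcases mul_eq_zero.mp h3 with h3 | h3
          · exact hne hq h3
          · by_cases h4 : Polynomial.expand κ 2 A' + Polynomial.X * Polynomial.expand κ 2 (-B') = 0
            · obtain ⟨h5, h6⟩ := hAB _ _ h4
              rw [neg_eq_zero] at h6
              exact hq (by rw [hq', h5, h6]; simp)
            · exact hne h4 h3
        · simp only [map_sub, map_mul, map_pow, Polynomial.aeval_X]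
          rw [← hqy, ← hpy] at hx
          linear_combination (Polynomial.aeval (y ^ 2) A' - Polynomial.aeval (y ^ 2) B' * y) * hx
    exact hpair.isAlgebraic_of_isCanonicalVector_of_eq hF hJ hj h0 i

lemma IsSmoothPlaneCurve.hasPrimaryJacobian {k : Type} [Field k] {d : ℕ}
    {F : MvPolynomial (Fin 3) k} (hF : IsSmoothPlaneCurve d F) : HasPrimaryJacobian F := by
  intro j
  change X j ∈ (Ideal.span (Set.range fun l => pderiv l F)).radical
  rw [← vanishingIdeal_zeroLocus_eq_radical (K := AlgebraicClosure k)]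
  intro P hP
  rw [aeval_X]
  by_contra hj
  obtain ⟨i, hi⟩ := hF.2 P fun h => hj (by rw [h]; rfl)
  refine hi ?_
  rw [eval_map, ← aeval_def]
  exact hP _ (Ideal.subset_span ⟨i, rfl⟩)

lemma HasPrimaryJacobian.map {k κ : Type} [Field k] [Field κ] (φ : k →+* κ)
    {F : MvPolynomial (Fin 3) k} (hF : HasPrimaryJacobian F) :
    HasPrimaryJacobian (MvPolynomial.map φ F) := by
  intro j
  obtain ⟨N, hN⟩ := hF j
  refine ⟨N, ?_⟩
  have := Ideal.mem_map_of_mem (MvPolynomial.map φ) hN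
  rw [Ideal.map_span, ← Set.range_comp, map_pow, map_X] at this
  convert this using 4
  exact pderiv_map

lemma isAlgebraic_div_of_quadratic {κ K : Type} [Field κ] [CharZero κ] [Field K] [Algebra κ K]
    {y w : K} (hy : Transcendental κ y)
    (hgen : ∀ x : K, ∃ a b c : Polynomial κ, c ≠ 0 ∧
      Polynomial.aeval y c * x = Polynomial.aeval y a + Polynomial.aeval y b * w)
    {F : MvPolynomial (Fin 3) κ} (hF : F.IsHomogeneous 4) (hJ : HasPrimaryJacobian F)
    {P : Fin 3 → K} {j : Fin 3} (hj : P j ≠ 0) (h0 : aeval P F = 0) (i : Fin 3) :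
    IsAlgebraic κ (P i / P j) := by
  have h := isAlgebraic_of_quadratic hy hgen hF hJ (P := fun i => (P j)⁻¹ * P i) (j := j)
    (inv_mul_cancel₀ hj) (by rw [aeval_mul_of_isHomogeneous hF, h0, mul_zero]) i
  rwa [mul_comm, ← div_eq_mul_inv] at h

/-- The restriction of `F` to the line through `q` and `p`, as a polynomial in the coordinate
`Z` of the point `q + Z p`. -/
def lineRestrict {κ : Type} [Field κ] (F : MvPolynomial (Fin 3) κ)
    (q p : Fin 3 → κ) : Polynomial κ :=
  aeval (fun i => Polynomial.C (q i) + Polynomial.C (p i) * Polynomial.X) F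

lemma aeval_lineRestrict {κ K : Type} [Field κ] [CommRing K] [Algebra κ K]
    (F : MvPolynomial (Fin 3) κ) (q p : Fin 3 → κ) (z : K) :
    Polynomial.aeval z (lineRestrict F q p) =
      aeval (fun i => algebraMap κ K (q i) + algebraMap κ K (p i) * z) F := by
  rw [lineRestrict, comp_aeval_apply]
  simp

lemma lineRestrict_ne_zero {κ : Type} [Field κ] [CharZero κ]
    {F : MvPolynomial (Fin 3) κ} (hF : F.IsHomogeneous 4) (hJ : HasPrimaryJacobian F)
    {q p : Fin 3 → κ} {j : Fin 3} (hpj : p j = 1) (hqj : q j = 0) (hq : q ≠ 0) :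
    lineRestrict F q p ≠ 0 := by
  intro h
  obtain ⟨i, hi⟩ := Function.ne_iff.mp hq
  have hX : Transcendental κ (RatFunc.X : RatFunc κ) := RatFunc.transcendental_X
  have hX0 : (RatFunc.X : RatFunc κ) ≠ 0 := RatFunc.X_ne_zero
  have hae : ∀ p : Polynomial κ, Polynomial.aeval (RatFunc.X : RatFunc κ) p =
      algebraMap (Polynomial κ) (RatFunc κ) p := fun p => by
    rw [← RatFunc.algebraMap_X, Polynomial.aeval_algebraMap_apply, Polynomial.aeval_X_left_apply]
  have h1 := aeval_lineRestrict F q p (RatFunc.X : RatFunc κ)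
  rw [h, map_zero] at h1
  have h2 := isAlgebraic_div_of_quadratic (w := 0) hX (fun x => by
      refine ⟨x.num, 0, x.denom, x.denom_ne_zero, ?_⟩
      rw [hae, hae, mul_zero, add_zero]
      have hd : algebraMap (Polynomial κ) (RatFunc κ) x.denom ≠ 0 := by
        simpa using x.denom_ne_zero
      conv_rhs => rw [← mul_div_cancel₀ (algebraMap (Polynomial κ) (RatFunc κ) x.num) hd,
        RatFunc.num_div_denom x]) hF hJ
    (P := fun i => algebraMap κ (RatFunc κ) (q i) + algebraMap κ (RatFunc κ) (p i) * RatFunc.X)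
    (j := j) (by simpa [hpj, hqj] using hX0) h1.symm i
  have h3 : (RatFunc.X : RatFunc κ)⁻¹ = ((algebraMap κ (RatFunc κ) (q i) +
      algebraMap κ (RatFunc κ) (p i) * RatFunc.X) / (algebraMap κ (RatFunc κ) (q j) +
      algebraMap κ (RatFunc κ) (p j) * RatFunc.X) - algebraMap κ (RatFunc κ) (p i)) *
      algebraMap κ (RatFunc κ) (q i)⁻¹ := by
    have : algebraMap κ (RatFunc κ) (q i) ≠ 0 := by simpa using hi
    rw [hpj, hqj, map_inv₀, map_zero, map_one, zero_add, one_mul]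
    field_simp
    ring
  have h4 : IsAlgebraic κ (RatFunc.X : RatFunc κ)⁻¹ := by
    rw [h3]
    exact (h2.sub (isAlgebraic_algebraMap _)).mul (isAlgebraic_algebraMap _)
  exact hX (by simpa using h4.inv)

lemma natDegree_lineRestrict_le_four {κ : Type} [Field κ]
    {F : MvPolynomial (Fin 3) κ} (hF : F.IsHomogeneous 4) (q p : Fin 3 → κ) :
    (lineRestrict F q p).natDegree ≤ 4 := by
  refine (aeval_natDegree_le (m := 4) (n := 1) F hF.totalDegree_le _ fun i => ?_)
  rw [add_comm]
  exact Polynomial.natDegree_linear_le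

lemma lineRestrict_eq_reflect {κ : Type} [Field κ] [CharZero κ]
    {F : MvPolynomial (Fin 3) κ} (hF : F.IsHomogeneous 4) (q p : Fin 3 → κ) :
    lineRestrict F q p = (lineRestrict F p q).reflect 4 := by
  refine Polynomial.eq_of_infinite_eval_eq _ _ (Set.Infinite.mono
    (s := {x | x ≠ 0}) ?_ (Set.Finite.infinite_compl (Set.finite_singleton (0 : κ))))
  intro z hz
  change Polynomial.eval z _ = Polynomial.eval z _
  have h := aeval_inv_mul_pow (y := z) hz (natDegree_lineRestrict_le_four hF p q)
  rw [← Polynomial.coe_aeval_eq_eval, ← h, aeval_lineRestrict, aeval_lineRestrict, mul_comm,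
    ← aeval_mul_of_isHomogeneous hF]
  congr 2
  funext i
  simp only [Algebra.algebraMap_self, RingHom.id_apply]
  have : z ≠ 0 := hz
  field_simp
  ring

lemma natDegree_lineRestrict_le_three {κ : Type} [Field κ] [CharZero κ]
    {F : MvPolynomial (Fin 3) κ} (hF : F.IsHomogeneous 4) (q : Fin 3 → κ) {p : Fin 3 → κ}
    (hp : eval p F = 0) : (lineRestrict F q p).natDegree ≤ 3 := by
  rw [Polynomial.natDegree_le_iff_coeff_eq_zero]
  intro n hn
  rcases eq_or_lt_of_le (Nat.succ_le_of_lt hn) with h | h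
  · rw [lineRestrict_eq_reflect hF, Polynomial.coeff_reflect, ← h, Polynomial.revAt_le (by norm_num)]
    change Polynomial.coeff _ 0 = 0
    rw [Polynomial.coeff_zero_eq_aeval_zero, aeval_lineRestrict]
    simpa using hp
  · exact Polynomial.coeff_eq_zero_of_natDegree_lt
      ((natDegree_lineRestrict_le_four hF q p).trans_lt h)

lemma coeff_three_lineRestrict {κ : Type} [Field κ] [CharZero κ]
    {F : MvPolynomial (Fin 3) κ} (hF : F.IsHomogeneous 4) (q p : Fin 3 → κ) :
    (lineRestrict F q p).coeff 3 = ∑ i, eval p (pderiv i F) * q i := by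
  rw [lineRestrict_eq_reflect hF, Polynomial.coeff_reflect, Polynomial.revAt_le (by norm_num)]
  have h1 := Polynomial.coeff_derivative (lineRestrict F p q) 0
  have h2 := derivation_aeval_eq_sum (Polynomial.derivative' (R := κ)) 
    (fun i => Polynomial.C (p i) + Polynomial.C (q i) * Polynomial.X) F
  have h3 := congrArg (Polynomial.aeval (0 : κ)) h2
  change (lineRestrict F p q).coeff 1 = _
  rw [zero_add, Nat.cast_zero, zero_add, mul_one] at h1
  rw [← h1, Polynomial.coeff_zero_eq_aeval_zero]
  change Polynomial.aeval 0 (Polynomial.derivative (lineRestrict F p q)) = _ at h3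
  rw [h3, map_sum]
  refine Finset.sum_congr rfl fun i _ => ?_
  rw [map_mul, comp_aeval_apply]
  simp

/-- The linear change of coordinates whose third column is `p`. -/
def projMatrix {k : Type} [Field k] (i₁ i₂ : Fin 3) (p : Fin 3 → k) : Matrix (Fin 3) (Fin 3) k :=
  Matrix.of fun i => ![Pi.single (M := fun _ => k) i₁ 1 i, Pi.single (M := fun _ => k) i₂ 1 i, p i]

lemma isUnit_det_projMatrix {k : Type} [Field k] {i₁ i₂ j : Fin 3} (h₁ : i₁ ≠ j) (h₂ : i₂ ≠ j)
    (h₁₂ : i₁ ≠ i₂) {p : Fin 3 → k} (hp : p j = 1) : IsUnit (projMatrix i₁ i₂ p).det := by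
  rw [Matrix.det_fin_three]
  fin_cases j <;> fin_cases i₁ <;> fin_cases i₂ <;> simp at h₁ h₂ h₁₂ <;>
    simp at hp <;> simp [projMatrix, hp]

lemma hasInfiniteLevelProg_of_coeff_ne_zero {k : Type} [Field k] [CharZero k]
    {F : MvPolynomial (Fin 3) k} (hF : F.IsHomogeneous 4) {i₁ i₂ : Fin 3}
    {p : Fin 3 → k} (hp : eval p F = 0) {x : ℕ → k} (hx : Function.Injective x)
    (hc : ∀ i, (lineRestrict F (Pi.single i₁ (x i) + Pi.single i₂ 1) p).coeff 3 ≠ 0) {n : ℕ}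
    (hn : 3 ≤ n) :
    HasInfiniteLevelProg (aeval (fun i => ∑ j, C (projMatrix i₁ i₂ p i j) * X j) F) x n := by
  have hroot : ∀ i, ∃ z : AlgebraicClosure k,
      Polynomial.aeval z (lineRestrict F (Pi.single i₁ (x i) + Pi.single i₂ 1) p) = 0 := fun i => by
    refine IsAlgClosed.exists_aeval_eq_zero _ _ fun h => ?_
    have := Polynomial.coeff_eq_zero_of_degree_lt (n := 3) (by rw [h]; norm_num)
    exact hc i this
  choose z hz using hroot
  refine ⟨fun i => ![algebraMap k _ (x i), 1, z i], fun i i' h => ?_, fun i => ⟨?_, rfl, rfl, ?_⟩⟩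
  · exact hx ((algebraMap k (AlgebraicClosure k)).injective (congrFun h 0))
  · rw [eval_map, ← aeval_def, comp_aeval_apply]
    have hzi := hz i
    rw [aeval_lineRestrict] at hzi
    rw [← hzi]
    congr 2
    funext l
    rw [map_sum, Fin.sum_univ_three]
    simp only [map_mul, aeval_X, algHom_C, projMatrix, Pi.single_apply, Pi.add_apply]
    simp
    split_ifs
    · rfl
    · rw [map_zero]
  · set H := lineRestrict F (Pi.single i₁ (x i) + Pi.single i₂ 1) p
    have hH0 : H ≠ 0 := fun h => hc i (by change H.coeff 3 = 0; rw [h, Polynomial.coeff_zero])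
    have hy_int : IsIntegral k (z i) := Algebra.IsIntegral.isIntegral _
    have hle : IntermediateField.adjoin k (Set.range ![algebraMap k (AlgebraicClosure k) (x i), 1, z i])
        ≤ IntermediateField.adjoin k {z i} := by
      rw [IntermediateField.adjoin_le_iff]
      rintro _ ⟨l, rfl⟩
      fin_cases l
      · exact algebraMap_mem _ _
      · exact one_mem _
      · exact IntermediateField.mem_adjoin_simple_self k _
    have hfd : FiniteDimensional k (IntermediateField.adjoin k {z i}) :=
      IntermediateField.adjoin.finiteDimensional hy_int
    refine ((IntermediateField.finrank_le_of_le_right hle).trans ?_).trans hn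
    rw [IntermediateField.adjoin.finrank hy_int]
    exact (Polynomial.natDegree_le_of_dvd (minpoly.dvd k _ (hz i)) hH0).trans
      (natDegree_lineRestrict_le_three hF _ hp)

lemma exists_forall_coeff_ne_zero {k : Type} [Field k] [CharZero k]
    {F : MvPolynomial (Fin 3) k} (hF : F.IsHomogeneous 4) (hJ : HasPrimaryJacobian F)
    {i₁ i₂ j : Fin 3} (h₁ : i₁ ≠ j) (h₂ : i₂ ≠ j)
    (h₁₂ : i₁ ≠ i₂) {p : Fin 3 → k} (hj : p j = 1) (hp : eval p F = 0) {y : ℕ → ℕ}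
    (hy : ∀ i, 0 < y i) : ∃ ε : k, ε ≠ 0 ∧
      ∀ i, (lineRestrict F (Pi.single i₁ (ε * y i) + Pi.single i₂ 1) p).coeff 3 ≠ 0 := by
  by_contra! hcon
  have hsum : ∀ c : k, (lineRestrict F (Pi.single i₁ c + Pi.single i₂ 1) p).coeff 3 =
      eval p (pderiv i₁ F) * c + eval p (pderiv i₂ F) := fun c => by
    rw [coeff_three_lineRestrict hF]
    simp only [Pi.add_apply, mul_add, Finset.sum_add_distrib, Pi.single_apply, mul_ite, mul_zero,
      Finset.sum_ite_eq', Finset.mem_univ, if_true, mul_one]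
  obtain ⟨a, ha⟩ := hcon 1 one_ne_zero
  obtain ⟨b, hb⟩ := hcon (-1) (neg_ne_zero.mpr one_ne_zero)
  rw [hsum] at ha hb
  have hpos : ((y a : k) + y b) ≠ 0 := by
    rw [← Nat.cast_add]
    exact Nat.cast_ne_zero.mpr (by have := hy a; omega)
  have hd1 : eval p (pderiv i₁ F) = 0 := by
    apply mul_right_cancel₀ hpos
    linear_combination ha - hb
  have hd2 : eval p (pderiv i₂ F) = 0 := by
    rw [hd1] at ha
    linear_combination ha
  have heul : ∑ i, p i * eval p (pderiv i F) = 0 := by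
    have := congrArg (eval p) hF.sum_X_mul_pderiv
    simpa [hp] using this
  have hd3 : eval p (pderiv j F) = 0 := by
    rw [Fin.sum_univ_three] at heul
    fin_cases j <;> fin_cases i₁ <;> fin_cases i₂ <;> simp at h₁ h₂ h₁₂ <;>
      simp_all
  obtain ⟨l, hl⟩ := hJ.exists_ne_zero (K := k) (P := p) (fun h => by simp [h] at hj)
  refine hl ?_
  change eval p (pderiv l F) = 0
  have hl' : l = i₁ ∨ l = i₂ ∨ l = j := by omega
  rcases hl' with rfl | rfl | rfl <;> assumption

lemma exists_infinite_level_progressions {k : Type} [Field k] [CharZero k]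
    {F : MvPolynomial (Fin 3) k} (hF : F.IsHomogeneous 4) (hJ : HasPrimaryJacobian F)
    {p : Fin 3 → k} {j : Fin 3} (hj : p j = 1) (hp : eval p F = 0) {n : ℕ} (hn : 3 ≤ n) :
    ∃ F' : MvPolynomial (Fin 3) k, IsLinearChange F F' ∧
      (∃ x : ℕ → k, IsGeomProg x ∧ Function.Injective x ∧ HasInfiniteLevelProg F' x n) ∧
      (∃ x : ℕ → k, IsArithProg x ∧ Function.Injective x ∧ HasInfiniteLevelProg F' x n) := by
  obtain ⟨i₁, i₂, h₁, h₂, h₁₂⟩ : ∃ i₁ i₂ : Fin 3, i₁ ≠ j ∧ i₂ ≠ j ∧ i₁ ≠ i₂ := by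
    fin_cases j
    · exact ⟨1, 2, by decide, by decide, by decide⟩
    · exact ⟨0, 2, by decide, by decide, by decide⟩
    · exact ⟨0, 1, by decide, by decide, by decide⟩
  have hprog : ∀ y : ℕ → ℕ, Function.Injective y → (∀ i, 0 < y i) → ∃ ε : k, ε ≠ 0 ∧
      Function.Injective (fun i => ε * y i) ∧ HasInfiniteLevelProg
        (aeval (fun i => ∑ j, C (projMatrix i₁ i₂ p i j) * X j) F) (fun i => ε * y i) n := by
    intro y hy hpos
    obtain ⟨ε, hε, h⟩ := exists_forall_coeff_ne_zero hF hJ h₁ h₂ h₁₂ hj hp hpos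
    have hinj : Function.Injective (fun i => ε * (y i : k)) := fun a b hab =>
      hy (Nat.cast_injective (mul_left_cancel₀ hε hab))
    exact ⟨ε, hε, hinj, hasInfiniteLevelProg_of_coeff_ne_zero hF hp hinj h hn⟩
  refine ⟨_, ⟨(projMatrix i₁ i₂ p).nonsingInvUnit (isUnit_det_projMatrix h₁ h₂ h₁₂ hj), rfl⟩, ?_, ?_⟩
  · obtain ⟨ε, hε, h1, h2⟩ := hprog (fun i => 2 ^ (i + 1))
      (fun a b h => by simpa using Nat.pow_right_injective le_rfl h) (fun i => by positivity)
    exact ⟨_, ⟨2, ε, two_ne_zero, hε, fun i => by push_cast; rfl⟩, h1, h2⟩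
  · obtain ⟨ε, hε, h1, h2⟩ := hprog (fun i => i + 2)
      (fun a b h => by simpa using h) (fun i => by positivity)
    exact ⟨_, ⟨ε, ε, hε, hε, fun i => by push_cast; ring⟩, h1, h2⟩

lemma exists_basis_of_finrank_le_two {L K : Type} [Field L] [Field K] [Algebra L K]
    (h0 : 0 < Module.finrank L K) (h2 : Module.finrank L K ≤ 2) :
    ∃ w : K, ∀ z : K, ∃ r s : L, z = algebraMap L K r + algebraMap L K s * w := by
  have : FiniteDimensional L K := Module.finite_of_finrank_pos h0
  by_cases h : ∀ w : K, ∃ c : L, c • (1 : K) = w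
  · refine ⟨0, fun z => ?_⟩
    obtain ⟨c, rfl⟩ := h z
    exact ⟨c, 0, by rw [Algebra.smul_def]; ring⟩
  · push Not at h
    obtain ⟨w, hw⟩ := h
    have hli : LinearIndependent L ![1, w] := (LinearIndependent.pair_iff' one_ne_zero).mpr hw
    have hc := hli.fintype_card_le_finrank
    rw [Fintype.card_fin] at hc
    have hs := hli.span_eq_top_of_card_eq_finrank' (by rw [Fintype.card_fin]; omega)
    refine ⟨w, fun z => ?_⟩
    have hz : z ∈ Submodule.span L (Set.range ![1, w]) := hs ▸ Submodule.mem_top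
    rw [Matrix.range_cons, Matrix.range_cons, Matrix.range_empty, Set.union_empty,
      Set.singleton_union, Submodule.mem_span_pair] at hz
    obtain ⟨r, s, rfl⟩ := hz
    exact ⟨r, s, by rw [Algebra.smul_def, Algebra.smul_def, mul_one]⟩

lemma exists_third (i j : Fin 3) (h : i ≠ j) :
    ∃ l : Fin 3, l ≠ i ∧ l ≠ j ∧ ∀ m, m = i ∨ m = j ∨ m = l := by
  revert i j
  decide

lemma exists_polynomial_div_of_mem_adjoin {k K : Type} [Field k] [Field K] [Algebra k K] {x : K}
    (hx : Transcendental k x) (r : IntermediateField.adjoin k {x}) :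
    ∃ a c : Polynomial k, c ≠ 0 ∧ Polynomial.aeval x c * (r : K) = Polynomial.aeval x a := by
  obtain ⟨a, c, h⟩ := (IntermediateField.mem_adjoin_simple_iff k _).mp r.2
  by_cases hc : c = 0
  · refine ⟨0, 1, one_ne_zero, ?_⟩
    rw [h, hc]
    simp
  · refine ⟨a, c, hc, ?_⟩
    rw [h, mul_div_cancel₀ _ (aeval_ne_zero_of_transcendental hx hc)]

lemma adjoin_range_eq_top {k K L : Type} [Field k] [Field K] [Algebra k K] {P : Fin 3 → K}
    (hgen : IntermediateField.adjoin k (Set.range P) = ⊤) [Field L] [Algebra L K]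
    [Algebra k L] [IsScalarTower k L K]
    {E : IntermediateField L K} (hE : ∀ i, P i ∈ E) : E = ⊤ := by
  rw [eq_top_iff]
  intro z _
  have h : IntermediateField.adjoin k (Set.range P) ≤ E.restrictScalars k := by
    rw [IntermediateField.adjoin_le_iff]
    rintro _ ⟨i, rfl⟩
    exact hE i
  exact h (hgen ▸ IntermediateField.mem_top)

section FunctionField

variable {k K : Type} [Field k] [CharZero k] [Field K] [Algebra k K]
  {F : MvPolynomial (Fin 3) k} {P : Fin 3 → K} {x : K}

lemma three_le_finrank_of_finite (hF : F.IsHomogeneous 4) (hJ : HasPrimaryJacobian F)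
    {j : Fin 3} (hj : P j = 1) (h0 : aeval P F = 0) {i : Fin 3} (hi : Transcendental k (P i))
    (hx : Transcendental k x) (hfin : 0 < Module.finrank (IntermediateField.adjoin k {x}) K) :
    3 ≤ Module.finrank (IntermediateField.adjoin k {x}) K := by
  by_contra! h
  obtain ⟨w, hw⟩ := exists_basis_of_finrank_le_two hfin (by omega)
  refine hi (isAlgebraic_of_quadratic (w := w) hx (fun z => ?_) hF hJ hj h0 i)
  obtain ⟨r, s, rfl⟩ := hw z
  obtain ⟨a, c, hc, hac⟩ := exists_polynomial_div_of_mem_adjoin hx r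
  obtain ⟨b, d, hd, hbd⟩ := exists_polynomial_div_of_mem_adjoin hx s
  refine ⟨d * a, c * b, c * d, mul_ne_zero hc hd, ?_⟩
  change _ * ((r : K) + (s : K) * w) = _
  simp only [map_mul]
  rw [← hac, ← hbd]
  ring

lemma finrank_adjoin_pos (hF : F.IsHomogeneous 4) (hJ : HasPrimaryJacobian F)
    (hgen : IntermediateField.adjoin k (Set.range P) = ⊤)
    {j : Fin 3} (hj : P j = 1) (h0 : aeval P F = 0) {i : Fin 3} (hi : Transcendental k (P i))
    (hx : Transcendental k x) : 0 < Module.finrank (IntermediateField.adjoin k {x}) K := by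
  have hij : i ≠ j := by
    rintro rfl
    exact hi (hj ▸ isAlgebraic_one)
  obtain ⟨l, hli, hlj, hl⟩ := exists_third i j hij
  set L := IntermediateField.adjoin k {P i}
  have halg : ∀ m, IsAlgebraic L (P m) := by
    have hil : IsAlgebraic L (P i) := by
      have := isAlgebraic_algebraMap (A := K)
        (⟨P i, IntermediateField.mem_adjoin_simple_self k _⟩ : L)
      exact this
    intro m
    rcases hl m with rfl | rfl | rfl
    · exact hil
    · rw [hj]; exact isAlgebraic_one
    · refine ⟨lineRestrict (MvPolynomial.map (algebraMap k L) F)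
        (Function.update (Pi.single j 1) i ⟨P i, IntermediateField.mem_adjoin_simple_self k _⟩)
        (Pi.single m 1), ?_, ?_⟩
      · refine lineRestrict_ne_zero (hF.map _) (hJ.map _) (j := m) (by simp) ?_ ?_
        · simp [Function.update_of_ne hli, hlj]
        · refine Function.ne_iff.mpr ⟨j, ?_⟩
          simp [Function.update_of_ne hij.symm]
      · rw [aeval_lineRestrict, aeval_map_algebraMap, ← h0]
        congr 2
        funext n
        rcases hl n with rfl | rfl | rfl
        · simp [hli.symm]
        · simp [hlj.symm, hij.symm, hj]
        · simp [hli, hlj]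
  have hall : ∀ z : K, IsAlgebraic L z := by
    have htop : algebraicClosure L K = ⊤ :=
      adjoin_range_eq_top hgen fun m => mem_algebraicClosure_iff.mpr (halg m)
    intro z
    rw [← mem_algebraicClosure_iff, htop]
    exact IntermediateField.mem_top
  have hfin := IntermediateField.finiteDimensional_adjoin (K := IntermediateField.adjoin k {x})
    (S := Set.range P) fun z _ => (isAlgebraic_adjoin_of_transcendental hi hall hx z).isIntegral
  rw [adjoin_range_eq_top hgen (E := IntermediateField.adjoin (IntermediateField.adjoin k {x})
    (Set.range P)) fun m => IntermediateField.subset_adjoin _ _ ⟨m, rfl⟩] at hfin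
  rw [← IntermediateField.finrank_top']
  exact Module.finrank_pos

lemma exists_finrank_adjoin_le_three (hF : F.IsHomogeneous 4) (hJ : HasPrimaryJacobian F)
    (hgen : IntermediateField.adjoin k (Set.range P) = ⊤)
    {j : Fin 3} (hj : P j = 1) (h0 : aeval P F = 0) {i : Fin 3} (hi : Transcendental k (P i))
    {p : Fin 3 → k} {l : Fin 3} (hl : p l = 1) (hp : eval p F = 0) :
    ∃ x : K, Transcendental k x ∧ Module.finrank (IntermediateField.adjoin k {x}) K ≤ 3 := by
  obtain ⟨m, hm⟩ : ∃ m, P m - algebraMap k K (p m) * P l ≠ 0 := by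
    by_contra! h
    simp only [sub_eq_zero] at h
    have h1 : algebraMap k K (p j) * P l = 1 := by rw [← h, hj]
    have hPl : P l = algebraMap k K (p j)⁻¹ := by
      rw [map_inv₀]
      exact eq_inv_of_mul_eq_one_right h1
    refine hi ?_
    rw [h i, hPl, ← map_mul]
    exact isAlgebraic_algebraMap _
  have hml : m ≠ l := by
    rintro rfl
    exact hm (by rw [hl, map_one, one_mul, sub_self])
  obtain ⟨n, hnm, hnl, hn⟩ := exists_third m l hml
  set β := P m - algebraMap k K (p m) * P l
  set x := (P n - algebraMap k K (p n) * P l) / β with hxdef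
  set z := P l / β
  set L := IntermediateField.adjoin k {x}
  set q : Fin 3 → L := Function.update (Pi.single m 1) n
    ⟨x, IntermediateField.mem_adjoin_simple_self k _⟩
  set f := lineRestrict (MvPolynomial.map (algebraMap k L) F) q (fun s => algebraMap k L (p s))
  have hql : q l = 0 := by simp [q, Function.update_of_ne hnl.symm, hml.symm]
  have hqm : q m = 1 := by simp [q, Function.update_of_ne hnm.symm]
  have hqn : algebraMap L K (q n) = x := by simp [q]
  have hf0 : f ≠ 0 := by
    refine lineRestrict_ne_zero (hF.map _) (hJ.map _) (j := l) (by simp [hl]) hql ?_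
    exact Function.ne_iff.mpr ⟨m, by simp [hqm]⟩
  have hf3 : f.natDegree ≤ 3 := by
    refine natDegree_lineRestrict_le_three (hF.map _) q ?_
    change eval (algebraMap k L ∘ p) _ = 0
    rw [eval_map, ← eval₂_comp, hp, map_zero]
  have hpoint : ∀ s, algebraMap L K (q s) + algebraMap L K (algebraMap k L (p s)) * z =
      β⁻¹ * P s := by
    intro s
    rw [← IsScalarTower.algebraMap_apply]
    rcases hn s with rfl | rfl | rfl
    · rw [hqm, map_one]
      simp only [z]
      field_simp
      simp only [β]
      ring
    · rw [hql, hl, map_one, map_zero]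
      simp only [z]
      ring
    · rw [hqn]
      simp only [z, hxdef]
      field_simp
      ring
  have hfz : Polynomial.aeval z f = 0 := by
    rw [aeval_lineRestrict, aeval_map_algebraMap]
    simp only [hpoint]
    rw [aeval_mul_of_isHomogeneous hF, h0, mul_zero]
  have hz : IsAlgebraic L z := ⟨f, hf0, hfz⟩
  have hPz : ∀ s, β⁻¹ * P s ∈ IntermediateField.adjoin L {z} := by
    intro s
    rw [← hpoint]
    exact add_mem (algebraMap_mem _ _) (mul_mem (algebraMap_mem _ _)
      (IntermediateField.mem_adjoin_simple_self L z))
  have htop : IntermediateField.adjoin L {z} = ⊤ := by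
    refine adjoin_range_eq_top hgen fun s => ?_
    have h1 := div_mem (hPz s) (hPz j)
    rwa [hj, mul_one, mul_comm, mul_div_assoc, div_self (inv_ne_zero hm), mul_one] at h1
  refine ⟨x, fun hx => hi ?_, ?_⟩
  · have : Algebra.IsAlgebraic k L := IntermediateField.isAlgebraic_adjoin_simple hx.isIntegral
    have : Algebra.IsAlgebraic L (IntermediateField.adjoin L {z}) :=
      IntermediateField.isAlgebraic_adjoin_simple hz.isIntegral
    rw [htop] at this
    have h2 : IsAlgebraic L (P i) := by
      have h3 := this.isAlgebraic ⟨P i, IntermediateField.mem_top⟩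
      exact h3.algebraMap (A := K)
    exact h2.restrictScalars k
  · rw [← IntermediateField.finrank_top', ← htop, IntermediateField.adjoin.finrank hz.isIntegral]
    exact (Polynomial.natDegree_le_of_dvd (minpoly.dvd _ _ hfz) hf0).trans hf3

lemma gonality_eq_three (hF : F.IsHomogeneous 4) (hJ : HasPrimaryJacobian F)
    (hgen : IntermediateField.adjoin k (Set.range P) = ⊤)
    {j : Fin 3} (hj : P j = 1) (h0 : aeval P F = 0) {i : Fin 3} (hi : Transcendental k (P i))
    {p : Fin 3 → k} {l : Fin 3} (hl : p l = 1) (hp : eval p F = 0) :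
    gonality k K = 3 := by
  have hlow : ∀ x : K, Transcendental k x →
      3 ≤ Module.finrank (IntermediateField.adjoin k {x}) K := fun x hx =>
    three_le_finrank_of_finite hF hJ hj h0 hi hx (finrank_adjoin_pos hF hJ hgen hj h0 hi hx)
  obtain ⟨x, hx, hx3⟩ := exists_finrank_adjoin_le_three hF hJ hgen hj h0 hi hl hp
  refine le_antisymm (Nat.sInf_le ⟨x, hx, le_antisymm hx3 (hlow x hx)⟩) ?_
  refine le_csInf ⟨_, x, hx, rfl⟩ ?_
  rintro n ⟨y, hy, rfl⟩
  exact hlow y hy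

end FunctionField

lemma degreeOf_eq_zero_of_dvd_aeval_X {k : Type} [Field k] {f : MvPolynomial (Fin 2) k}
    {i l : Fin 2} (hil : l ≠ i) {g : Polynomial k} (hg : g ≠ 0)
    (hfg : f ∣ Polynomial.aeval (X i) g) : f ≠ 0 ∧ degreeOf l f = 0 := by
  have hG : Polynomial.aeval (X i : MvPolynomial (Fin 2) k) g ≠ 0 := fun h =>
    hg ((transcendental_iff.mp (transcendental_X k i)) g h)
  have hdeg : degreeOf l (Polynomial.aeval (X i : MvPolynomial (Fin 2) k) g) = 0 := by
    rw [Polynomial.aeval_eq_sum_range, ← Nat.le_zero]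
    refine (degreeOf_sum_le _ _ _).trans (Finset.sup_le fun n _ => ?_)
    rw [smul_eq_C_mul]
    refine (degreeOf_C_mul_le _ _ _).trans ((degreeOf_pow_le _ _ _).trans ?_)
    simp [degreeOf_X, hil]
  obtain ⟨h, hh⟩ := hfg
  have hne : f * h ≠ 0 := hh ▸ hG
  refine ⟨left_ne_zero_of_mul hne, ?_⟩
  have := degreeOf_mul_eq (n := l) (left_ne_zero_of_mul hne) (right_ne_zero_of_mul hne)
  rw [← hh, hdeg] at this
  omega

lemma gonality_fractionRing_eq_three {k : Type} [Field k] [CharZero k]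
    {F : MvPolynomial (Fin 3) k} (hF : F.IsHomogeneous 4) (hJ : HasPrimaryJacobian F)
    [IsDomain (PlaneCurveRing k F)] {p : Fin 3 → k} {l : Fin 3} (hl : p l = 1)
    (hp : eval p F = 0) : gonality k (FractionRing (PlaneCurveRing k F)) = 3 := by
  set f : MvPolynomial (Fin 2) k := aeval ![X 0, X 1, 1] F with hf
  set R := PlaneCurveRing k F
  set K := FractionRing R
  let π : MvPolynomial (Fin 2) k →ₐ[k] K :=
    (IsScalarTower.toAlgHom k R K).comp (Ideal.Quotient.mkₐ k _)
  have hπ : ∀ g, π g = 0 ↔ f ∣ g := by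
    intro g
    change algebraMap R K (Ideal.Quotient.mk _ g) = 0 ↔ _
    rw [FaithfulSMul.algebraMap_eq_zero_iff, Ideal.Quotient.eq_zero_iff_mem,
      Ideal.mem_span_singleton]
  set P : Fin 3 → K := fun i => π (![X 0, X 1, 1] i)
  have hj : P 2 = 1 := map_one π
  have h0 : aeval P F = 0 := by
    rw [← comp_aeval_apply]
    exact (hπ _).mpr dvd_rfl
  have hgen : IntermediateField.adjoin k (Set.range P) = ⊤ := by
    rw [eq_top_iff]
    intro z _
    have hmem : ∀ g, π g ∈ IntermediateField.adjoin k (Set.range P) := by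
      intro g
      rw [aeval_unique π]
      refine aeval_mem_subalgebra (IntermediateField.adjoin k (Set.range P)).toSubalgebra
        (fun i => ?_) g
      refine IntermediateField.subset_adjoin _ _ ⟨i.castSucc, ?_⟩
      fin_cases i <;> rfl
    obtain ⟨a, b, _, rfl⟩ := IsFractionRing.div_surjective R z
    obtain ⟨a, rfl⟩ := Ideal.Quotient.mk_surjective a
    obtain ⟨b, rfl⟩ := Ideal.Quotient.mk_surjective b
    exact div_mem (hmem a) (hmem b)
  obtain ⟨i, hi⟩ : ∃ i, Transcendental k (P i) := by
    by_contra! h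
    simp only [Transcendental, not_not] at h
    have key : ∀ i l : Fin 2, l ≠ i → f ≠ 0 ∧ degreeOf l f = 0 := by
      intro i l hil
      obtain ⟨g, hg, hgz⟩ := h i.castSucc
      refine degreeOf_eq_zero_of_dvd_aeval_X hil hg ((hπ _).mp ?_)
      rw [← Polynomial.aeval_algHom_apply, ← hgz]
      congr 1
      fin_cases i <;> rfl
    have hc : f = C (coeff 0 f) := by
      rw [← totalDegree_eq_zero_iff_eq_C, totalDegree_eq_zero_iff]
      intro m hm s
      have : degreeOf s f = 0 := by
        fin_cases s
        · exact (key 1 0 (by decide)).2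
        · exact (key 0 1 (by decide)).2
      exact Nat.le_zero.mp (this ▸ monomial_le_degreeOf s hm)
    have h1 : π 1 = 0 := by
      refine (hπ 1).mpr (IsUnit.dvd ?_)
      rw [hc]
      refine IsUnit.map C (IsUnit.mk0 _ fun h2 => (key 1 0 (by decide)).1 ?_)
      rw [hc, h2, C_0]
    exact one_ne_zero ((map_one π).symm.trans h1)
  exact gonality_eq_three hF hJ hgen hj h0 hi hl hp

/-- A lower bound of Liouville type for the absolute value induced by `φ` on `k`. -/
def LiouvilleBound {k Ω : Type} [Field k] [NormedField Ω] (φ : k →+* Ω) : Prop :=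
  ∃ n : ℕ, ∀ (D : ℕ) (y : k), 1 ≤ D → y ≠ 0 → IsIntegral ℤ ((D : k) * y) →
    (∀ σ : k →+* ℂ, ‖σ y‖ ≤ D) → ((D : ℝ) ^ n)⁻¹ ≤ ‖φ y‖

lemma exists_int_norm {k : Type} [Field k] [NumberField k] {y : k} (hy : y ≠ 0)
    (hi : IsIntegral ℤ y) : ∃ N : ℤ, N ≠ 0 ∧ (N : ℚ) = Algebra.norm ℚ y := by
  have h := Algebra.isIntegral_norm ℚ hi
  obtain ⟨N, hN⟩ := IsIntegrallyClosed.isIntegral_iff.mp h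
  refine ⟨N, ?_, by simpa using hN⟩
  rintro rfl
  have : Algebra.norm ℚ y = 0 := by rw [← hN]; simp
  exact hy (Algebra.norm_eq_zero_iff.mp this)

lemma prod_embeddings_erase_le {k : Type} [Field k] [NumberField k] {y : k} {B : ℝ} (hB : 1 ≤ B)
    (h : ∀ σ : k →+* ℂ, ‖σ y‖ ≤ B) (s : Finset (k →ₐ[ℚ] ℂ)) :
    ∏ σ ∈ s, ‖σ y‖ ≤ B ^ Module.finrank ℚ k := by
  calc ∏ σ ∈ s, ‖σ y‖ ≤ ∏ σ ∈ s, B :=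
        Finset.prod_le_prod (fun _ _ => norm_nonneg _) fun σ _ => h σ.toRingHom
    _ = B ^ s.card := by simp
    _ ≤ B ^ Module.finrank ℚ k := by
        refine pow_le_pow_right₀ hB ?_
        rw [← AlgHom.card ℚ k ℂ]
        exact Finset.card_le_univ s

lemma liouvilleBound_complex {k : Type} [Field k] [NumberField k] (φ : k →+* ℂ) :
    LiouvilleBound φ := by
  classical
  refine ⟨1 + 2 * Module.finrank ℚ k, fun D y hD hy hi hσ => ?_⟩
  have hD' : (1 : ℝ) ≤ D := by exact_mod_cast hD
  have hDk : (D : k) ≠ 0 := by exact_mod_cast (by omega : D ≠ 0)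
  obtain ⟨N, hN0, hN⟩ := exists_int_norm (mul_ne_zero hDk hy) hi
  have h1 : (N : ℂ) = ∏ σ : k →ₐ[ℚ] ℂ, σ ((D : k) * y) := by
    rw [← Algebra.norm_eq_prod_embeddings ℚ ℂ, ← hN]; simp
  have h2 : (1 : ℝ) ≤ ∏ σ : k →ₐ[ℚ] ℂ, ‖σ ((D : k) * y)‖ := by
    rw [← norm_prod, ← h1, Complex.norm_intCast]
    exact_mod_cast Int.one_le_abs hN0
  have h3 : ∀ σ : k →+* ℂ, ‖σ ((D : k) * y)‖ ≤ (D : ℝ) ^ 2 := fun σ => by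
    rw [map_mul, map_natCast, norm_mul, Complex.norm_natCast, sq]
    gcongr
    exact hσ σ
  rw [← Finset.mul_prod_erase _ _ (Finset.mem_univ φ.toRatAlgHom)] at h2
  have h4 := prod_embeddings_erase_le (one_le_pow₀ hD' : (1 : ℝ) ≤ (D : ℝ) ^ 2) h3
    (Finset.univ.erase φ.toRatAlgHom)
  have h5 : ‖φ.toRatAlgHom ((D : k) * y)‖ = D * ‖φ y‖ := by simp
  rw [h5] at h2
  rw [inv_le_iff_one_le_mul₀ (by positivity)]
  calc (1 : ℝ) ≤ _ := h2
    _ ≤ D * ‖φ y‖ * ((D : ℝ) ^ 2) ^ Module.finrank ℚ k := by gcongr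
    _ = _ := by ring

lemma mem_integer_of_norm_le_one {p : ℕ} [Fact p.Prime] {x : PadicAlgCl p} :
    x ∈ (Valued.v (R := PadicAlgCl p)).integer ↔ ‖x‖ ≤ 1 := Iff.rfl

lemma padicAlgCl_norm_le_one {p : ℕ} [Fact p.Prime] {x : PadicAlgCl p} (hx : IsIntegral ℤ x) :
    ‖x‖ ≤ 1 :=
  mem_integer_of_norm_le_one.mp
    ((Valuation.integer.integers (Valued.v (R := PadicAlgCl p))).mem_of_integral hx.tower_top)

lemma padicAlgCl_norm_ratCast {p : ℕ} [Fact p.Prime] (q : ℚ) :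
    ‖(q : PadicAlgCl p)‖ = ‖(q : ℚ_[p])‖ := by
  rw [← PadicAlgCl.norm_extends p (q : ℚ_[p])]
  simp

lemma padicAlgCl_le_norm_intCast {p : ℕ} [hp : Fact p.Prime] {N : ℤ} (hN : N ≠ 0) :
    |(N : ℝ)|⁻¹ ≤ ‖(N : PadicAlgCl p)‖ := by
  have h := padicAlgCl_norm_ratCast (p := p) (N : ℚ)
  rw [Rat.cast_intCast, Rat.cast_intCast] at h
  have hN' : (N : ℚ) ≠ 0 := by exact_mod_cast hN
  have h2 : ‖((N : ℚ) : ℚ_[p])‖ = padicNorm p (N : ℚ) := Padic.eq_padicNorm _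
  rw [Rat.cast_intCast] at h2
  rw [h, h2, padicNorm.eq_zpow_of_nonzero hN', padicValRat.of_int, zpow_neg, zpow_natCast]
  push_cast
  have hd : (p : ℤ) ^ padicValInt p N ∣ N := padicValInt_dvd N
  have hle : ((p : ℤ) ^ padicValInt p N) ≤ |N| :=
    Int.le_of_dvd (abs_pos.mpr hN) ((dvd_abs _ _).mpr hd)
  have hle' : ((p : ℝ) ^ padicValInt p N) ≤ |(N : ℝ)| := by exact_mod_cast hle
  have := hp.1.pos
  gcongr

lemma liouvilleBound_padic {k : Type} [Field k] [NumberField k] {p : ℕ} [Fact p.Prime]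
    (φ : k →+* PadicAlgCl p) : LiouvilleBound φ := by
  classical
  refine ⟨2 * Module.finrank ℚ k, fun D y hD hy hi hσ => ?_⟩
  have hD' : (1 : ℝ) ≤ D := by exact_mod_cast hD
  have hDk : (D : k) ≠ 0 := by exact_mod_cast (by omega : D ≠ 0)
  obtain ⟨N, hN0, hN⟩ := exists_int_norm (mul_ne_zero hDk hy) hi
  have h1 : (N : ℂ) = ∏ σ : k →ₐ[ℚ] ℂ, σ ((D : k) * y) := by
    rw [← Algebra.norm_eq_prod_embeddings ℚ ℂ, ← hN]; simp
  have h3 : ∀ σ : k →+* ℂ, ‖σ ((D : k) * y)‖ ≤ (D : ℝ) ^ 2 := fun σ => by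
    rw [map_mul, map_natCast, norm_mul, Complex.norm_natCast, sq]
    gcongr
    exact hσ σ
  have h4 : |(N : ℝ)| ≤ ((D : ℝ) ^ 2) ^ Module.finrank ℚ k := by
    rw [← Complex.norm_intCast, h1, norm_prod]
    exact prod_embeddings_erase_le (one_le_pow₀ hD') h3 _
  have h5 : (N : PadicAlgCl p) = ∏ σ : k →ₐ[ℚ] PadicAlgCl p, σ ((D : k) * y) := by
    rw [← Algebra.norm_eq_prod_embeddings ℚ (PadicAlgCl p), ← hN]; simp
  have h6 := padicAlgCl_le_norm_intCast (p := p) hN0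
  rw [h5, norm_prod, ← Finset.mul_prod_erase _ _ (Finset.mem_univ φ.toRatAlgHom)] at h6
  have h7 : ∏ σ ∈ Finset.univ.erase φ.toRatAlgHom, ‖σ ((D : k) * y)‖ ≤ 1 :=
    Finset.prod_le_one (fun _ _ => norm_nonneg _) fun σ _ =>
      padicAlgCl_norm_le_one (hi.map σ.toRingHom.toIntAlgHom)
  have h8 : ‖φ.toRatAlgHom ((D : k) * y)‖ ≤ ‖φ y‖ := by
    have h9 : ‖(D : PadicAlgCl p)‖ ≤ 1 := padicAlgCl_norm_le_one (isIntegral_natCast D)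
    have : φ.toRatAlgHom ((D : k) * y) = D * φ y := by simp
    rw [this, norm_mul]
    exact mul_le_of_le_one_left (norm_nonneg _) h9
  have hNpos : 0 < |(N : ℝ)| := abs_pos.mpr (by exact_mod_cast hN0)
  calc ((D : ℝ) ^ (2 * Module.finrank ℚ k))⁻¹ ≤ |(N : ℝ)|⁻¹ := by
        rw [pow_mul]; gcongr
    _ ≤ _ := h6
    _ ≤ ‖φ.toRatAlgHom ((D : k) * y)‖ := mul_le_of_le_one_right (norm_nonneg _) h7
    _ ≤ ‖φ y‖ := h8

lemma isIntegral_of_padic_norm_le_one {k : Type} [Field k] [NumberField k] {y : k}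
    (h : ∀ (p : ℕ) [Fact p.Prime] (φ : k →+* PadicAlgCl p), ‖φ y‖ ≤ 1) : IsIntegral ℤ y := by
  have hy : IsIntegral ℚ y := Algebra.IsIntegral.isIntegral y
  have hcoeff : ∀ i, ∃ z : ℤ, (z : ℚ) = (minpoly ℚ y).coeff i := by
    intro i
    set q := (minpoly ℚ y).coeff i with hq
    refine ⟨q.num, Rat.coe_int_num_of_den_eq_one ?_⟩
    by_contra hden
    obtain ⟨p, hp, hpd⟩ := Nat.exists_prime_and_dvd hden
    have : Fact p.Prime := ⟨hp⟩
    have hsplit := IsAlgClosed.splits ((minpoly ℚ y).map (algebraMap ℚ (PadicAlgCl p)))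
    have hprod := hsplit.eq_prod_roots_of_monic ((minpoly.monic hy).map _)
    set O := (Valued.v (R := PadicAlgCl p)).integer
    have hmem : (minpoly ℚ y).map (algebraMap ℚ (PadicAlgCl p)) ∈ Polynomial.lifts O.subtype := by
      rw [hprod]
      refine Subsemiring.multiset_prod_mem _ _ fun P hP => ?_
      obtain ⟨a, ha, rfl⟩ := Multiset.mem_map.mp hP
      have ha' : Polynomial.aeval a (minpoly ℚ y) = 0 := by
        rw [Polynomial.aeval_def, ← Polynomial.eval_map]
        exact (Polynomial.mem_roots'.mp ha).2
      obtain ⟨ψ, hψ⟩ := (Algebra.IsAlgebraic.range_eval_eq_rootSet_minpoly (F := ℚ)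
        (PadicAlgCl p) y).ge (by
          rw [Polynomial.mem_rootSet]; exact ⟨minpoly.ne_zero hy, ha'⟩ :
          a ∈ (minpoly ℚ y).rootSet (PadicAlgCl p))
      have hψ' : ‖a‖ ≤ 1 := by rw [← hψ]; exact h p ψ.toRingHom
      exact (Polynomial.mem_lifts _).mpr ⟨Polynomial.X - Polynomial.C ⟨a, hψ'⟩, by simp⟩
    obtain ⟨P, hP⟩ := (Polynomial.mem_lifts _).mp hmem
    have hPi := congrArg (fun r => Polynomial.coeff r i) hP
    simp only [Polynomial.coeff_map] at hPi
    have : ‖(q : PadicAlgCl p)‖ ≤ 1 := by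
      have h1 := mem_integer_of_norm_le_one.mp (P.coeff i).2
      have h2 : ((P.coeff i : O) : PadicAlgCl p) = (q : PadicAlgCl p) := by
        rw [hq]; simpa using hPi
      rwa [h2] at h1
    rw [padicAlgCl_norm_ratCast, Padic.norm_rat_le_one_iff_padicValuation_le_one,
      Rat.padicValuation_le_one_iff] at this
    exact this hpd
  choose z hz using hcoeff
  have hlift : minpoly ℚ y ∈ Polynomial.lifts (Int.castRingHom ℚ) :=
    (Polynomial.lifts_iff_coeff_lifts _).mpr fun i => ⟨z i, by simpa using hz i⟩
  obtain ⟨P, hP, -, hm⟩ := Polynomial.lifts_and_natDegree_eq_and_monic hlift (minpoly.monic hy)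
  refine ⟨P, hm, ?_⟩
  have := minpoly.aeval ℚ y
  rw [← hP, Polynomial.aeval_def, Polynomial.eval₂_map] at this
  rwa [show (algebraMap ℚ k).comp (Int.castRingHom ℚ) = algebraMap ℤ k from
    RingHom.ext_int _ _] at this

/-- An element of a number field which is neither zero nor a root of unity is small at some place,
in the sense of an embedding into an algebraically closed normed field with a Liouville bound. -/
lemma exists_embedding_norm_lt_one {k : Type} [Field k] [NumberField k] {t : k} (ht : t ≠ 0)
    (hroot : ∀ n : ℕ, 0 < n → t ^ n ≠ 1) :
    ∃ (Ω : Type) (_ : NormedField Ω) (_ : CharZero Ω) (_ : IsAlgClosed Ω) (φ : k →+* Ω),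
      ‖φ t‖ < 1 ∧ LiouvilleBound φ := by
  by_cases hy_int : IsIntegral ℤ t⁻¹
  · have : ∃ σ : k →+* ℂ, 1 < ‖σ t⁻¹‖ := by
      by_contra! hcon
      obtain ⟨n, hn, h1⟩ := NumberField.Embeddings.pow_eq_one_of_norm_le_one k ℂ (inv_ne_zero ht)
        hy_int hcon
      exact hroot n hn (by simpa using h1)
    obtain ⟨σ, hσ⟩ := this
    refine ⟨ℂ, inferInstance, inferInstance, inferInstance, σ, ?_, liouvilleBound_complex σ⟩
    rw [map_inv₀, norm_inv] at hσ
    exact (one_lt_inv_iff₀.mp hσ).2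
  · have : ∃ (p : ℕ) (_ : Fact p.Prime) (φ : k →+* PadicAlgCl p), 1 < ‖φ t⁻¹‖ := by
      by_contra! hcon
      exact hy_int (isIntegral_of_padic_norm_le_one hcon)
    obtain ⟨p, hp, φ, hφ⟩ := this
    refine ⟨PadicAlgCl p, inferInstance, inferInstance, inferInstance, φ, ?_,
      liouvilleBound_padic φ⟩
    rw [map_inv₀, norm_inv] at hφ
    exact (one_lt_inv_iff₀.mp hφ).2

namespace Polynomial

lemma exists_bezout_degree_lt {κ : Type} [Field κ] {g h r : κ[X]} (hg : g.Monic)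
    (hh : h.Monic) (hc : IsCoprime g h) (hr : r.degree < (g * h).degree) :
    ∃ a b : κ[X], a.degree < g.degree ∧ b.degree < h.degree ∧ a * h + b * g = r := by
  obtain ⟨u, v, huv⟩ := hc
  have ha : (r * v %ₘ g).degree < g.degree := degree_modByMonic_lt _ hg
  have hdiv := modByMonic_add_div (r * v) g
  have heq : (r * v %ₘ g) * h + (r * u + (r * v /ₘ g) * h) * g = r := by
    linear_combination r * huv + h * hdiv
  refine ⟨r * v %ₘ g, r * u + (r * v /ₘ g) * h, ha, ?_, heq⟩
  by_contra! hlt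
  have h1 : (r * v %ₘ g * h).degree < (h * g).degree := by
    rw [degree_mul, degree_mul, add_comm]
    exact WithBot.add_lt_add_left (by simpa using hh.ne_zero) ha
  have h2 : (h * g).degree ≤ ((r * u + (r * v /ₘ g) * h) * g).degree := by
    rw [degree_mul, degree_mul]
    exact add_le_add_left hlt _
  have h3 := degree_add_eq_right_of_degree_lt (h1.trans_le h2)
  rw [heq] at h3
  rw [h3, mul_comm g h] at hr
  exact absurd h2 (not_le.mpr hr)

lemma C_X_dvd_of_map_eq_zero {κ : Type} [Field κ] {f : κ[X][X]}
    (hf : f.map (evalRingHom 0) = 0) : C X ∣ f := by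
  rw [C_dvd_iff_dvd_coeff]
  intro i
  rw [X_dvd_iff, coeff_zero_eq_eval_zero]
  simpa using congrArg (fun p => p.coeff i) hf

lemma map_C_map_eval_zero {κ : Type} [CommRing κ] (p : κ[X]) :
    (p.map C).map (evalRingHom 0) = p := by
  rw [map_map, show (evalRingHom 0).comp C = RingHom.id κ from RingHom.ext fun x => eval_C, map_id]

/-- Hensel's lemma for factorizations, modulo a power of the variable. -/
lemma exists_hensel_factorization {κ : Type} [Field κ] {f : κ[X][X]} (hf : f.Monic)
    {g₀ h₀ : κ[X]} (hg₀ : g₀.Monic) (hh₀ : h₀.Monic) (hc : IsCoprime g₀ h₀)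
    (hfac : f.map (evalRingHom 0) = g₀ * h₀) (N : ℕ) :
    ∃ g h : κ[X][X], g.Monic ∧ h.Monic ∧ g.map (evalRingHom 0) = g₀ ∧
      h.map (evalRingHom 0) = h₀ ∧ C (X ^ (N + 1)) ∣ f - g * h := by
  induction N with
  | zero =>
    refine ⟨g₀.map C, h₀.map C, hg₀.map _, hh₀.map _, map_C_map_eval_zero _, map_C_map_eval_zero _, ?_⟩
    rw [zero_add, pow_one]
    refine C_X_dvd_of_map_eq_zero ?_
    rw [Polynomial.map_sub, Polynomial.map_mul, map_C_map_eval_zero, map_C_map_eval_zero, hfac, sub_self]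
  | succ N ih =>
    obtain ⟨g, h, hg, hh, hgm, hhm, e, he⟩ := ih
    have hdegm : ∀ {p : κ[X][X]}, p.Monic → (p.map (evalRingHom 0)).degree = p.degree := fun hp =>
      hp.degree_map _
    have hdeg : f.degree = (g * h).degree := by
      rw [← hdegm hf, ← hdegm (hg.mul hh), hfac, Polynomial.map_mul, hgm, hhm]
    have hedeg : e.degree < (g * h).degree := by
      have h1 := degree_sub_lt_left hdeg hf.ne_zero
        (by rw [hf.leadingCoeff, (hg.mul hh).leadingCoeff])
      rwa [he, degree_mul, degree_C (pow_ne_zero _ X_ne_zero), zero_add, hdeg] at h1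
    obtain ⟨a, b, ha, hb, hab⟩ := exists_bezout_degree_lt (r := e.map (evalRingHom 0)) hg₀ hh₀ hc (by
      refine degree_map_le.trans_lt (hedeg.trans_eq ?_)
      rw [← hdegm (hg.mul hh), Polynomial.map_mul, hgm, hhm])
    have hlift : ∀ {p : κ[X][X]} {q a : κ[X]}, p.Monic → p.map (evalRingHom 0) = q →
        a.degree < q.degree → (p + C (X ^ (N + 1)) * a.map C).Monic ∧
        (p + C (X ^ (N + 1)) * a.map C).map (evalRingHom 0) = q := by
      intro p q a hp hpq ha
      constructor
      · refine hp.add_of_left ?_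
        rw [degree_mul, degree_C (pow_ne_zero _ X_ne_zero), zero_add, ← hdegm hp, hpq]
        exact degree_map_le.trans_lt ha
      · rw [Polynomial.map_add, Polynomial.map_mul, map_C, hpq]
        simp
    refine ⟨_, _, (hlift hg hgm ha).1, (hlift hh hhm hb).1, (hlift hg hgm ha).2,
      (hlift hh hhm hb).2, ?_⟩
    have h1 : C X ∣ e - a.map C * h - b.map C * g - C (X ^ (N + 1)) * a.map C * b.map C := by
      refine C_X_dvd_of_map_eq_zero ?_
      simp only [Polynomial.map_sub, Polynomial.map_mul, map_C, map_C_map_eval_zero, hgm, hhm]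
      rw [← hab]
      simp
    obtain ⟨d, hd⟩ := h1
    refine ⟨d, ?_⟩
    rw [pow_succ X (N + 1), C_mul, mul_assoc, ← hd]
    linear_combination he

lemma taylor_coeff_sub_one {R : Type} [CommRing R] (r : R) (p : R[X])
    (hp : p.natDegree ≠ 0) : (taylor r p).coeff (p.natDegree - 1) =
      p.coeff (p.natDegree - 1) + p.natDegree * p.leadingCoeff * r := by
  rw [taylor_coeff, eval_eq_sum_range' (n := 2), Finset.sum_range_succ, Finset.sum_range_one,
    hasseDeriv_coeff, hasseDeriv_coeff, zero_add, Nat.choose_self,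
    show 1 + (p.natDegree - 1) = p.natDegree - 1 + 1 by omega, Nat.choose_succ_self_right,
    show p.natDegree - 1 + 1 = p.natDegree by omega]
  · simp
  · have := natDegree_hasseDeriv_le p (p.natDegree - 1)
    omega

/-- Modulo the `M`-th power of the variable, and after extracting a root of the variable,
the polynomial `P` splits into linear factors. -/
def HasPuiseux {κ : Type} [Field κ] (P : κ[X][X]) (M : ℕ) : Prop :=
  ∃ E : ℕ, 0 < E ∧ ∃ S : Multiset κ[X], S.card = P.natDegree ∧
    C (X ^ (E * M)) ∣ P.map (expand κ E : κ[X] →+* κ[X]) - (S.map fun s => X - C s).prod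

namespace HasPuiseux

variable {κ : Type} [Field κ] {P Q : κ[X][X]} {M : ℕ}

lemma expand_comp_expand (a b : ℕ) : (expand κ a : κ[X] →+* κ[X]).comp (expand κ b : κ[X] →+* κ[X]) =
    (expand κ (a * b) : κ[X] →+* κ[X]) :=
  RingHom.ext fun p => expand_expand a b p

lemma natDegree_map_expand {E : ℕ} (hE : 0 < E) (P : κ[X][X]) :
    (P.map (expand κ E : κ[X] →+* κ[X])).natDegree = P.natDegree :=
  natDegree_map_eq_of_injective (f := (expand κ E : κ[X] →+* κ[X])) (expand_injective hE) P

lemma map_expand_multiset_prod (E : ℕ) (S : Multiset κ[X]) :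
    ((S.map fun s => X - C s).prod).map (expand κ E : κ[X] →+* κ[X]) =
      ((S.map (expand κ E)).map fun s => X - C s).prod := by
  rw [Polynomial.map_multiset_prod, Multiset.map_map, Multiset.map_map]
  congr 2
  funext s
  simp

lemma dvd_map_expand {A B : κ[X][X]} {m : ℕ} (h : C (X ^ m) ∣ A - B) (E : ℕ) :
    C (X ^ (E * m)) ∣ A.map (expand κ E : κ[X] →+* κ[X]) - B.map (expand κ E : κ[X] →+* κ[X]) := by
  have := _root_.map_dvd (mapRingHom (expand κ E : κ[X] →+* κ[X])) h
  rw [map_sub, coe_mapRingHom, map_C] at this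
  simpa [← pow_mul] using this

lemma mul (hP : P.Monic) (hQ : Q.Monic) (h₁ : HasPuiseux P M) (h₂ : HasPuiseux Q M) :
    HasPuiseux (P * Q) M := by
  obtain ⟨E₁, hE₁, S₁, hc₁, hd₁⟩ := h₁
  obtain ⟨E₂, hE₂, S₂, hc₂, hd₂⟩ := h₂
  refine ⟨E₂ * E₁, mul_pos hE₂ hE₁, S₁.map (expand κ E₂) + S₂.map (expand κ E₁), ?_, ?_⟩
  · rw [Multiset.card_add, Multiset.card_map, Multiset.card_map, hc₁, hc₂, hP.natDegree_mul hQ]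
  · have h₁ := dvd_map_expand hd₁ E₂
    have h₂ := dvd_map_expand hd₂ E₁
    rw [map_map, expand_comp_expand, map_expand_multiset_prod, ← mul_assoc] at h₁ h₂
    rw [mul_comm E₁] at h₂
    rw [Multiset.map_add, Multiset.prod_add, Polynomial.map_mul]
    convert (h₁.mul_right (Q.map (expand κ (E₂ * E₁) : κ[X] →+* κ[X]))).add
      (h₂.mul_left ((S₁.map (expand κ E₂)).map fun s => X - C s).prod) using 1
    ring

lemma congr (hd : C (X ^ M) ∣ P - Q) (hn : P.natDegree = Q.natDegree) (h : HasPuiseux Q M) :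
    HasPuiseux P M := by
  obtain ⟨E, hE, S, hc, hS⟩ := h
  refine ⟨E, hE, S, hc.trans hn.symm, ?_⟩
  simpa using (dvd_map_expand hd E).add hS

lemma of_taylor {r : κ[X]} (h : HasPuiseux (taylor r P) M) : HasPuiseux P M := by
  obtain ⟨E, hE, S, hc, hS⟩ := h
  refine ⟨E, hE, S.map fun s => s + expand κ E r, ?_, ?_⟩
  · rw [Multiset.card_map, hc, natDegree_taylor]
  · have h1 := _root_.map_dvd (taylorAlgHom (-expand κ E r)) hS
    have h2 : taylorAlgHom (-expand κ E r) ((taylor r P).map (expand κ E : κ[X] →+* κ[X])) =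
        P.map (expand κ E : κ[X] →+* κ[X]) := by
      rw [map_taylor]
      simp [taylor_taylor]
    rw [map_sub, h2, map_multiset_prod, Multiset.map_map] at h1
    rw [Multiset.map_map]
    convert h1 using 3
    · simp
    · congr 1
      funext s
      simp
      ring

lemma of_scaleRoots {E r : ℕ} (hE : 0 < E) (hPQ : P.map (expand κ E : κ[X] →+* κ[X]) =
    Q.scaleRoots (X ^ r)) (h : HasPuiseux Q (E * M)) : HasPuiseux P M := by
  obtain ⟨E', hE', S, hc, hS⟩ := h
  have hn : Q.natDegree = P.natDegree := by
    rw [← natDegree_scaleRoots Q (X ^ r), ← hPQ]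
    exact natDegree_map_expand hE P
  refine ⟨E' * E, mul_pos hE' hE, S.map fun s => X ^ (E' * r) * s, ?_, ?_⟩
  · rw [Multiset.card_map, hc, hn]
  · have h1 : P.map (expand κ (E' * E) : κ[X] →+* κ[X]) =
        (Q.map (expand κ E' : κ[X] →+* κ[X])).scaleRoots (X ^ (E' * r)) := by
      rw [← expand_comp_expand, ← map_map, hPQ]
      ext1 i
      rw [coeff_map, coeff_scaleRoots, coeff_scaleRoots, coeff_map,
        natDegree_map_expand hE']
      simp [← pow_mul, mul_assoc]
    have h2 : ((S.map fun s => X ^ (E' * r) * s).map fun s => X - C s).prod =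
        ((S.map fun s => X - C s).prod).scaleRoots (X ^ (E' * r)) := by
      clear hS hc
      induction S using Multiset.induction_on with
      | empty => simp
      | cons s S ih =>
        rw [Multiset.map_cons, Multiset.map_cons, Multiset.prod_cons, ih, Multiset.map_cons,
          Multiset.prod_cons, mul_scaleRoots_of_noZeroDivisors, X_sub_C_scaleRoots, mul_comm s]
    rw [h1, h2, C_dvd_iff_dvd_coeff]
    intro i
    rw [coeff_sub, coeff_scaleRoots, coeff_scaleRoots, natDegree_multiset_prod_X_sub_C_eq_card,
      natDegree_map_expand hE', hc, ← sub_mul, ← coeff_sub, mul_assoc]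
    exact ((C_dvd_iff_dvd_coeff _ _).mp hS i).mul_right _

end HasPuiseux

lemma exists_monic_coeff_eq {R : Type} [CommRing R] [Nontrivial R] (n : ℕ) (b : ℕ → R) :
    ∃ Q : R[X], Q.Monic ∧ Q.natDegree = n ∧ ∀ i < n, Q.coeff i = b i := by
  have hd : (∑ i ∈ Finset.range n, C (b i) * X ^ i).degree < (n : WithBot ℕ) := by
    refine (degree_sum_le _ _).trans_lt ((Finset.sup_lt_iff (WithBot.bot_lt_coe n)).mpr ?_)
    intro i hi
    exact (degree_C_mul_X_pow_le _ _).trans_lt (WithBot.coe_lt_coe.mpr (Finset.mem_range.mp hi))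
  refine ⟨X ^ n + ∑ i ∈ Finset.range n, C (b i) * X ^ i, monic_X_pow_add hd, ?_, ?_⟩
  · rw [natDegree_eq_of_degree_eq (degree_add_eq_left_of_degree_lt (hd.trans_eq
      (degree_X_pow n).symm)), natDegree_X_pow]
  · intro i hi
    simp [coeff_X_pow, hi.ne, hi]

/-- Extracting the slope of the Newton polygon. -/
lemma exists_map_expand_eq_scaleRoots {κ : Type} [Field κ] {P : κ[X][X]} (hP : P.Monic)
    (h : ∃ i < P.natDegree, P.coeff i ≠ 0) : ∃ E r : ℕ, 0 < E ∧ ∃ Q : κ[X][X], Q.Monic ∧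
      Q.natDegree = P.natDegree ∧
      P.map (expand κ E : κ[X] →+* κ[X]) = Q.scaleRoots (X ^ r) ∧
      ∃ i < P.natDegree, (Q.coeff i).coeff 0 ≠ 0 := by
  set n := P.natDegree
  set E := n.factorial
  have hE : 0 < E := n.factorial_pos
  have hdvd : ∀ i < n, (n - i) * (E / (n - i)) = E := fun i hi =>
    Nat.mul_div_cancel' (Nat.dvd_factorial (by omega) (by omega))
  classical
  obtain ⟨i₀, hi₀, hmin⟩ := ((Finset.range n).filter fun i => P.coeff i ≠ 0).exists_min_image
    (fun i => E / (n - i) * (P.coeff i).natTrailingDegree) (by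
      obtain ⟨i, hi, hne⟩ := h
      exact ⟨i, by simp [hi, hne]⟩)
  rw [Finset.mem_filter, Finset.mem_range] at hi₀
  set r := E / (n - i₀) * (P.coeff i₀).natTrailingDegree
  have hb : ∀ i, ∃ b : κ[X], i < n → expand κ E (P.coeff i) = b * X ^ (r * (n - i)) := by
    intro i
    by_cases hi : i < n
    · by_cases hne : P.coeff i = 0
      · exact ⟨0, fun _ => by simp [hne]⟩
      · have h1 := hmin i (by simp [hi, hne])
        have h2 : X ^ (P.coeff i).natTrailingDegree ∣ P.coeff i :=
          X_pow_dvd_iff.mpr fun d hd => coeff_eq_zero_of_lt_natTrailingDegree hd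
        have h3 := _root_.map_dvd (expand κ E) h2
        rw [map_pow, expand_X, ← pow_mul] at h3
        have h4 : r * (n - i) ≤ E * (P.coeff i).natTrailingDegree := by
          calc r * (n - i) ≤ E / (n - i) * (P.coeff i).natTrailingDegree * (n - i) :=
                Nat.mul_le_mul_right _ h1
            _ = (n - i) * (E / (n - i)) * (P.coeff i).natTrailingDegree := by ring
            _ = _ := by rw [hdvd i hi]
        obtain ⟨b, hb⟩ := (pow_dvd_pow X h4).trans h3
        exact ⟨b, fun _ => by rw [hb, mul_comm]⟩
    · exact ⟨0, fun h => absurd h hi⟩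
  choose b hb using hb
  obtain ⟨Q, hQ, hQn, hQb⟩ := exists_monic_coeff_eq n b
  refine ⟨E, r, hE, Q, hQ, hQn, ?_, i₀, hi₀.1, ?_⟩
  · ext1 i
    rw [coeff_map, coeff_scaleRoots, hQn, ← pow_mul]
    rcases lt_trichotomy i n with hi | hi | hi
    · rw [hQb i hi, ← hb i hi]
      rfl
    · have h1 : P.coeff i = 1 := by rw [hi]; exact hP.coeff_natDegree
      have h2 : Q.coeff i = 1 := by rw [hi, ← hQn]; exact hQ.coeff_natDegree
      rw [h1, h2, hi]
      simp
    · rw [coeff_eq_zero_of_natDegree_lt hi, coeff_eq_zero_of_natDegree_lt (hQn.trans_lt hi)]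
      simp
  · have h1 : r * (n - i₀) = E * (P.coeff i₀).natTrailingDegree := by
      rw [← hdvd i₀ hi₀.1]
      ring
    have h2 := congrArg (fun p => p.coeff (r * (n - i₀))) (hb i₀ hi₀.1)
    rw [hQb i₀ hi₀.1]
    intro h3
    simp only [coeff_mul_X_pow', le_refl, if_true, Nat.sub_self, h3] at h2
    rw [h1, mul_comm E, coeff_expand_mul hE] at h2
    exact hi₀.2 (by simpa using h2)

/-- A depressed monic polynomial which is not a power of the variable has a nontrivial
factorization into coprime monic factors. -/
lemma exists_coprime_factorization {κ : Type} [Field κ] [CharZero κ] [IsAlgClosed κ]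
    {Q : κ[X]} (hQ : Q.Monic) (h0 : Q.coeff (Q.natDegree - 1) = 0)
    (h : ∃ i < Q.natDegree, Q.coeff i ≠ 0) : ∃ g h : κ[X], g.Monic ∧ h.Monic ∧ IsCoprime g h ∧
      Q = g * h ∧ g.natDegree < Q.natDegree ∧ h.natDegree < Q.natDegree := by
  obtain ⟨i, hi, hne⟩ := h
  obtain ⟨c, hc⟩ := IsAlgClosed.exists_root Q (by
    rw [degree_eq_natDegree hQ.ne_zero]
    exact_mod_cast (by omega : Q.natDegree ≠ 0))
  obtain ⟨h, hh, hnd⟩ := exists_eq_pow_rootMultiplicity_mul_and_not_dvd Q hQ.ne_zero c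
  set m := rootMultiplicity c Q
  have hm : 0 < m := (rootMultiplicity_pos hQ.ne_zero).mpr hc
  have hg : ((X - C c) ^ m).Monic := (monic_X_sub_C c).pow m
  have hhm : h.Monic := hg.of_mul_monic_left (hh ▸ hQ)
  have hdeg : Q.natDegree = m + h.natDegree := by
    conv_lhs => rw [hh, hg.natDegree_mul hhm, (monic_X_sub_C c).natDegree_pow, natDegree_X_sub_C,
      mul_one]
  have hpos : 0 < h.natDegree := by
    by_contra! h1
    have h2 : h = 1 := hhm.natDegree_eq_zero.mp (by omega)
    rw [h2, mul_one] at hh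
    have hQm : Q.natDegree = m := by rw [hdeg, h2, natDegree_one, add_zero]
    have h3 := (monic_X_sub_C c).nextCoeff_pow m
    rw [← hh, nextCoeff_of_natDegree_pos (by omega), h0, nextCoeff_X_sub_C, smul_neg,
      nsmul_eq_mul, eq_comm, neg_eq_zero, mul_eq_zero] at h3
    have hc0 : c = 0 := h3.resolve_left (by exact_mod_cast hm.ne')
    rw [hh, hc0, C_0, sub_zero, coeff_X_pow, if_neg (by omega)] at hne
    exact hne rfl
  refine ⟨(X - C c) ^ m, h, hg, hhm, ?_, hh, ?_, ?_⟩
  · exact ((irreducible_X_sub_C c).coprime_iff_not_dvd.mpr hnd).pow_left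
  · rw [(monic_X_sub_C c).natDegree_pow, natDegree_X_sub_C, mul_one]
    omega
  · omega

/-- The Newton–Puiseux theorem, modulo powers of the variable. -/
theorem Monic.hasPuiseux {κ : Type} [Field κ] [CharZero κ] [IsAlgClosed κ] {P : κ[X][X]}
    (hP : P.Monic) (M : ℕ) : HasPuiseux P M := by
  induction hn : P.natDegree using Nat.strong_induction_on generalizing P M with
  | _ n ih =>
  rcases Nat.eq_zero_or_pos n with hn0 | hn0
  · refine ⟨1, one_pos, 0, by rw [hn, hn0]; rfl, ?_⟩
    rw [hP.natDegree_eq_zero.mp (hn.trans hn0)]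
    simp
  refine HasPuiseux.of_taylor (r := -(C (n : κ)⁻¹ * P.coeff (n - 1))) ?_
  have hcoeff := taylor_coeff_sub_one (-(C (n : κ)⁻¹ * P.coeff (n - 1))) P (by omega)
  rw [hn, hP.leadingCoeff, mul_one] at hcoeff
  have hcast : (n : κ[X]) * C (n : κ)⁻¹ = 1 := by
    rw [← C_eq_natCast, ← C_mul, mul_inv_cancel₀ (by exact_mod_cast hn0.ne'), C_1]
  rw [mul_neg, ← mul_assoc, hcast, one_mul, add_neg_cancel] at hcoeff
  set P₁ := taylor (-(C (n : κ)⁻¹ * P.coeff (n - 1))) P with hP₁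
  have hP₁m : P₁.Monic := by
    rw [Monic, hP₁, leadingCoeff_taylor, hP.leadingCoeff]
  have hP₁n : P₁.natDegree = n := by rw [hP₁, natDegree_taylor, hn]
  by_cases hz : ∃ i < P₁.natDegree, P₁.coeff i ≠ 0
  · obtain ⟨E, r, hE, Q, hQ, hQn, hsc, i, hi, hne⟩ := exists_map_expand_eq_scaleRoots hP₁m hz
    refine HasPuiseux.of_scaleRoots hE hsc ?_
    have hQ₀n : (Q.map (evalRingHom 0)).natDegree = n := by
      rw [hQ.natDegree_map, hQn, hP₁n]
    have hQ₀ : (Q.map (evalRingHom 0)).coeff (n - 1) = 0 := by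
      have h1 := congrArg (fun p => p.coeff (n - 1)) hsc
      simp only [coeff_map, coeff_scaleRoots, hcoeff, map_zero] at h1
      rw [coeff_map, (mul_eq_zero.mp h1.symm).resolve_right (pow_ne_zero _ (pow_ne_zero _ X_ne_zero)),
        map_zero]
    obtain ⟨g₀, h₀, hg₀, hh₀, hco, hfac, hgn, hhn⟩ := exists_coprime_factorization
      (hQ.map (evalRingHom 0)) (by rw [hQ₀n]; exact hQ₀) ⟨i, by rwa [hQ₀n, ← hP₁n], by
        rwa [coeff_map, coe_evalRingHom, ← coeff_zero_eq_eval_zero]⟩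
    obtain ⟨g, h, hg, hh, hgm, hhm, hd⟩ := exists_hensel_factorization hQ hg₀ hh₀ hco hfac (E * M)
    have hdeg : Q.natDegree = (g * h).natDegree := by
      rw [← hQ.natDegree_map (evalRingHom (0 : κ)), hfac, hg.natDegree_mul hh,
        hg₀.natDegree_mul hh₀, ← hgm, ← hhm, hg.natDegree_map, hh.natDegree_map]
    refine HasPuiseux.congr ((_root_.map_dvd C (pow_dvd_pow X (Nat.le_succ _))).trans hd) hdeg ?_
    refine HasPuiseux.mul hg hh (ih _ ?_ hg _ rfl) (ih _ ?_ hh _ rfl)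
    · rwa [← hg.natDegree_map (evalRingHom (0 : κ)), hgm, ← hQ₀n]
    · rwa [← hh.natDegree_map (evalRingHom (0 : κ)), hhm, ← hQ₀n]
  · push Not at hz
    have hX : P₁ = X ^ n := by
      ext1 i
      rw [coeff_X_pow]
      rcases lt_trichotomy i n with hi | hi | hi
      · rw [hz i (by rwa [hP₁n]), if_neg hi.ne]
      · rw [if_pos hi, hi, ← hP₁n]
        exact hP₁m.coeff_natDegree
      · rw [if_neg hi.ne', coeff_eq_zero_of_natDegree_lt (hP₁n.trans_lt hi)]
    refine ⟨1, one_pos, Multiset.replicate n 0, by rw [hP₁n, Multiset.card_replicate], ?_⟩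
    rw [hX]
    simp

end Polynomial

/-- A crude height bound: `D` is a denominator of `y` and bounds all its conjugates. -/
def HeightLE {k : Type} [Field k] (D : ℕ) (y : k) : Prop :=
  1 ≤ D ∧ IsIntegral ℤ ((D : k) * y) ∧ ∀ σ : k →+* ℂ, ‖σ y‖ ≤ D

namespace HeightLE

variable {k : Type} [Field k] {D D₁ D₂ : ℕ} {y z : k}

lemma of_dvd (h : HeightLE D₁ y) (hd : D₁ ∣ D) (hD : 1 ≤ D) : HeightLE D y := by
  refine ⟨hD, ?_, fun σ => (h.2.2 σ).trans (by exact_mod_cast Nat.le_of_dvd hD hd)⟩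
  obtain ⟨c, rfl⟩ := hd
  rw [Nat.cast_mul, mul_comm (D₁ : k), mul_assoc]
  exact (isIntegral_natCast c).mul h.2.1

lemma mul (h₁ : HeightLE D₁ y) (h₂ : HeightLE D₂ z) : HeightLE (D₁ * D₂) (y * z) := by
  refine ⟨Nat.mul_pos h₁.1 h₂.1, ?_, fun σ => ?_⟩
  · rw [Nat.cast_mul, mul_mul_mul_comm]
    exact h₁.2.1.mul h₂.2.1
  · rw [map_mul, norm_mul]
    push_cast
    exact mul_le_mul (h₁.2.2 σ) (h₂.2.2 σ) (norm_nonneg _) (Nat.cast_nonneg _)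

lemma pow (h : HeightLE D y) (n : ℕ) : HeightLE (D ^ n) (y ^ n) := by
  induction n with
  | zero => exact ⟨by simp, by simpa using isIntegral_one, by simp⟩
  | succ n ih =>
    rw [pow_succ, pow_succ]
    exact ih.mul h

lemma neg (h : HeightLE D y) : HeightLE D (-y) := by
  refine ⟨h.1, ?_, fun σ => ?_⟩
  · rw [mul_neg]
    exact h.2.1.neg
  · rw [map_neg, norm_neg]
    exact h.2.2 σ

lemma add (h₁ : HeightLE D₁ y) (h₂ : HeightLE D₂ z) : HeightLE (2 * D₁ * D₂) (y + z) := by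
  refine ⟨Nat.mul_pos (Nat.mul_pos two_pos h₁.1) h₂.1, ?_, fun σ => ?_⟩
  · have ha := (isIntegral_natCast (R := ℤ) (B := k) (2 * D₂)).mul h₁.2.1
    have hb := (isIntegral_natCast (R := ℤ) (B := k) (2 * D₁)).mul h₂.2.1
    have h := ha.add hb
    rwa [show ((2 * D₂ : ℕ) : k) * (D₁ * y) + ((2 * D₁ : ℕ) : k) * (D₂ * z) =
      ((2 * D₁ * D₂ : ℕ) : k) * (y + z) by push_cast; ring] at h
  · have h1 : (1 : ℝ) ≤ D₁ := by exact_mod_cast h₁.1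
    have h2 : (1 : ℝ) ≤ D₂ := by exact_mod_cast h₂.1
    have h3 := h₁.2.2 σ
    have h4 := h₂.2.2 σ
    rw [map_add]
    refine (norm_add_le _ _).trans ?_
    push_cast
    nlinarith

lemma add_same (hy : HeightLE D y) (hz : HeightLE D z) : HeightLE (2 * D) (y + z) := by
  refine ⟨Nat.mul_pos two_pos hy.1, ?_, fun σ => ?_⟩
  · rw [Nat.cast_mul, mul_assoc, mul_add]
    exact (isIntegral_natCast 2).mul (hy.2.1.add hz.2.1)
  · rw [map_add]
    refine (norm_add_le_of_le (hy.2.2 σ) (hz.2.2 σ)).trans_eq ?_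
    push_cast
    ring

lemma sum {ι : Type} (s : Finset ι) {f : ι → k} (hD : 1 ≤ D) (h : ∀ i ∈ s, HeightLE D (f i)) :
    HeightLE ((s.card + 1) * D) (∑ i ∈ s, f i) := by
  refine ⟨Nat.mul_pos (Nat.succ_pos _) hD, ?_, fun σ => ?_⟩
  · rw [Finset.mul_sum]
    refine IsIntegral.sum _ fun i hi => ?_
    rw [Nat.cast_mul, mul_assoc]
    exact (isIntegral_natCast _).mul (h i hi).2.1
  · rw [map_sum]
    refine (norm_sum_le_of_le s fun i hi => (h i hi).2.2 σ).trans ?_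
    rw [Finset.sum_const, nsmul_eq_mul]
    push_cast
    nlinarith [(Nat.cast_nonneg D : (0 : ℝ) ≤ D)]

lemma of_monic_root {P : Polynomial k} (hP : P.Monic) (hD : 1 ≤ D)
    (h : ∀ i ∈ Finset.range P.natDegree, HeightLE D (P.coeff i)) (hy : P.eval y = 0) :
    HeightLE (2 * D) y := by
  refine ⟨by omega, ?_, fun σ => ?_⟩
  · have h1 : IsIntegral ℤ ((D : k) * y) := by
      have h2 := Polynomial.scaleRoots_aeval_eq_zero (A := k) (r := (D : k)) hy
      refine IsIntegral.of_aeval_monic_of_isIntegral_coeff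
        ((Polynomial.monic_scaleRoots_iff (D : k)).mpr hP) ?_ ?_ fun i => ?_
      · rw [Polynomial.natDegree_scaleRoots]
        intro h0
        rw [hP.natDegree_eq_zero.mp h0, Polynomial.eval_one] at hy
        exact one_ne_zero hy
      · rw [Polynomial.coe_aeval_eq_eval] at h2
        exact h2 ▸ isIntegral_zero
      · rw [Polynomial.coeff_scaleRoots]
        rcases lt_trichotomy i P.natDegree with hi | hi | hi
        · obtain ⟨e, he⟩ : ∃ e, P.natDegree - i = e + 1 := ⟨P.natDegree - i - 1, by omega⟩
          rw [he, pow_succ', ← mul_assoc, mul_comm (P.coeff i)]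
          exact (h i (Finset.mem_range.mpr hi)).2.1.mul ((isIntegral_natCast D).pow e)
        · rw [hi, hP.coeff_natDegree, one_mul]
          exact (isIntegral_natCast D).pow _
        · rw [Polynomial.coeff_eq_zero_of_natDegree_lt hi, zero_mul]
          exact isIntegral_zero
    rw [Nat.cast_mul, mul_assoc]
    exact (isIntegral_natCast 2).mul h1
  · have h1 : (P.map σ).IsRoot (σ y) := by
      rw [Polynomial.IsRoot, Polynomial.eval_map_apply, hy, map_zero]
    have h2 := h1.norm_lt_cauchyBound (hP.map σ).ne_zero
    have h3 : (P.map σ).cauchyBound ≤ D + 1 := by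
      rw [Polynomial.cauchyBound, (hP.map σ).leadingCoeff, nnnorm_one, div_one]
      gcongr
      refine Finset.sup_le fun i hi => ?_
      rw [hP.natDegree_map] at hi
      rw [Polynomial.coeff_map]
      exact_mod_cast (h i hi).2.2 σ
    have h4 : ((P.map σ).cauchyBound : ℝ) ≤ D + 1 := by exact_mod_cast h3
    have h5 : (1 : ℝ) ≤ D := by exact_mod_cast hD
    push_cast
    have h6 : ‖σ y‖ < (P.map σ).cauchyBound := by exact_mod_cast h2
    linarith

variable [NumberField k]

lemma exists_bound (y : k) : ∃ D, HeightLE D y := by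
  obtain ⟨d, hd, hy_int⟩ := ((IsFractionRing.isAlgebraic_iff ℤ ℚ k).mpr
    (Algebra.IsAlgebraic.isAlgebraic (R := ℚ) y)).exists_integral_multiple
  obtain ⟨B, hB⟩ := exists_nat_ge (∑ σ : k →+* ℂ, ‖σ y‖)
  have h1 : IsIntegral ℤ ((d.natAbs : k) * y) := by
    rw [zsmul_eq_mul] at hy_int
    rcases Int.natAbs_eq d with h | h
    · rw [h, Int.cast_natCast] at hy_int
      exact hy_int
    · rw [h, Int.cast_neg, Int.cast_natCast, neg_mul] at hy_int
      simpa using hy_int.neg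
  have h2 : 1 ≤ d.natAbs := Int.natAbs_pos.mpr hd
  refine ⟨d.natAbs * (B + 1), Nat.mul_pos h2 B.succ_pos, ?_, fun σ => ?_⟩
  · rw [Nat.cast_mul, mul_comm (d.natAbs : k), mul_assoc]
    exact (isIntegral_natCast _).mul h1
  · have h3 : ‖σ y‖ ≤ B :=
      (Finset.single_le_sum (f := fun σ : k →+* ℂ => ‖σ y‖) (fun _ _ => norm_nonneg _)
        (Finset.mem_univ σ)).trans hB
    refine h3.trans ?_
    exact_mod_cast (Nat.le_succ B).trans (Nat.le_mul_of_pos_left _ h2)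

lemma exists_bound_finset {ι : Type} (s : Finset ι) (f : ι → k) :
    ∃ D, 1 ≤ D ∧ ∀ i ∈ s, HeightLE D (f i) := by
  choose D hD using fun i => exists_bound (f i)
  have h1 : 1 ≤ ∏ i ∈ s, D i := Finset.one_le_prod' fun i _ => (hD i).1
  exact ⟨∏ i ∈ s, D i, h1, fun i hi => (hD i).of_dvd (Finset.dvd_prod_of_mem D hi) h1⟩

lemma exists_bound_eval_pow (τ : k) (f : Polynomial k) :
    ∃ D, 1 ≤ D ∧ ∀ m : ℕ, HeightLE (D ^ (m + 1)) (f.eval (τ ^ m)) := by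
  obtain ⟨T, hT⟩ := exists_bound τ
  induction f using Polynomial.induction_on' with
  | add p q hp hq =>
    obtain ⟨A, hA, hA'⟩ := hp
    obtain ⟨B, hB, hB'⟩ := hq
    have h1 : 1 ≤ 2 * A * B := Nat.mul_pos (Nat.mul_pos two_pos hA) hB
    refine ⟨2 * A * B, h1, fun m => ?_⟩
    rw [Polynomial.eval_add]
    refine ((hA' m).add (hB' m)).of_dvd ?_ (Nat.one_le_pow _ _ h1)
    rw [mul_pow, mul_pow]
    exact mul_dvd_mul_right (mul_dvd_mul_right (dvd_pow_self 2 m.succ_ne_zero) _) _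
  | monomial n a =>
    obtain ⟨A, hA⟩ := exists_bound a
    have h1 : 1 ≤ A * T ^ n := Nat.mul_pos hA.1 (Nat.one_le_pow _ _ hT.1)
    refine ⟨A * T ^ n, h1, fun m => ?_⟩
    rw [Polynomial.eval_monomial, ← pow_mul]
    refine (hA.mul (hT.pow _)).of_dvd ?_ (Nat.one_le_pow _ _ h1)
    rw [mul_pow, ← pow_mul]
    refine mul_dvd_mul (dvd_pow_self A m.succ_ne_zero) (pow_dvd_pow T ?_)
    nlinarith

end HeightLE

lemma LiouvilleBound.exists_pow_le {k Ω : Type} [Field k] [NormedField Ω] {φ : k →+* Ω}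
    (hφ : LiouvilleBound φ) : ∃ n : ℕ, ∀ (D : ℕ) (y : k), HeightLE D y → y ≠ 0 →
      ((D : ℝ) ^ n)⁻¹ ≤ ‖φ y‖ := by
  obtain ⟨n, hn⟩ := hφ
  exact ⟨n, fun D y h hy => hn D y h.1 hy h.2.1 h.2.2⟩

lemma exists_eq_zero_of_norm_le {k Ω : Type} [Field k] [NormedField Ω] {φ : k →+* Ω} {n : ℕ}
    (hφ : ∀ (D : ℕ) (y : k), HeightLE D y → y ≠ 0 → ((D : ℝ) ^ n)⁻¹ ≤ ‖φ y‖)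
    (A B : ℕ) (c : ℝ) {ρ : ℝ} (hρ : 0 ≤ ρ) (hlt : ρ * (B : ℝ) ^ n < 1) :
    ∃ i₀ : ℕ, ∀ i ≥ i₀, ∀ y, HeightLE (A * B ^ i) y → ‖φ y‖ ≤ c * ρ ^ i → y = 0 := by
  have h1 : Filter.Tendsto (fun i => (A : ℝ) ^ n * c * (ρ * (B : ℝ) ^ n) ^ i) Filter.atTop
      (nhds 0) := by
    simpa using (tendsto_pow_atTop_nhds_zero_of_lt_one
      (mul_nonneg hρ (pow_nonneg (Nat.cast_nonneg _) _)) hlt).const_mul ((A : ℝ) ^ n * c)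
  obtain ⟨i₀, hi₀⟩ := Filter.eventually_atTop.mp (h1.eventually_lt_const one_pos)
  refine ⟨i₀, fun i hi y hy hle => ?_⟩
  by_contra hne
  have h2 := hφ _ y hy hne
  have hD : (0 : ℝ) < ((A * B ^ i : ℕ) : ℝ) ^ n := pow_pos (by exact_mod_cast hy.1) n
  have h3 : 1 ≤ ((A * B ^ i : ℕ) : ℝ) ^ n * (c * ρ ^ i) := by
    have := (inv_le_iff_one_le_mul₀' hD).mp (h2.trans hle)
    exact this
  refine absurd (h3.trans_lt (lt_of_eq_of_lt ?_ (hi₀ i hi))) (lt_irrefl 1)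
  push_cast
  ring

namespace Polynomial

variable {L : Type} [NormedField L]

lemma exists_norm_eval_le (p : L[X]) : ∃ B : ℝ, 0 ≤ B ∧ ∀ u, ‖u‖ ≤ 1 → ‖p.eval u‖ ≤ B := by
  refine ⟨∑ i ∈ Finset.range (p.natDegree + 1), ‖p.coeff i‖,
    Finset.sum_nonneg fun _ _ => norm_nonneg _, fun u hu => ?_⟩
  rw [eval_eq_sum_range]
  refine norm_sum_le_of_le _ fun i _ => ?_
  rw [norm_mul, norm_pow]
  exact mul_le_of_le_one_right (norm_nonneg _) (pow_le_one₀ (norm_nonneg _) hu)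

lemma exists_norm_eval_map_le (P : L[X][X]) {Y : ℝ} (hY : 0 ≤ Y) : ∃ B : ℝ, 0 ≤ B ∧
    ∀ u y, ‖u‖ ≤ 1 → ‖y‖ ≤ Y → ‖(P.map (evalRingHom u)).eval y‖ ≤ B := by
  induction P using Polynomial.induction_on' with
  | add p q hp hq =>
    obtain ⟨A, hA, hA'⟩ := hp
    obtain ⟨B, hB, hB'⟩ := hq
    refine ⟨A + B, add_nonneg hA hB, fun u y hu hy => ?_⟩
    rw [Polynomial.map_add, eval_add]
    exact norm_add_le_of_le (hA' u y hu hy) (hB' u y hu hy)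
  | monomial n a =>
    obtain ⟨A, hA, hA'⟩ := exists_norm_eval_le a
    refine ⟨A * Y ^ n, mul_nonneg hA (pow_nonneg hY n), fun u y hu hy => ?_⟩
    rw [map_monomial, eval_monomial, norm_mul, norm_pow]
    exact mul_le_mul (hA' u hu) (pow_le_pow_left₀ (norm_nonneg _) hy n) (by positivity) hA

lemma Monic.exists_norm_root_le {P : L[X][X]} (hP : P.Monic) : ∃ Y : ℝ, 0 ≤ Y ∧
    ∀ u y, ‖u‖ ≤ 1 → (P.map (evalRingHom u)).eval y = 0 → ‖y‖ ≤ Y := by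
  choose B hB hB' using fun i => exists_norm_eval_le (P.coeff i)
  refine ⟨∑ i ∈ Finset.range P.natDegree, B i + 1,
    add_nonneg (Finset.sum_nonneg fun _ _ => hB _) zero_le_one, fun u y hu hy => ?_⟩
  have hm := hP.map (evalRingHom u)
  refine (NNReal.coe_lt_coe.mpr (IsRoot.norm_lt_cauchyBound hm.ne_zero hy)).le.trans ?_
  rw [cauchyBound, hm.leadingCoeff, nnnorm_one, div_one, hP.natDegree_map]
  push_cast
  refine add_le_add_left ?_ 1
  have h0 : 0 ≤ ∑ i ∈ Finset.range P.natDegree, B i := Finset.sum_nonneg fun _ _ => hB _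
  rw [← Real.le_toNNReal_iff_coe_le h0]
  refine Finset.sup_le fun i hi => ?_
  rw [Real.le_toNNReal_iff_coe_le h0, coeff_map, coe_nnnorm]
  exact (hB' i u hu).trans (Finset.single_le_sum (fun j _ => hB j) hi)

lemma pow_card_le_prod_map {α : Type} (S : Multiset α) (f : α → ℝ) {b : ℝ} (hb : 0 ≤ b)
    (h : ∀ s ∈ S, b ≤ f s) : b ^ S.card ≤ (S.map f).prod := by
  induction S using Multiset.induction_on with
  | empty => simp
  | cons s S ih =>
    rw [Multiset.card_cons, pow_succ', Multiset.map_cons, Multiset.prod_cons]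
    exact mul_le_mul (h s (Multiset.mem_cons_self s S))
      (ih fun x hx => h x (Multiset.mem_cons_of_mem hx)) (pow_nonneg hb _)
      (hb.trans (h s (Multiset.mem_cons_self s S)))

lemma eval_map_prod_X_sub_C (S : Multiset L[X]) (u y : L) :
    (((S.map fun s => X - C s).prod).map (evalRingHom u)).eval y =
      (S.map fun s => y - s.eval u).prod := by
  rw [Polynomial.map_multiset_prod, eval_multiset_prod, Multiset.map_map, Multiset.map_map]
  congr 2
  funext s
  simp

/-- The roots of a monic polynomial over `L[X]` at the powers of a small element `t` are
approximated by the values of finitely many polynomials. -/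
theorem Monic.exists_approx_roots [CharZero L] [IsAlgClosed L] {P : L[X][X]} (hP : P.Monic)
    {t : L} (ht0 : t ≠ 0) (ht : ‖t‖ < 1) (M : ℕ) :
    ∃ E : ℕ, 0 < E ∧ ∃ (N : ℕ) (𝒯 : Finset L[X]), (∀ T ∈ 𝒯, T.degree < N) ∧ ∃ c : ℝ, 0 ≤ c ∧
      ∀ i y, (P.map (evalRingHom (t ^ (E * i)))).eval y = 0 →
        ∃ T ∈ 𝒯, ‖y - T.eval (t ^ i)‖ ≤ c * (‖t‖ ^ (E * M)) ^ i := by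
  classical
  obtain ⟨E, hE, S, hS, G, hG⟩ := hP.hasPuiseux (P.natDegree * M)
  set d := P.natDegree
  set N := E * (d * M)
  obtain ⟨Y, hY, hY'⟩ := hP.exists_norm_root_le
  obtain ⟨B, hB, hB'⟩ := exists_norm_eval_map_le G hY
  choose Bs hBs hBs' using fun s : L[X] => exists_norm_eval_le (s /ₘ X ^ N)
  have hX : (X ^ N : L[X]).Monic := monic_X_pow N
  have hpos : 0 < ‖t‖ := norm_pos_iff.mpr ht0
  have htp : ∀ m : ℕ, ‖t ^ m‖ ≤ 1 := fun m => by
    rw [norm_pow]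
    exact pow_le_one₀ (norm_nonneg _) ht.le
  refine ⟨E, hE, N, S.toFinset.image (· %ₘ X ^ N), ?_, B + 1 + ∑ s ∈ S.toFinset, Bs s,
    add_nonneg (by linarith) (Finset.sum_nonneg fun _ _ => hBs _), fun i y hy => ?_⟩
  · intro T hT
    obtain ⟨s, -, rfl⟩ := Finset.mem_image.mp hT
    exact (degree_modByMonic_lt s hX).trans_eq (degree_X_pow N)
  have hρ : 0 < (‖t‖ ^ (E * M)) ^ i := pow_pos (pow_pos hpos _) _
  have hd : d ≠ 0 := by
    intro h0
    rw [hP.natDegree_eq_zero.mp h0, Polynomial.map_one, eval_one] at hy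
    exact one_ne_zero hy
  have hN : ‖t ^ i‖ ^ N = ((‖t‖ ^ (E * M)) ^ i) ^ d := by
    rw [norm_pow, ← pow_mul, ← pow_mul, ← pow_mul]
    congr 1
    ring
  have hprod : (S.map fun s => ‖y - s.eval (t ^ i)‖).prod ≤ B * ((‖t‖ ^ (E * M)) ^ i) ^ d := by
    have h1 := congrArg (fun p => (p.map (evalRingHom (t ^ i))).eval y) hG
    have h2 : (evalRingHom (t ^ i)).comp (Polynomial.expand L E : L[X] →+* L[X]) =
        evalRingHom (t ^ (E * i)) := RingHom.ext fun p => by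
      simp [expand_eval, ← pow_mul, mul_comm]
    simp only [Polynomial.map_sub, Polynomial.map_mul, eval_sub, eval_mul, map_map, h2, hy,
      eval_map_prod_X_sub_C, map_C, eval_C, coe_evalRingHom, eval_pow, eval_X, zero_sub] at h1
    have h3 := congrArg norm h1
    rw [norm_neg, norm_mul, norm_pow, hN, show ∀ x : L, ‖x‖ = normHom x from fun _ => rfl, map_multiset_prod,
      Multiset.map_map] at h3
    refine (le_of_eq h3).trans ?_
    rw [mul_comm]
    exact mul_le_mul_of_nonneg_right (hB' _ _ (htp i) (hY' _ _ (htp _) hy)) (by positivity)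
  obtain ⟨s, hs, hle⟩ : ∃ s ∈ S, ‖y - s.eval (t ^ i)‖ ≤ (B + 1) * (‖t‖ ^ (E * M)) ^ i := by
    by_contra! hcon
    have h1 := pow_card_le_prod_map S (fun s => ‖y - s.eval (t ^ i)‖) (by positivity)
      fun s hs => (hcon s hs).le
    rw [hS, mul_pow] at h1
    have h2 := le_of_mul_le_mul_right (h1.trans hprod) (pow_pos hρ d)
    have h3 := le_self_pow₀ (by linarith : 1 ≤ B + 1) hd
    linarith
  refine ⟨s %ₘ X ^ N, Finset.mem_image_of_mem _ (Multiset.mem_toFinset.mpr hs), ?_⟩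
  have h4 := congrArg (eval (t ^ i)) (modByMonic_add_div s (X ^ N))
  rw [eval_add, eval_mul, eval_pow, eval_X] at h4
  have h5 : y - (s %ₘ X ^ N).eval (t ^ i) =
      (y - s.eval (t ^ i)) + (t ^ i) ^ N * (s /ₘ X ^ N).eval (t ^ i) := by
    rw [← h4]
    ring
  rw [h5, add_mul]
  refine norm_add_le_of_le hle ?_
  rw [norm_mul, norm_pow, hN, mul_comm]
  have h6 : (‖t‖ ^ (E * M)) ^ i ≤ 1 :=
    pow_le_one₀ (pow_nonneg (norm_nonneg _) _) (pow_le_one₀ (norm_nonneg _) ht.le)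
  refine mul_le_mul ((hBs' s _ (htp i)).trans ?_) (pow_le_of_le_one hρ.le h6 hd) (by positivity)
    (Finset.sum_nonneg fun _ _ => hBs _)
  exact Finset.single_le_sum (fun s _ => hBs s) (Multiset.mem_toFinset.mpr hs)

end Polynomial

/-- Some pattern of monochromatic points recurs infinitely often in a finite colouring. -/
lemma exists_infinite_recurring_pattern {κ : Type} [Finite κ] (col : ℕ → κ) (R : ℕ) :
    ∃ (c : κ) (O : Finset ℕ), O.card = R ∧ {i | ∀ o ∈ O, col (i + o) = c}.Infinite := by
  classical
  have := Fintype.ofFinite κ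
  have : Nonempty κ := ⟨col 0⟩
  obtain ⟨w, hw⟩ := Finite.exists_infinite_fiber
    (fun (i : ℕ) (j : Fin (Fintype.card κ * R)) => col (i + j))
  obtain ⟨c, hc⟩ := Fintype.exists_le_card_fiber_of_mul_le_card w (n := R) (by simp)
  obtain ⟨O, hO, hcard⟩ := Finset.exists_subset_card_eq hc
  refine ⟨c, O.map Fin.valEmbedding, by rw [Finset.card_map, hcard],
    (Set.infinite_coe_iff.mp hw).mono fun i hi o ho => ?_⟩
  obtain ⟨j, hj, rfl⟩ := Finset.mem_map.mp ho
  have h1 := (Finset.mem_filter.mp (hO hj)).2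
  exact (congrFun (show (fun j : Fin (Fintype.card κ * R) => col (i + j)) = w from hi) j).trans h1

lemma exists_natDegree_eval_lt {k : Type} [Field k] (Q : Polynomial (Polynomial k)) (N : ℕ) :
    ∃ R : ℕ, ∀ q : Polynomial k, q.degree < N → (Q.eval q).natDegree < R := by
  induction Q using Polynomial.induction_on' with
  | add p q hp hq =>
    obtain ⟨A, hA⟩ := hp
    obtain ⟨B, hB⟩ := hq
    refine ⟨max A B, fun f hf => ?_⟩
    rw [Polynomial.eval_add]
    exact (Polynomial.natDegree_add_le _ _).trans_lt (max_lt_max (hA f hf) (hB f hf))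
  | monomial n a =>
    refine ⟨a.natDegree + n * N + 1, fun f hf => ?_⟩
    rw [Polynomial.eval_monomial, Nat.lt_succ_iff]
    refine Polynomial.natDegree_mul_le.trans (Nat.add_le_add_left ?_ _)
    exact Polynomial.natDegree_pow_le.trans
      (Nat.mul_le_mul_left _ (Polynomial.natDegree_le_of_degree_le hf.le))

lemma eval_basis_pow_add {k : Type} [Field k] {τ : k} (hτ : τ ≠ 0) (s : Finset ℕ) (i j o : ℕ) :
    (Lagrange.basis s (fun l => τ ^ (i + l)) j).eval (τ ^ (i + o)) =
      (Lagrange.basis s (fun l => τ ^ l) j).eval (τ ^ o) := by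
  rw [Lagrange.basis, Lagrange.basis, Polynomial.eval_prod, Polynomial.eval_prod]
  refine Finset.prod_congr rfl fun l _ => ?_
  simp only [Lagrange.basisDivisor, Polynomial.eval_mul, Polynomial.eval_C, Polynomial.eval_sub,
    Polynomial.eval_X, pow_add, ← mul_sub]
  rw [mul_inv, mul_mul_mul_comm, inv_mul_cancel₀ (pow_ne_zero i hτ), one_mul]

lemma sum_eval_mul_basis {k Ω : Type} [Field k] [Field Ω] (φ : k →+* Ω) {τ : k}
    (hτ : Function.Injective fun i : ℕ => τ ^ i) (s : Finset ℕ) {T : Polynomial Ω}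
    (hT : T.degree < s.card) (u : Ω) (o : ℕ) :
    ∑ j ∈ s, T.eval (u * φ τ ^ j) * φ ((Lagrange.basis s (fun l => τ ^ l) j).eval (τ ^ o)) =
      T.eval (u * φ τ ^ o) := by
  have hmon : ∀ e < s.card, ∑ j ∈ s, (φ τ ^ j) ^ e *
      φ ((Lagrange.basis s (fun l => τ ^ l) j).eval (τ ^ o)) = (φ τ ^ o) ^ e := by
    intro e he
    have h1 := Lagrange.eq_interpolate (s := s) (v := fun l => τ ^ l) (f := Polynomial.X ^ e)
      hτ.injOn ((Polynomial.degree_X_pow e).trans_lt (by exact_mod_cast he))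
    have h2 := congrArg (fun p => φ (p.eval (τ ^ o))) h1
    simp only [Lagrange.interpolate_apply, Polynomial.eval_finsetSum, Polynomial.eval_mul,
      Polynomial.eval_C, Polynomial.eval_pow, Polynomial.eval_X, map_sum, map_mul, map_pow] at h2
    exact h2.symm
  have hexp : ∀ x, T.eval x = ∑ e ∈ Finset.range s.card, T.coeff e * x ^ e := by
    intro x
    rcases eq_or_ne T 0 with rfl | hT0
    · simp
    · refine Polynomial.eval_eq_sum_range' ?_ x
      rw [Polynomial.degree_eq_natDegree hT0] at hT
      exact_mod_cast hT
  simp only [hexp, Finset.sum_mul]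
  rw [Finset.sum_comm]
  refine Finset.sum_congr rfl fun e he => ?_
  rw [mul_pow, ← hmon e (Finset.mem_range.mp he), Finset.mul_sum, Finset.mul_sum]
  refine Finset.sum_congr rfl fun j _ => ?_
  ring

lemma exists_infinite_fiber_of_mapsTo {α β : Type} {s : Set α} (hs : s.Infinite) {t : Set β}
    (ht : t.Finite) {f : α → β} (hf : Set.MapsTo f s t) : ∃ b, {a | a ∈ s ∧ f a = b}.Infinite := by
  by_contra! hcon
  refine hs ((ht.biUnion fun b _ => hcon b).subset fun a ha => ?_)
  exact Set.mem_biUnion (hf ha) ⟨ha, rfl⟩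

/-- Sequences of bounded height which are extremely well approximated by finitely many
polynomials take the values of polynomials on an infinite set. -/
theorem exists_polynomial_values {k Ω : Type} [Field k] [NumberField k] [NormedField Ω]
    {φ : k →+* Ω} {n : ℕ}
    (hφ : ∀ (D : ℕ) (y : k), HeightLE D y → y ≠ 0 → ((D : ℝ) ^ n)⁻¹ ≤ ‖φ y‖)
    {τ : k} (hτ : Function.Injective fun i : ℕ => τ ^ i) (hτ0 : τ ≠ 0)
    {ι : Type} [Finite ι] (r : ι → ℕ → k) {A B : ℕ} (hA : 1 ≤ A) (hB : 1 ≤ B)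
    (hr : ∀ a i, HeightLE (A * B ^ i) (r a i))
    {N : ℕ} {𝒯 : Finset (Polynomial Ω)} (h𝒯 : ∀ T ∈ 𝒯, T.degree < N) {c ρ : ℝ} (hc : 0 ≤ c)
    (hρ : 0 ≤ ρ) (hρ1 : ρ ≤ 1)
    (happ : ∀ a i, ∃ T ∈ 𝒯, ‖φ (r a i) - T.eval (φ τ ^ i)‖ ≤ c * ρ ^ i)
    (hlt : ρ * (B : ℝ) ^ n < 1) {Q : Polynomial (Polynomial k)} (hQ : Q ≠ 0)
    (hQr : ∀ a i, (Q.map (Polynomial.evalRingHom (τ ^ i))).eval (r a i) = 0) :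
    ∃ q : ι → Polynomial k, {i | ∀ a, r a i = (q a).eval (τ ^ i)}.Infinite := by
  classical
  have := Fintype.ofFinite ι
  obtain ⟨R₀, hR₀⟩ := exists_natDegree_eval_lt Q N
  choose T hT hTle using happ
  obtain ⟨S, O, hO, hinf⟩ := exists_infinite_recurring_pattern
    (fun (i : ℕ) (a : ι) => (⟨T a i, hT a i⟩ : 𝒯)) (max N R₀)
  obtain ⟨O', hO', hcard⟩ := Finset.exists_subset_card_eq (hO.symm ▸ le_max_left N R₀)
  set W := O.sup id
  have hW : ∀ o ∈ O, o ≤ W := fun o ho => Finset.le_sup (f := id) ho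
  set b : ℕ → ℕ → k := fun o j => (Lagrange.basis O' (fun l => τ ^ l) j).eval (τ ^ o)
  set q : ι → ℕ → Polynomial k := fun a i =>
    Lagrange.interpolate O' (fun l => τ ^ (i + l)) (fun l => r a (i + l))
  have hinj : ∀ i, Function.Injective fun l : ℕ => τ ^ (i + l) := fun i =>
    hτ.comp (add_right_injective i)
  have hqeval : ∀ a i o, (q a i).eval (τ ^ (i + o)) = ∑ j ∈ O', r a (i + j) * b o j := by
    intro a i o
    simp only [q, Lagrange.interpolate_apply, Polynomial.eval_finsetSum, Polynomial.eval_mul,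
      Polynomial.eval_C, eval_basis_pow_add hτ0, b]
  obtain ⟨D, hD, hDb⟩ := HeightLE.exists_bound_finset (O ×ˢ O') fun x => b x.1 x.2
  have hheight : ∀ a i, ∀ o ∈ O, HeightLE (2 * (N + 1) * A * B ^ W * D * B ^ i)
      (r a (i + o) - (q a i).eval (τ ^ (i + o))) := by
    intro a i o ho
    have h1 : ∀ j ∈ O, HeightLE (A * B ^ (i + W)) (r a (i + j)) := fun j hj =>
      (hr a (i + j)).of_dvd (mul_dvd_mul_left A (pow_dvd_pow B (Nat.add_le_add_left (hW j hj) i)))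
        (Nat.mul_pos hA (Nat.one_le_pow _ _ hB))
    have h2 : 1 ≤ A * B ^ (i + W) * D :=
      Nat.mul_pos (Nat.mul_pos hA (Nat.one_le_pow _ _ hB)) hD
    have h3 := HeightLE.sum O' h2 fun j hj =>
      (h1 j (hO' hj)).mul (hDb (o, j) (Finset.mk_mem_product ho hj))
    have h4 : HeightLE ((O'.card + 1) * (A * B ^ (i + W) * D)) (r a (i + o)) :=
      (h1 o ho).of_dvd ((Dvd.intro _ rfl).mul_left _) h3.1
    have h5 := h4.add_same h3.neg
    rw [sub_eq_add_neg, hqeval]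
    convert h5 using 1
    rw [hcard, pow_add]
    ring
  have hnorm : ∀ i ∈ {i | ∀ o ∈ O, (fun a => (⟨T a (i + o), hT a (i + o)⟩ : 𝒯)) = S},
      ∀ a, ∀ o ∈ O, ‖φ (r a (i + o) - (q a i).eval (τ ^ (i + o)))‖ ≤
        (c * (1 + ∑ o ∈ O, ∑ j ∈ O', ‖φ (b o j)‖)) * ρ ^ i := by
    intro i hi a o ho
    have hTS : ∀ j ∈ O, T a (i + j) = S a := fun j hj =>
      congrArg Subtype.val (congrFun (hi j hj) a)
    have h1 := sum_eval_mul_basis φ hτ O' (T := S a)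
      (by rw [hcard]; exact h𝒯 _ (S a).2) (φ τ ^ i) o
    simp only [← pow_add] at h1
    have h2 : φ (r a (i + o) - (q a i).eval (τ ^ (i + o))) =
        (φ (r a (i + o)) - (S a : Polynomial Ω).eval (φ τ ^ (i + o))) -
        ∑ j ∈ O', (φ (r a (i + j)) - (S a : Polynomial Ω).eval (φ τ ^ (i + j))) * φ (b o j) := by
      simp only [sub_mul, Finset.sum_sub_distrib]
      rw [show ∑ j ∈ O', (S a : Polynomial Ω).eval (φ τ ^ (i + j)) * φ (b o j) = _ from h1,
        hqeval, map_sub, map_sum]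
      simp only [map_mul]
      ring
    have h3 : ∀ j ∈ O, ‖φ (r a (i + j)) - (S a : Polynomial Ω).eval (φ τ ^ (i + j))‖ ≤
        c * ρ ^ i := by
      intro j hj
      rw [← hTS j hj]
      exact (hTle a (i + j)).trans
        (mul_le_mul_of_nonneg_left (pow_le_pow_of_le_one hρ hρ1 (Nat.le_add_right i j)) hc)
    have h4 : ∑ j ∈ O', ‖φ (b o j)‖ ≤ ∑ o ∈ O, ∑ j ∈ O', ‖φ (b o j)‖ :=
      Finset.single_le_sum (f := fun o => ∑ j ∈ O', ‖φ (b o j)‖)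
        (fun _ _ => Finset.sum_nonneg fun _ _ => norm_nonneg _) ho
    rw [h2]
    calc _ ≤ c * ρ ^ i + ∑ j ∈ O', c * ρ ^ i * ‖φ (b o j)‖ := by
          refine (norm_sub_le _ _).trans (add_le_add (h3 o ho) (norm_sum_le_of_le _ fun j hj => ?_))
          rw [norm_mul]
          exact mul_le_mul_of_nonneg_right (h3 j (hO' hj)) (norm_nonneg _)
      _ = c * ρ ^ i * (1 + ∑ j ∈ O', ‖φ (b o j)‖) := by rw [← Finset.mul_sum]; ring
      _ ≤ c * ρ ^ i * (1 + ∑ o ∈ O, ∑ j ∈ O', ‖φ (b o j)‖) := by gcongr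
      _ = _ := by ring
  obtain ⟨i₀, hi₀⟩ := exists_eq_zero_of_norm_le hφ (2 * (N + 1) * A * B ^ W * D) B
    (c * (1 + ∑ o ∈ O, ∑ j ∈ O', ‖φ (b o j)‖)) hρ hlt
  set 𝓜 := {i | ∀ o ∈ O, (fun a => (⟨T a (i + o), hT a (i + o)⟩ : 𝒯)) = S}
  have hval : ∀ i ∈ 𝓜 \ Set.Iio i₀, ∀ a, ∀ o ∈ O,
      r a (i + o) = (q a i).eval (τ ^ (i + o)) := fun i hi a o ho =>
    sub_eq_zero.mp (hi₀ i (not_lt.mp hi.2) _ (hheight a i o ho) (hnorm i hi.1 a o ho))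
  have hroot : ∀ i ∈ 𝓜 \ Set.Iio i₀, ∀ a, q a i ∈ Q.roots.toFinset := by
    intro i hi a
    rw [Multiset.mem_toFinset, Polynomial.mem_roots hQ, Polynomial.IsRoot]
    refine Polynomial.eq_zero_of_natDegree_lt_card_of_eval_eq_zero' _
      (O.image fun o => τ ^ (i + o)) ?_ ?_
    · intro x hx
      obtain ⟨o, ho, rfl⟩ := Finset.mem_image.mp hx
      have h1 := hQr a (i + o)
      rw [hval i hi a o ho] at h1
      exact (Polynomial.eval_map_apply (Polynomial.evalRingHom (τ ^ (i + o))) (q a i)).symm.trans h1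
    · rw [Finset.card_image_of_injective _ (hinj i), hO]
      refine (hR₀ _ ?_).trans_le (le_max_right _ _)
      rw [← hcard]
      exact Lagrange.degree_interpolate_lt _ (hinj i).injOn
  obtain ⟨f, hf⟩ := exists_infinite_fiber_of_mapsTo (hinf.sdiff (Set.finite_Iio i₀))
    (Set.Finite.pi' fun _ : ι => Q.roots.toFinset.finite_toSet) (f := fun i a => q a i)
    fun i hi a => hroot i hi a
  obtain ⟨o, ho⟩ : O.Nonempty := by
    rw [← Finset.card_pos, hO]
    exact lt_max_of_lt_right ((Nat.zero_le _).trans_lt (hR₀ 0 (by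
      rw [Polynomial.degree_zero]
      exact WithBot.bot_lt_coe N)))
  refine ⟨f, (hf.image (add_left_injective o).injOn).mono ?_⟩
  rintro _ ⟨i, ⟨hi, rfl⟩, rfl⟩ a
  exact hval i hi a o ho

lemma injective_pow_of_forall_ne_one {k : Type} [Field k] {τ : k} (hτ0 : τ ≠ 0)
    (hroot : ∀ n : ℕ, 0 < n → τ ^ n ≠ 1) : Function.Injective fun i : ℕ => τ ^ i := by
  refine Function.Injective.of_lt_imp_ne fun i j hij h => hroot (j - i) (Nat.sub_pos_of_lt hij) ?_
  rw [pow_sub₀ _ hτ0 hij.le, ← show τ ^ i = τ ^ j from h]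
  exact mul_inv_cancel₀ (pow_ne_zero i hτ0)

namespace Polynomial

lemma map_expand_map_evalRingHom {k : Type} [Field k] (P : k[X][X]) (E : ℕ) (x : k) :
    (P.map (expand k E : k[X] →+* k[X])).map (evalRingHom x) = P.map (evalRingHom (x ^ E)) := by
  rw [map_map]
  congr 1
  ext y
  · simp
  · simp

/-- Roots in a number field of the specializations of a monic polynomial along the powers of `τ`
have height growing at most geometrically. -/
lemma Monic.exists_heightLE_roots {k : Type} [Field k] [NumberField k] {P : k[X][X]}
    (hP : P.Monic) (τ : k) : ∃ D, 1 ≤ D ∧ ∀ (m : ℕ) (y : k),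
      (P.map (evalRingHom (τ ^ m))).eval y = 0 → HeightLE (D ^ (m + 1)) y := by
  choose D hD hD' using fun f : k[X] => HeightLE.exists_bound_eval_pow τ f
  set s := Finset.range P.natDegree
  set B := ∏ i ∈ s, D (P.coeff i)
  have hB : 1 ≤ B := Finset.one_le_prod' fun i _ => hD _
  refine ⟨2 * B, by omega, fun m y hy => ?_⟩
  have h := HeightLE.of_monic_root (hP.map (evalRingHom (τ ^ m))) (D := B ^ (m + 1))
    (Nat.one_le_pow _ _ hB) (fun i hi => ?_) hy
  · refine h.of_dvd ?_ (Nat.one_le_pow _ _ (by omega))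
    rw [mul_pow]
    exact mul_dvd_mul_right (dvd_pow_self 2 (Nat.succ_ne_zero m)) _
  · rw [hP.natDegree_map] at hi
    rw [coeff_map, coe_evalRingHom]
    exact (hD' _ m).of_dvd (pow_dvd_pow_of_dvd (Finset.dvd_prod_of_mem (fun i => D (P.coeff i)) hi) _)
      (Nat.one_le_pow _ _ hB)

/-- Along a suitable arithmetic progression of exponents, sequences of roots in a number field of
the specializations of a monic polynomial at the powers of `τ` are infinitely often
simultaneously given by polynomials in the powers of `τ`. -/
theorem Monic.exists_polynomial_roots {k : Type} [Field k] [NumberField k] {P : k[X][X]}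
    (hP : P.Monic) {τ : k} (hτ0 : τ ≠ 0) (hroot : ∀ n : ℕ, 0 < n → τ ^ n ≠ 1)
    {ι : Type} [Finite ι] (r : ι → ℕ → k)
    (hr : ∀ a m, (P.map (evalRingHom (τ ^ m))).eval (r a m) = 0) :
    ∃ E : ℕ, 0 < E ∧ ∃ q : ι → k[X], {i | ∀ a, r a (E * i) = (q a).eval (τ ^ i)}.Infinite := by
  obtain ⟨Ω, _, _, _, φ, hφ1, hφ⟩ := exists_embedding_norm_lt_one hτ0 hroot
  obtain ⟨n, hn⟩ := hφ.exists_pow_le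
  obtain ⟨D, hD, hD'⟩ := hP.exists_heightLE_roots τ
  have hDn : (0 : ℝ) < (D : ℝ) ^ n := by positivity
  obtain ⟨M, hM⟩ := exists_pow_lt_of_lt_one (inv_pos.mpr hDn) hφ1
  have hφ0 : φ τ ≠ 0 := (_root_.map_ne_zero φ).mpr hτ0
  obtain ⟨E, hE, N, 𝒯, h𝒯, c, hc, happ⟩ :=
    (hP.map (mapRingHom φ)).exists_approx_roots hφ0 hφ1 M
  refine ⟨E, hE, ?_⟩
  refine exists_polynomial_values (φ := φ) hn ?_ hτ0 (fun a i => r a (E * i)) hD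
    (Nat.one_le_pow E D hD) (fun a i => ?_) h𝒯 hc (ρ := ‖φ τ‖ ^ (E * M)) (by positivity)
    (pow_le_one₀ (norm_nonneg _) hφ1.le) (fun a i => ?_) ?_
    (Q := P.map (Polynomial.expand k E : k[X] →+* k[X])) (hP.map _).ne_zero (fun a i => ?_)
  · exact injective_pow_of_forall_ne_one hτ0 hroot
  · have h := hD' (E * i) _ (hr a (E * i))
    rwa [pow_succ', pow_mul] at h
  · refine happ i _ ?_
    have h := congrArg φ (hr a (E * i))
    rw [map_zero, ← eval_map_apply, map_map] at h
    have h2 : (evalRingHom (φ τ ^ (E * i))).comp (mapRingHom φ) =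
        φ.comp (evalRingHom (τ ^ (E * i))) := by
      ext x
      · simp
      · simp
    rwa [map_map, h2]
  · have h1 : ‖φ τ‖ ^ M * (D : ℝ) ^ n < 1 := by
      rwa [lt_inv_comm₀ (by positivity) hDn, ← one_div, lt_div_iff₀ (by positivity), mul_comm] at hM
    have h2 : ‖φ τ‖ ^ (E * M) * ((D ^ E : ℕ) : ℝ) ^ n = (‖φ τ‖ ^ M * (D : ℝ) ^ n) ^ E := by
      push_cast
      ring
    rw [h2]
    exact pow_lt_one₀ (by positivity) h1 hE.ne'
  · rw [map_expand_map_evalRingHom, ← pow_mul, mul_comm i E]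
    exact hr a (E * i)

/-- There is a monic polynomial vanishing at the sums and products of two roots of a given monic
polynomial, universally with respect to base change. -/
lemma Monic.exists_monic_eval₂_add_mul {R : Type} [CommRing R] {P : R[X]} (hP : P.Monic) :
    ∃ Q : R[X], Q.Monic ∧ ∀ (L : Type) [CommRing L] (φ : R →+* L) (z w : L),
      P.eval₂ φ z = 0 → P.eval₂ φ w = 0 →
        Q.eval₂ φ (z + w) = 0 ∧ Q.eval₂ φ (z * w) = 0 := by
  set P' := P.map (algebraMap R (AdjoinRoot P))
  set i : R →+* AdjoinRoot P' := (AdjoinRoot.of P').comp (AdjoinRoot.of P)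
  set x : AdjoinRoot P' := AdjoinRoot.of P' (AdjoinRoot.root P)
  set y : AdjoinRoot P' := AdjoinRoot.root P'
  have hx : i.IsIntegralElem x := ⟨P, hP, by
    rw [← hom_eval₂, AdjoinRoot.eval₂_root, map_zero]⟩
  have hy : i.IsIntegralElem y := ⟨P, hP, by
    have h := AdjoinRoot.eval₂_root P'
    rwa [eval₂_map] at h⟩
  obtain ⟨Q₁, hQ₁, h₁⟩ := hx.add i hy
  obtain ⟨Q₂, hQ₂, h₂⟩ := hx.mul i hy
  refine ⟨Q₁ * Q₂, hQ₁.mul hQ₂, fun L _ φ z w hz hw => ?_⟩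
  have hw' : P'.eval₂ (AdjoinRoot.lift φ z hz) w = 0 := by
    rw [eval₂_map, AdjoinRoot.algebraMap_eq, AdjoinRoot.lift_comp_of, hw]
  set ψ := AdjoinRoot.lift (AdjoinRoot.lift φ z hz) w hw'
  have hψ : ψ.comp i = φ := by
    rw [← RingHom.comp_assoc, AdjoinRoot.lift_comp_of, AdjoinRoot.lift_comp_of]
  have hψx : ψ x = z := by simp [ψ, x]
  have hψy : ψ y = w := by simp [ψ, y]
  refine ⟨?_, ?_⟩
  · have h := congrArg ψ h₁
    rw [hom_eval₂, hψ, map_add, hψx, hψy, map_zero] at h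
    rw [eval₂_mul, h, zero_mul]
  · have h := congrArg ψ h₂
    rw [hom_eval₂, hψ, map_mul, hψx, hψy, map_zero] at h
    rw [eval₂_mul, h, mul_zero]

lemma exists_quadratic_of_finrank_le_two {k L : Type} [Field k] [Field L] [Algebra k L] {z : L}
    (hz : IsIntegral k z) (h2 : Module.finrank k (IntermediateField.adjoin k {z}) ≤ 2) :
    ∃ s p : k, z ^ 2 - algebraMap k L s * z + algebraMap k L p = 0 ∧
      ∀ P : k[X], aeval z P = 0 → aeval (algebraMap k L s - z) P = 0 := by
  rw [IntermediateField.adjoin.finrank hz] at h2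
  have hm := minpoly.monic hz
  have hpos := minpoly.natDegree_pos hz
  have h0 := minpoly.aeval k z
  have hlc := hm.coeff_natDegree
  rw [aeval_eq_sum_range] at h0
  obtain h1 | h1 : (minpoly k z).natDegree = 1 ∨ (minpoly k z).natDegree = 2 := by omega
  · rw [h1] at h0 hlc
    simp only [Finset.sum_range_succ, Finset.sum_range_zero, hlc, Algebra.smul_def, map_one] at h0
    set c := (minpoly k z).coeff 0
    have hc : z = algebraMap k L (-c) := by
      rw [map_neg]
      linear_combination h0
    refine ⟨-2 * c, c ^ 2, ?_, fun P hP => ?_⟩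
    · rw [hc]
      simp only [map_neg, map_mul, map_pow, map_ofNat]
      ring
    · rwa [show algebraMap k L (-2 * c) - z = z by
        rw [hc]
        simp only [map_neg, map_mul, map_ofNat]
        ring]
  · rw [h1] at h0 hlc
    simp only [Finset.sum_range_succ, Finset.sum_range_zero, hlc, Algebra.smul_def, map_one] at h0
    refine ⟨-(minpoly k z).coeff 1, (minpoly k z).coeff 0, ?_, fun P hP => ?_⟩
    · rw [map_neg]
      linear_combination h0
    · obtain ⟨R, rfl⟩ := minpoly.dvd k z hP
      rw [map_mul, aeval_eq_sum_range (p := minpoly k z), h1]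
      simp only [Finset.sum_range_succ, Finset.sum_range_zero, hlc, Algebra.smul_def, map_one,
        map_neg]
      linear_combination (aeval (-(algebraMap k L) ((minpoly k z).coeff 1) - z) R) * h0

/-- Two polynomials over an integral domain `A` without common root over the algebraic closure of
its fraction field generate a nonzero constant. -/
lemma exists_bezout_of_forall_eval₂ {A : Type} [CommRing A] [IsDomain A] (G H : A[X])
    (h : ∀ w : AlgebraicClosure (FractionRing A), aeval w G = 0 → aeval w H ≠ 0) :
    ∃ r : A, r ≠ 0 ∧ ∃ U V : A[X], U * G + V * H = C r := by
  have hcop : IsCoprime (G.map (algebraMap A (FractionRing A)))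
      (H.map (algebraMap A (FractionRing A))) := by
    rw [isCoprime_iff_aeval_ne_zero_of_isAlgClosed _ (AlgebraicClosure (FractionRing A))]
    intro w
    rw [aeval_map_algebraMap, aeval_map_algebraMap, or_iff_not_imp_left, not_not]
    exact h w
  obtain ⟨u, v, huv⟩ := hcop
  obtain ⟨b, hb0, hb⟩ := IsLocalization.integerNormalization_spec (nonZeroDivisors A) u
  obtain ⟨c, hc0, hc⟩ := IsLocalization.integerNormalization_spec (nonZeroDivisors A) v
  refine ⟨b * c, mul_ne_zero (nonZeroDivisors.ne_zero hb0) (nonZeroDivisors.ne_zero hc0),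
    C c * IsLocalization.integerNormalization (nonZeroDivisors A) u,
    C b * IsLocalization.integerNormalization (nonZeroDivisors A) v, ?_⟩
  apply map_injective _ (IsFractionRing.injective A (FractionRing A))
  simp only [Polynomial.map_add, Polynomial.map_mul, hb, hc, map_C, Algebra.smul_def,
    algebraMap_apply, map_mul]
  linear_combination C (algebraMap A (FractionRing A) b) * C (algebraMap A (FractionRing A) c) * huv

/-- A root over `FractionRing k[X]` of degree at most two generates a quadratic function field. -/
lemma exists_quadratic_function_field {k : Type} [Field k] {P : k[X][X]} {E : ℕ} {q₁ q₂ : k[X]}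
    {w : AlgebraicClosure (FractionRing k[X])}
    (hw : aeval w (X ^ 2 - C q₁ * X + C q₂) = 0)
    (hP : aeval w (P.map (expand k E : k[X] →+* k[X])) = 0) :
    ∃ (K : Type) (_ : Field K) (_ : Algebra k K) (y v z : K), Transcendental k y ∧
      (∀ x : K, ∃ a b c : k[X], c ≠ 0 ∧ aeval y c * x = aeval y a + aeval y b * v) ∧
      P.eval₂ (aeval (y ^ E) : k[X] →ₐ[k] K) z = 0 := by
  set L := FractionRing k[X]
  set G : k[X][X] := X ^ 2 - C q₁ * X + C q₂
  have hG : (G.map (algebraMap k[X] L)) ≠ 0 ∧ (G.map (algebraMap k[X] L)).natDegree ≤ 2 := by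
    have : G.map (algebraMap k[X] L) =
        X ^ 2 - C (algebraMap k[X] L q₁) * X + C (algebraMap k[X] L q₂) := by
      simp [G]
    have hd : (X ^ 2 - C (algebraMap k[X] L q₁) * X + C (algebraMap k[X] L q₂)).natDegree = 2 := by
      compute_degree!
    rw [this]
    exact ⟨fun h => by simp [h] at hd, hd.le⟩
  have hwi : IsIntegral L w := Algebra.IsIntegral.isIntegral w
  have h2 : Module.finrank L (IntermediateField.adjoin L {w}) ≤ 2 := by
    rw [IntermediateField.adjoin.finrank hwi]
    refine (natDegree_le_of_dvd (minpoly.dvd L w ?_) hG.1).trans hG.2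
    rw [aeval_map_algebraMap, hw]
  have h0 : 0 < Module.finrank L (IntermediateField.adjoin L {w}) := by
    rw [IntermediateField.adjoin.finrank hwi]
    exact minpoly.natDegree_pos hwi
  set K := IntermediateField.adjoin L {w}
  obtain ⟨v, hv⟩ := exists_basis_of_finrank_le_two h0 h2
  have hKX : ∀ f : k[X], algebraMap K (AlgebraicClosure L) (algebraMap k[X] K f) =
      algebraMap k[X] (AlgebraicClosure L) f := fun f => rfl
  have hkX : ∀ x : k, algebraMap k[X] K (C x) = algebraMap k K x := fun x => Subtype.ext
    (IsScalarTower.algebraMap_apply k k[X] (AlgebraicClosure L) x).symm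
  have : IsScalarTower k k[X] K := IsScalarTower.of_algebraMap_eq fun x => (hkX x).symm
  have hinj : Function.Injective (algebraMap k[X] K) := by
    rw [IsScalarTower.algebraMap_eq k[X] L K]
    exact (algebraMap L K).injective.comp (IsFractionRing.injective k[X] L)
  set y := algebraMap k[X] K X
  have hy : ∀ f : k[X], aeval y f = algebraMap k[X] K f := fun f => by
    rw [aeval_algebraMap_apply, aeval_X_left_apply]
  refine ⟨K, inferInstance, inferInstance, y, v, IntermediateField.AdjoinSimple.gen L w, ?_, ?_, ?_⟩
  · refine (transcendental_iff).mpr fun f hf => ?_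
    rw [hy] at hf
    exact (map_eq_zero_iff _ hinj).mp hf
  · intro x
    obtain ⟨r, s, rfl⟩ := hv x
    obtain ⟨a, c, hc, rfl⟩ := IsFractionRing.div_surjective (A := k[X]) r
    obtain ⟨b, d, hd, rfl⟩ := IsFractionRing.div_surjective (A := k[X]) s
    have hc0 := nonZeroDivisors.ne_zero hc
    have hd0 := nonZeroDivisors.ne_zero hd
    refine ⟨a * d, b * c, c * d, mul_ne_zero hc0 hd0, ?_⟩
    have hc1 : algebraMap k[X] K c ≠ 0 := (map_ne_zero_iff _ hinj).mpr hc0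
    have hd1 : algebraMap k[X] K d ≠ 0 := (map_ne_zero_iff _ hinj).mpr hd0
    simp only [hy, map_mul, map_div₀, ← IsScalarTower.algebraMap_apply]
    field_simp
  · rw [aeval_def, eval₂_map] at hP
    apply (algebraMap K (AlgebraicClosure L)).injective
    rw [hom_eval₂, map_zero, IntermediateField.AdjoinSimple.algebraMap_gen]
    convert hP using 2
    ext x
    · simp only [← hkX, hKX, RingHom.comp_apply, RingHom.coe_coe, aeval_C, expand_C]
      rfl
    · simp only [y, map_pow, hKX, RingHom.comp_apply, RingHom.coe_coe, aeval_X, expand_X]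
      rfl

/-- If the specializations of a monic polynomial `P` at the powers of `τ` all have roots of degree
at most two over the number field `k`, then `P` itself has a root in a quadratic extension of a
rational function field, after a substitution `X ↦ X ^ E`. -/
theorem Monic.exists_quadratic_root {k : Type} [Field k] [NumberField k] {P : k[X][X]}
    (hP : P.Monic) {τ : k} (hτ0 : τ ≠ 0) (hroot : ∀ n : ℕ, 0 < n → τ ^ n ≠ 1)
    (ζ : ℕ → AlgebraicClosure k)
    (hζ : ∀ m, aeval (ζ m) (P.map (evalRingHom (τ ^ m))) = 0)
    (h2 : ∀ m, Module.finrank k (IntermediateField.adjoin k {ζ m}) ≤ 2) :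
    ∃ E : ℕ, 0 < E ∧ ∃ (K : Type) (_ : Field K) (_ : Algebra k K) (y v z : K),
      Transcendental k y ∧
      (∀ x : K, ∃ a b c : k[X], c ≠ 0 ∧ aeval y c * x = aeval y a + aeval y b * v) ∧
      P.eval₂ (aeval (y ^ E) : k[X] →ₐ[k] K) z = 0 := by
  choose s p hsp hconj using fun m =>
    exists_quadratic_of_finrank_le_two (Algebra.IsIntegral.isIntegral (ζ m)) (h2 m)
  obtain ⟨Q, hQ, hQ'⟩ := hP.exists_monic_eval₂_add_mul
  have hQr : ∀ m, (Q.map (evalRingHom (τ ^ m))).eval (s m) = 0 ∧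
      (Q.map (evalRingHom (τ ^ m))).eval (p m) = 0 := by
    intro m
    have h₂ := hconj m _ (hζ m)
    have h₁ := hζ m
    rw [aeval_def, eval₂_map] at h₁ h₂
    obtain ⟨h₃, h₄⟩ := hQ' _ _ _ _ h₁ h₂
    rw [add_sub_cancel, ← eval₂_map, eval₂_at_apply, map_eq_zero] at h₃
    rw [show ζ m * (algebraMap k (AlgebraicClosure k) (s m) - ζ m) =
      algebraMap k (AlgebraicClosure k) (p m) by linear_combination -hsp m, ← eval₂_map,
      eval₂_at_apply, map_eq_zero] at h₄
    exact ⟨h₃, h₄⟩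
  obtain ⟨E, hE, q, hq⟩ := hQ.exists_polynomial_roots hτ0 hroot
    (fun a : Bool => cond a s p) (fun a m => by cases a <;> simp [hQr m])
  refine ⟨E, hE, ?_⟩
  by_contra hcon
  obtain ⟨r, hr, U, V, hUV⟩ := exists_bezout_of_forall_eval₂ (X ^ 2 - C (q true) * X + C (q false))
    (P.map (Polynomial.expand k E : k[X] →+* k[X]))
    fun w h₁ h₂ => hcon (exists_quadratic_function_field h₁ h₂)
  have hinj := injective_pow_of_forall_ne_one hτ0 hroot
  refine hr (eq_zero_of_infinite_isRoot r ((hq.image hinj.injOn).mono ?_))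
  rintro _ ⟨i, hi, rfl⟩
  have h := congrArg (fun f => aeval (ζ (E * i)) (f.map (evalRingHom (τ ^ i)))) hUV
  simp only [Polynomial.map_add, Polynomial.map_mul, map_add, map_mul, map_C, aeval_C,
    map_expand_map_evalRingHom] at h
  rw [← pow_mul, mul_comm i E, hζ, mul_zero, add_zero] at h
  have h3 : aeval (ζ (E * i)) ((X ^ 2 - C (q true) * X + C (q false) : k[X][X]).map
      (evalRingHom (τ ^ i))) = 0 := by
    have h4 := hsp (E * i)
    rw [show s (E * i) = _ from hi true, show p (E * i) = _ from hi false] at h4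
    simpa using h4
  simp only [Polynomial.map_add, map_add, map_C, aeval_C] at h3
  rw [h3, mul_zero] at h
  exact ((map_eq_zero _).mp h.symm)

end Polynomial

lemma eval₂_aeval_vec {k L : Type} [Field k] [CommRing L] [Algebra k L]
    (F : MvPolynomial (Fin 3) k) (f : Polynomial k) (ψ : Polynomial k →ₐ[k] L) (z : L) :
    (aeval ![Polynomial.C f, 1, Polynomial.X] F : Polynomial (Polynomial k)).eval₂
      (ψ : Polynomial k →+* L) z = aeval ![ψ f, 1, z] F := by
  rw [← Polynomial.coe_eval₂RingHom, map_aeval, aeval_def, coe_eval₂Hom]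
  congr 1
  · ext x
    simp only [RingHom.comp_apply, Polynomial.algebraMap_apply, Polynomial.coe_eval₂RingHom,
      Polynomial.eval₂_C, RingHom.coe_coe, Algebra.algebraMap_self, RingHom.id_apply]
    exact ψ.commutes x
  · funext i
    fin_cases i <;> simp

/-- A smooth plane quartic over a number field does not have points of degree at most two in all
fibres of `X / Y` above `a + b * τ ^ m`. -/
theorem not_forall_exists_quadratic_point {k : Type} [Field k] [NumberField k]
    {F : MvPolynomial (Fin 3) k} (hF : F.IsHomogeneous 4) (hJ : HasPrimaryJacobian F)
    {a b τ : k} (hb : b ≠ 0) (hτ0 : τ ≠ 0) (hroot : ∀ n : ℕ, 0 < n → τ ^ n ≠ 1)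
    (z : ℕ → AlgebraicClosure k)
    (hz : ∀ m, aeval ![algebraMap k (AlgebraicClosure k) (a + b * τ ^ m), 1, z m] F = 0)
    (h2 : ∀ m, Module.finrank k (IntermediateField.adjoin k {z m}) ≤ 2) : False := by
  set f : Polynomial k := Polynomial.C a + Polynomial.C b * Polynomial.X
  set Φ : Polynomial (Polynomial k) := aeval ![Polynomial.C f, 1, Polynomial.X] F
  set ψ : ℕ → Polynomial k →ₐ[k] AlgebraicClosure k := fun m =>
    Polynomial.aeval (algebraMap k (AlgebraicClosure k) (τ ^ m))
  have hψ : ∀ m g, ψ m g = algebraMap k (AlgebraicClosure k) (g.eval (τ ^ m)) := fun m g =>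
    Polynomial.aeval_algebraMap_apply_eq_algebraMap_eval _ _
  have hψz : ∀ m, Φ.eval₂ (ψ m : Polynomial k →+* AlgebraicClosure k) (z m) = 0 := fun m => by
    rw [eval₂_aeval_vec, hψ, ← hz m]
    simp [f]
  have hΦ0 : Φ ≠ 0 := by
    intro h
    refine lineRestrict_ne_zero hF hJ (q := ![a, 1, 0]) (p := ![0, 0, 1]) (j := 2) rfl rfl
      (fun h => one_ne_zero (congrFun h 1)) ?_
    have h1 := eval₂_aeval_vec F f (Polynomial.aeval (0 : Polynomial k)) Polynomial.X
    rw [show aeval ![Polynomial.C f, 1, Polynomial.X] F = Φ from rfl, h, Polynomial.eval₂_zero] at h1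
    rw [lineRestrict, h1]
    congr 2
    funext i
    fin_cases i <;> simp [f]
  have hΦd : 1 ≤ Φ.natDegree := by
    by_contra hcon
    obtain ⟨g, hg⟩ := Polynomial.natDegree_eq_zero.mp (by omega : Φ.natDegree = 0)
    refine hΦ0 ?_
    rw [← hg, Polynomial.eq_zero_of_infinite_isRoot g ((Set.infinite_range_of_injective
      (injective_pow_of_forall_ne_one hτ0 hroot)).mono ?_), map_zero]
    rintro _ ⟨m, rfl⟩
    have h := hψz m
    rw [← hg, Polynomial.eval₂_C, RingHom.coe_coe, hψ] at h
    exact (map_eq_zero _).mp h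
  have hP := Polynomial.monic_integralNormalization hΦ0
  obtain ⟨E, hE, K, _, _, y, v, w, hy, hgen, hw⟩ := hP.exists_quadratic_root hτ0 hroot
    (fun m => ψ m Φ.leadingCoeff * z m) (fun m => by
      rw [Polynomial.aeval_def, Polynomial.eval₂_map, show (algebraMap k (AlgebraicClosure k)).comp
        (Polynomial.evalRingHom (τ ^ m)) = (ψ m : Polynomial k →+* AlgebraicClosure k) from
          RingHom.ext fun g => (hψ m g).symm]
      refine (Polynomial.integralNormalization_eval₂_leadingCoeff_mul hΦd _ _).trans ?_
      rw [hψz, mul_zero]) (fun m => by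
      have : FiniteDimensional k (IntermediateField.adjoin k {z m}) :=
        IntermediateField.adjoin.finiteDimensional (Algebra.IsIntegral.isIntegral _)
      refine le_trans (IntermediateField.finrank_le_of_le_right ?_) (h2 m)
      rw [IntermediateField.adjoin_simple_le_iff, hψ]
      exact mul_mem (IntermediateField.algebraMap_mem _ _)
        (IntermediateField.mem_adjoin_simple_self k _))
  have hyE : Transcendental k (y ^ E) := hy.pow hE
  have hl : Polynomial.aeval (y ^ E) Φ.leadingCoeff ≠ 0 :=
    aeval_ne_zero_of_transcendental hyE (Polynomial.leadingCoeff_ne_zero.mpr hΦ0)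
  have hw' : Φ.eval₂ (Polynomial.aeval (y ^ E) : Polynomial k →ₐ[k] K)
      (w / Polynomial.aeval (y ^ E) Φ.leadingCoeff) = 0 := by
    have h := Polynomial.integralNormalization_eval₂_leadingCoeff_mul hΦd
      ((Polynomial.aeval (y ^ E) : Polynomial k →ₐ[k] K) : Polynomial k →+* K)
      (w / Polynomial.aeval (y ^ E) Φ.leadingCoeff)
    rw [RingHom.coe_coe, mul_div_cancel₀ _ hl, hw] at h
    exact (mul_eq_zero.mp h.symm).resolve_left (pow_ne_zero _ hl)
  rw [eval₂_aeval_vec] at hw'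
  have h := isAlgebraic_of_quadratic hy hgen hF hJ (j := 1) rfl hw' 0
  refine hyE ?_
  have h1 : y ^ E = algebraMap k K b⁻¹ * (Polynomial.aeval (y ^ E) f - algebraMap k K a) := by
    have : algebraMap k K b ≠ 0 := (_root_.map_ne_zero _).mpr hb
    simp [f, this]
  rw [h1]
  exact (isAlgebraic_algebraMap _).mul (h.sub (isAlgebraic_algebraMap _))

lemma finite_setOf_aeval_eq_zero {k L : Type} [Field k] [CharZero k] [Field L] [Algebra k L]
    {F : MvPolynomial (Fin 3) k} (hF : F.IsHomogeneous 4) (hJ : HasPrimaryJacobian F) (x : k) :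
    {z : L | aeval ![algebraMap k L x, 1, z] F = 0}.Finite := by
  have h := lineRestrict_ne_zero hF hJ (q := ![x, 1, 0]) (p := ![0, 0, 1]) (j := 2) rfl rfl
    (fun h => one_ne_zero (congrFun h 1))
  refine ((lineRestrict F ![x, 1, 0] ![0, 0, 1]).rootSet_finite L).subset fun z hz => ?_
  rw [Polynomial.mem_rootSet_of_ne h, aeval_lineRestrict, ← show _ = _ from hz]
  congr 2
  funext i
  fin_cases i <;> simp

/-- Quadratic arithmetic and geometric progression sequences on a smooth plane quartic over a
number field have finite length. -/
theorem not_injective_of_quadratic_progression {k : Type} [Field k] [NumberField k]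
    {F : MvPolynomial (Fin 3) k} (hF : F.IsHomogeneous 4) (hJ : HasPrimaryJacobian F)
    {x : ℕ → k} (hx : IsGeomProg x ∨ IsArithProg x) {P : ℕ → Fin 3 → AlgebraicClosure k}
    (hinj : Function.Injective P) (hP : ∀ i,
      eval (P i) (map (algebraMap k (AlgebraicClosure k)) F) = 0 ∧
      P i 0 = algebraMap k (AlgebraicClosure k) (x i) ∧ P i 1 = 1 ∧
      Module.finrank k (IntermediateField.adjoin k (Set.range (P i))) ≤ 2) : False := by
  have hPv : ∀ i, P i = ![algebraMap k (AlgebraicClosure k) (x i), 1, P i 2] := fun i => by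
    funext j
    fin_cases j
    · exact (hP i).2.1
    · exact (hP i).2.2.1
    · rfl
  have h0 : ∀ i, aeval ![algebraMap k (AlgebraicClosure k) (x i), 1, P i 2] F = 0 := fun i => by
    rw [← hPv, aeval_def, ← eval_map]
    exact (hP i).1
  have h2 : ∀ i, Module.finrank k (IntermediateField.adjoin k {P i 2}) ≤ 2 := fun i => by
    have : FiniteDimensional k (IntermediateField.adjoin k (Set.range (P i))) :=
      IntermediateField.finiteDimensional_adjoin fun _ _ => Algebra.IsIntegral.isIntegral _
    refine le_trans (IntermediateField.finrank_le_of_le_right ?_) (hP i).2.2.2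
    exact IntermediateField.adjoin.mono _ _ _ (Set.singleton_subset_iff.mpr ⟨2, rfl⟩)
  rcases hx with ⟨t, t', ht, ht', hx⟩ | ⟨t, t', ht, ht', hx⟩
  · by_cases hroot : ∀ n : ℕ, 0 < n → t ^ n ≠ 1
    · refine not_forall_exists_quadratic_point hF hJ (a := 0) (mul_ne_zero ht' ht) ht hroot
        (fun m => P m 2) (fun m => ?_) fun m => h2 m
      rw [← h0 m, hx m]
      ring_nf
    · push Not at hroot
      obtain ⟨n, hn, hn1⟩ := hroot
      have hmul : Function.Injective fun m : ℕ => P (n * m) 2 := by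
        intro m m' h
        have hxx : ∀ m : ℕ, x (n * m) = t' * t := fun m => by
          rw [hx, pow_succ, pow_mul, hn1, one_pow, one_mul]
        have : P (n * m) = P (n * m') := by
          rw [hPv (n * m), hPv (n * m'), hxx, hxx, show P (n * m) 2 = P (n * m') 2 from h]
        exact Nat.eq_of_mul_eq_mul_left hn (hinj this)
      refine Set.infinite_range_of_injective hmul
        ((finite_setOf_aeval_eq_zero hF hJ (t' * t)).subset ?_)
      rintro _ ⟨m, rfl⟩
      have h := h0 (n * m)
      rwa [hx, pow_succ, pow_mul, hn1, one_pow, one_mul] at h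
  · refine not_forall_exists_quadratic_point hF hJ (a := t') ht (two_ne_zero (α := k))
      (fun n hn h => ?_) (fun m => P (2 ^ m - 1) 2) (fun m => ?_) fun m => h2 _
    · have : 2 ^ n = 1 := by exact_mod_cast h
      exact hn.ne' ((Nat.pow_eq_one.mp this).resolve_left (by norm_num))
    · have h := h0 (2 ^ m - 1)
      rw [hx, Nat.sub_add_cancel Nat.one_le_two_pow, mul_comm] at h
      exact_mod_cast h

/-- **Quadratic progressions on plane quartics are finite, but `n`-level ones are infinite.**
Let `C` be a smooth projective plane quartic curve over a number field `k` with `C(k) ≠ ∅`.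
Then every quadratic (i.e. `2`-level) arithmetic or geometric progression sequence on `C` is
of finite length — there is no infinite sequence of pairwise distinct points
`(x i : 1 : z i)` on `C` of degree at most `2` over `k` with the `x i` in arithmetic or
geometric progression — yet `C` is trigonal, `gon(C,k) = 3`, and for every `n ≥ 3` the curve
`C` admits (on a plane model obtained by a `k`-linear change of coordinates) an `n`-level
progression sequence of infinite length, both of arithmetic and of geometric type. -/
theorem plane_quartic_quadratic_progressions_finite_but_n_level_infinite
    (k : Type) [Field k] [NumberField k]
    (F : MvPolynomial (Fin 3) k) (hF : IsSmoothPlaneCurve 4 F)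
    [IsDomain (PlaneCurveRing k F)]
    (hpt : ∃ p : Fin 3 → k, (∃ j, p j = 1) ∧ eval p F = 0) :
    (∀ x : ℕ → k, (IsGeomProg x ∨ IsArithProg x) →
      ∀ P : ℕ → Fin 3 → AlgebraicClosure k, Function.Injective P →
        (∀ i, eval (P i) (map (algebraMap k (AlgebraicClosure k)) F) = 0 ∧
          P i 0 = algebraMap k (AlgebraicClosure k) (x i) ∧ P i 1 = 1 ∧
          Module.finrank k (IntermediateField.adjoin k (Set.range (P i))) ≤ 2) →
        False) ∧
    gonality k (FractionRing (PlaneCurveRing k F)) = 3 ∧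
    (∀ n : ℕ, 3 ≤ n →
      ∃ F' : MvPolynomial (Fin 3) k, IsLinearChange F F' ∧
        (∃ x : ℕ → k, IsGeomProg x ∧ Function.Injective x ∧
          HasInfiniteLevelProg F' x n) ∧
        (∃ x : ℕ → k, IsArithProg x ∧ Function.Injective x ∧
          HasInfiniteLevelProg F' x n)) := by
  have hJ := hF.hasPrimaryJacobian
  obtain ⟨p, ⟨j, hj⟩, hp⟩ := hpt
  exact ⟨fun x hx P hinj hP => not_injective_of_quadratic_progression hF.1 hJ hx hinj hP,
    gonality_fractionRing_eq_three hF.1 hJ hj hp,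
    fun n hn => exists_infinite_level_progressions hF.1 hJ hj hp hn⟩
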